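/- For each d ∈ {xd, cd}, decidability, decidability of the global consequence relation, and recursive axiomatisability are not preserved under the mapping (Log^=_d 𝒞1, Log^=_d 𝒞2) ↦ Log^=_d(𝒞1 ⊗ 𝒞2) on classes of frames closed under disjoint unions: for 𝒞1 = 𝒟 and 𝒞2 = 𝒟_fin, Log^=_d 𝒞1 and Log^=_d 𝒞2 are decidable, have decidable global consequence, and are recursively enumerable, while Log^=_d(𝒞1 ⊗ 𝒞2) is undecidable, has undecidable global consequence, and is not recursively enumerable. -/

import Mathlib

namespace OneVarEq

/-- A Kripke `M`-frame. -/
structure KFrame (M : Type) where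
  W : Type
  ne : Nonempty W
  R : M → W → W → Prop

/-- the two domain semantics: expanding (`xd`) and constant (`cd`) domains -/
inductive DSem : Type
  | xd | cd
  deriving DecidableEq

/-- disjoint union of a family of frames -/
def KFrame.disjUnion {M ι : Type} (hι : Nonempty ι) (Fs : ι → KFrame M) : KFrame M where
  W := Σ i, (Fs i).W
  ne := ⟨⟨Classical.choice hι, Classical.choice (Fs (Classical.choice hι)).ne⟩⟩
  R := fun m a b => ∃ (i : ι) (w v : (Fs i).W), (Fs i).R m w v ∧ a = ⟨i, w⟩ ∧ b = ⟨i, v⟩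

/-- a class of frames closed under (arbitrary) disjoint unions -/
def ClosedDU {M : Type} (C : Set (KFrame M)) : Prop :=
  ∀ (ι : Type) (hι : Nonempty ι) (Fs : ι → KFrame M),
    (∀ i, Fs i ∈ C) → KFrame.disjUnion hι Fs ∈ C

/-- reduct of a frame along a map of modal signatures -/
def KFrame.reduct {M M' : Type} (f : M' → M) (F : KFrame M) : KFrame M' :=
  ⟨F.W, F.ne, fun m => F.R (f m)⟩

/-- fusion `𝒞1 ⊗ 𝒞2` of classes of frames: frames over a common set of worlds
whose reducts belong to the respective classes -/
def frameFusion {M1 M2 : Type} (C1 : Set (KFrame M1)) (C2 : Set (KFrame M2)) :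
    Set (KFrame (M1 ⊕ M2)) :=
  {F | F.reduct Sum.inl ∈ C1 ∧ F.reduct Sum.inr ∈ C2}

/-- a non-trivial frame: some `R_□` relates two distinct worlds -/
def KFrame.Nontrivial {M : Type} (F : KFrame M) : Prop :=
  ∃ (m : M) (w v : F.W), w ≠ v ∧ F.R m w v

/-- terms of the one-variable language with constants: the variable `x`,
or a constant `c_k` -/
inductive ETm : Type
  | var : ETm
  | const : ℕ → ETm
  deriving DecidableEq

/-- One-variable modal formulas with equality and (non-rigid) constants. -/
inductive EF (M : Type) : Type
  | pred : ℕ → ETm → EF M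
  | eq : ETm → ETm → EF M
  | neg : EF M → EF M
  | and : EF M → EF M → EF M
  | ex : EF M → EF M
  | box : M → EF M → EF M
  deriving DecidableEq

namespace EF

variable {M : Type}

def imp (φ ψ : EF M) : EF M := .neg (.and φ (.neg ψ))

def or (φ ψ : EF M) : EF M := .neg (.and (.neg φ) (.neg ψ))

def iff (φ ψ : EF M) : EF M := .and (imp φ ψ) (imp ψ φ)

def all (φ : EF M) : EF M := .neg (.ex (.neg φ))

end EF

/-- A Kripke model with equality (expanding domains in general): a family of
normal classical structures over subsets of one big domain, with non-rigid
constants, expanding along all accessibility relations. -/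
structure EModel {M : Type} (F : KFrame M) where
  D : Type
  dom : F.W → Set D
  domNe : ∀ w, (dom w).Nonempty
  expand : ∀ (m : M) (w v : F.W), F.R m w v → dom w ⊆ dom v
  I : F.W → ℕ → Set D
  cst : F.W → ℕ → D
  cstMem : ∀ w k, cst w k ∈ dom w

namespace EModel

variable {M : Type} {F : KFrame M}

/-- a `d`-model: for `cd`, all the domains coincide (with the common domain) -/
def IsD (𝔪 : EModel F) (d : DSem) : Prop :=
  d = DSem.cd → ∀ w, 𝔪.dom w = Set.univ

/-- value of a term at a world under an assignment -/
def tmVal (𝔪 : EModel F) (w : F.W) (a : 𝔪.D) : ETm → 𝔪.D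
  | .var => a
  | .const k => 𝔪.cst w k

/-- truth at a world under an assignment; `=` is interpreted as identity -/
def eval (𝔪 : EModel F) : EF M → F.W → 𝔪.D → Prop
  | .pred n t, w, a => 𝔪.tmVal w a t ∈ 𝔪.I w n
  | .eq t₁ t₂, w, a => 𝔪.tmVal w a t₁ = 𝔪.tmVal w a t₂
  | .neg φ, w, a => ¬ 𝔪.eval φ w a
  | .and φ ψ, w, a => 𝔪.eval φ w a ∧ 𝔪.eval ψ w a
  | .ex φ, w, _ => ∃ b ∈ 𝔪.dom w, 𝔪.eval φ w b
  | .box m φ, w, a => ∀ v, F.R m w v → 𝔪.eval φ v a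

def TrueAt (𝔪 : EModel F) (φ : EF M) (w : F.W) : Prop :=
  ∀ a ∈ 𝔪.dom w, 𝔪.eval φ w a

def TrueIn (𝔪 : EModel F) (φ : EF M) : Prop := ∀ w, 𝔪.TrueAt φ w

end EModel

/-- `Log^=_d 𝒞`: formulas with equality true in every `d`-model with equality
based on a frame from `𝒞` -/
def LogED {M : Type} (d : DSem) (C : Set (KFrame M)) : Set (EF M) :=
  {φ | ∀ F ∈ C, ∀ 𝔪 : EModel F, 𝔪.IsD d → 𝔪.TrueIn φ}

/-- global consequence `φ ⊢*_L ψ` -/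
inductive GlobalConseqE {M : Type} (L : Set (EF M)) (φ : EF M) : EF M → Prop
  | ax {ψ} : ψ ∈ L → GlobalConseqE L φ ψ
  | prem : GlobalConseqE L φ φ
  | mp {ψ χ} : GlobalConseqE L φ (EF.imp ψ χ) → GlobalConseqE L φ ψ → GlobalConseqE L φ χ
  | gen {ψ} : GlobalConseqE L φ ψ → GlobalConseqE L φ (EF.all ψ)
  | nec (m : M) {ψ} : GlobalConseqE L φ ψ → GlobalConseqE L φ (EF.box m ψ)

/-- Gödel numbering of terms -/
def ETm.code : ETm → ℕ
  | .var => 0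
  | .const k => k + 1

/-- the fixed Gödel numbering of formulas with equality (relative to a
numbering `eM` of the modal operators) -/
def EF.encode {M : Type} (eM : M → ℕ) : EF M → ℕ
  | .pred n t => Nat.pair 0 (Nat.pair n t.code)
  | .eq t₁ t₂ => Nat.pair 1 (Nat.pair t₁.code t₂.code)
  | .neg φ => Nat.pair 2 (EF.encode eM φ)
  | .and φ ψ => Nat.pair 3 (Nat.pair (EF.encode eM φ) (EF.encode eM ψ))
  | .ex φ => Nat.pair 4 (EF.encode eM φ)
  | .box m φ => Nat.pair 5 (Nat.pair (eM m) (EF.encode eM φ))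

/-- decidability of a set of formulas w.r.t. the fixed Gödel numbering -/
def DecidableELogic {M : Type} (eM : M → ℕ) (L : Set (EF M)) : Prop :=
  ComputablePred (fun n : ℕ => ∃ φ ∈ L, EF.encode eM φ = n)

/-- decidability of the global consequence relation of `L` -/
def GloballyDecidableE {M : Type} (eM : M → ℕ) (L : Set (EF M)) : Prop :=
  ComputablePred (fun p : ℕ × ℕ =>
    ∃ φ ψ, GlobalConseqE L φ ψ ∧ EF.encode eM φ = p.1 ∧ EF.encode eM ψ = p.2)

/-- recursive enumerability (= recursive axiomatisability) of a set of
formulas w.r.t. the fixed Gödel numbering -/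
def REELogic {M : Type} (eM : M → ℕ) (L : Set (EF M)) : Prop :=
  REPred (fun n : ℕ => ∃ φ ∈ L, EF.encode eM φ = n)

/-- the class `𝒟` of all disjoint unions of difference frames -/
def Dclass : Set (KFrame Unit) :=
  {F | ∃ (ι : Type) (f : F.W → ι), ∀ w v, F.R () w v ↔ (f w = f v ∧ w ≠ v)}

/-- the class `𝒟_fin` of all disjoint unions of finite difference frames -/
def DfinClass : Set (KFrame Unit) :=
  {F | ∃ (ι : Type) (f : F.W → ι),
    (∀ w v, F.R () w v ↔ (f w = f v ∧ w ≠ v)) ∧ ∀ w, {v | f v = f w}.Finite}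

/-- numbering of the trivial monomodal signature -/
def eU : Unit → ℕ := fun _ => 0

/-- numbering of the bimodal signature `Unit ⊕ Unit` -/
def eUU : Unit ⊕ Unit → ℕ := Sum.elim (fun _ => 0) (fun _ => 1)

end OneVarEq


namespace OneVarEq

/-! ### Part A: undecidability of the fusion -/

abbrev MM := Unit ⊕ Unit

def op : Bool → MM
  | false => Sum.inl ()
  | true => Sum.inr ()

namespace Fm
def mark (n : ℕ) : EF MM := .pred n (.const 0)
def rt (m : Bool) : EF MM := mark (if m then 1 else 0)
def ac : EF MM := mark 2
def vr (k : ℕ) : EF MM := .pred (3 + k) .var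
def bx (m : Bool) (φ : EF MM) : EF MM := .box (op m) φ
def di (m : Bool) (φ : EF MM) : EF MM := .neg (.box (op m) (.neg φ))
def tt : EF MM := .eq .var .var
def conj : List (EF MM) → EF MM
  | [] => tt
  | φ :: l => .and φ (conj l)
end Fm
open Fm

section evalLemmas
variable {M : Type} {F : KFrame M} (𝔪 : EModel F) (w : F.W) (a : 𝔪.D)

theorem eval_imp (φ ψ : EF M) : 𝔪.eval (EF.imp φ ψ) w a ↔ (𝔪.eval φ w a → 𝔪.eval ψ w a) := by
  simp only [EF.imp, EModel.eval]; tauto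

theorem eval_or (φ ψ : EF M) : 𝔪.eval (EF.or φ ψ) w a ↔ (𝔪.eval φ w a ∨ 𝔪.eval ψ w a) := by
  simp only [EF.or, EModel.eval]; tauto

theorem eval_iff (φ ψ : EF M) : 𝔪.eval (EF.iff φ ψ) w a ↔ (𝔪.eval φ w a ↔ 𝔪.eval ψ w a) := by
  simp only [EF.iff, EF.imp, EModel.eval]; tauto

theorem eval_all (φ : EF M) : 𝔪.eval (EF.all φ) w a ↔ ∀ b ∈ 𝔪.dom w, 𝔪.eval φ w b := by
  simp only [EF.all, EModel.eval]; push Not; rfl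

theorem eval_and (φ ψ : EF M) : 𝔪.eval (EF.and φ ψ) w a ↔ (𝔪.eval φ w a ∧ 𝔪.eval ψ w a) := Iff.rfl

theorem eval_neg (φ : EF M) : 𝔪.eval (EF.neg φ) w a ↔ ¬ 𝔪.eval φ w a := Iff.rfl

theorem eval_ex (φ : EF M) : 𝔪.eval (EF.ex φ) w a ↔ ∃ b ∈ 𝔪.dom w, 𝔪.eval φ w b := Iff.rfl
end evalLemmas

section evalLemmas2
variable {F : KFrame MM} (𝔪 : EModel F) (w : F.W) (a : 𝔪.D)

theorem eval_bx (m : Bool) (φ : EF MM) :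
    𝔪.eval (bx m φ) w a ↔ ∀ v, F.R (op m) w v → 𝔪.eval φ v a := Iff.rfl

theorem eval_di (m : Bool) (φ : EF MM) :
    𝔪.eval (di m φ) w a ↔ ∃ v, F.R (op m) w v ∧ 𝔪.eval φ v a := by
  simp only [di, EModel.eval]; push Not; rfl

theorem eval_tt : 𝔪.eval tt w a ↔ True := by simp [tt, EModel.eval]

theorem eval_conj (l : List (EF MM)) : 𝔪.eval (conj l) w a ↔ ∀ φ ∈ l, 𝔪.eval φ w a := by
  induction l with
  | nil => simp [conj, eval_tt]
  | cons φ l ih => simp [conj, eval_and, ih]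

theorem eval_mark (n : ℕ) : 𝔪.eval (mark n) w a ↔ 𝔪.cst w 0 ∈ 𝔪.I w n := Iff.rfl
theorem eval_vr (k : ℕ) : 𝔪.eval (vr k) w a ↔ a ∈ 𝔪.I w (3 + k) := Iff.rfl
end evalLemmas2

/-- frames of the fusion, unfolded -/
def Fus : Set (KFrame MM) := frameFusion Dclass DfinClass

theorem Fus.cls {F : KFrame MM} (hF : F ∈ Fus) (m : Bool) :
    ∃ (ι : Type) (f : F.W → ι), ∀ w v, F.R (op m) w v ↔ (f w = f v ∧ w ≠ v) := by
  obtain ⟨h1, h2⟩ := hF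
  cases m with
  | false => exact h1
  | true => obtain ⟨ι, f, h, -⟩ := h2; exact ⟨ι, f, h⟩

theorem Fus.symm {F : KFrame MM} (hF : F ∈ Fus) {m : Bool} {w v : F.W} (h : F.R (op m) w v) :
    F.R (op m) v w := by
  obtain ⟨ι, f, hf⟩ := Fus.cls hF m
  rw [hf] at *; exact ⟨h.1.symm, h.2.symm⟩

theorem Fus.sib {F : KFrame MM} (hF : F ∈ Fus) {m : Bool} {w v v' : F.W} (h : F.R (op m) w v)
    (h' : F.R (op m) w v') (hne : v ≠ v') : F.R (op m) v v' := by
  obtain ⟨ι, f, hf⟩ := Fus.cls hF m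
  rw [hf] at *; exact ⟨h.1.symm.trans h'.1, hne⟩

theorem Fus.dom_eq {F : KFrame MM} (hF : F ∈ Fus) (𝔪 : EModel F) {m : Bool} {w v : F.W}
    (h : F.R (op m) w v) : 𝔪.dom v = 𝔪.dom w :=
  Set.Subset.antisymm (𝔪.expand _ _ _ (Fus.symm hF h)) (𝔪.expand _ _ _ h)

/-! ### tree models -/

/-- direction of a path -/
def dirOf {N : ℕ} : List (Fin N) → Bool
  | [] => true
  | _ :: q => !dirOf q

def clsOf {N : ℕ} (m : Bool) (p : List (Fin N)) : Option (List (Fin N)) :=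
  if dirOf p = m then some p else
    match p with
    | [] => none
    | _ :: q => some q

theorem clsOf_self {N : ℕ} {m : Bool} {p : List (Fin N)} (h : dirOf p = m) :
    clsOf m p = some p := by simp [clsOf, h]

theorem clsOf_cons {N : ℕ} {m : Bool} {p : List (Fin N)} (j : Fin N) (h : dirOf p = m) :
    clsOf m (j :: p) = some p := by simp [clsOf, dirOf, h]

theorem clsOf_eq_some {N : ℕ} {m : Bool} {p q : List (Fin N)} (h : clsOf m q = some p) :
    q = p ∨ ∃ j, q = j :: p := by
  unfold clsOf at h
  split_ifs at h with h1
  · left; simpa using h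
  · cases q with
    | nil => simp at h
    | cons j q => right; exact ⟨j, by simpa using h⟩

theorem clsOf_eq_none {N : ℕ} {m : Bool} {q : List (Fin N)} (h : clsOf m q = none) :
    q = [] := by
  unfold clsOf at h
  split_ifs at h with h1
  cases q with
  | nil => rfl
  | cons j q => simp at h

def treeFrame (N : ℕ) : KFrame MM where
  W := List (Fin N)
  ne := ⟨[]⟩
  R := fun m p q => clsOf (Sum.elim (fun _ => false) (fun _ => true) m) p =
      clsOf (Sum.elim (fun _ => false) (fun _ => true) m) q ∧ p ≠ q

theorem treeFrame_R (N : ℕ) (m : Bool) (p q : List (Fin N)) :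
    (treeFrame N).R (op m) p q ↔ (clsOf m p = clsOf m q ∧ p ≠ q) := by
  cases m <;> rfl

theorem treeFrame_R_dir {N : ℕ} {m : Bool} {p : List (Fin N)} (h : dirOf p = m)
    (q : List (Fin N)) : (treeFrame N).R (op m) p q ↔ ∃ j, q = j :: p := by
  rw [treeFrame_R, clsOf_self h]
  constructor
  · rintro ⟨h1, h2⟩
    rcases clsOf_eq_some h1.symm with h3 | h3
    · exact absurd h3.symm h2
    · exact h3
  · rintro ⟨j, rfl⟩
    exact ⟨(clsOf_cons j h).symm, by simp⟩

theorem treeFrame_mem (N : ℕ) : treeFrame N ∈ Fus := by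
  refine ⟨⟨_, clsOf false, fun w v => Iff.rfl⟩, ⟨_, clsOf true, fun w v => Iff.rfl, ?_⟩⟩
  intro w
  cases h : clsOf true w with
  | none =>
    apply Set.Finite.subset (Set.finite_singleton ([] : List (Fin N)))
    intro v hv
    exact clsOf_eq_none hv
  | some p =>
    apply Set.Finite.subset ((Set.finite_singleton p).union
      (Set.finite_range (fun j : Fin N => j :: p)))
    intro v hv
    rcases clsOf_eq_some hv with h | ⟨j, rfl⟩
    · left; exact h
    · right; exact ⟨j, rfl⟩

/-- node data: predicates and activity -/
abbrev ND (N : ℕ) := (ℕ → Finset (Fin N)) × Bool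

def topEl {N : ℕ} (hN : 0 < N) (s : Finset (Fin N)) : Fin N :=
  if h : s.Nonempty then s.max' h else ⟨0, hN⟩

def treeModel {N : ℕ} (hN : 0 < N) (V : List (Fin N) → ND N) : EModel (treeFrame N) where
  D := Fin N
  dom := fun _ => Set.univ
  domNe := fun _ => ⟨⟨0, hN⟩, trivial⟩
  expand := fun _ _ _ _ => subset_rfl
  I := fun (p : List (Fin N)) n =>
    match n with
    | 0 => {_x | dirOf p = false}
    | 1 => {_x | dirOf p = true}
    | 2 => {_x | (V p).2 = true}
    | k + 3 => {x | x ∈ (V p).1 k}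
  cst := fun (p : List (Fin N)) n =>
    match n with
    | 0 => match p with
      | [] => ⟨0, hN⟩
      | j :: _ => j
    | k + 1 => topEl hN ((V p).1 k)
  cstMem := fun _ _ => trivial

def evT {N : ℕ} (hN : 0 < N) (V : List (Fin N) → ND N) (φ : EF MM) (p : List (Fin N))
    (x : Fin N) : Prop := (treeModel hN V).eval φ p x

section
variable {N : ℕ} (hN : 0 < N) (V : List (Fin N) → ND N) (p : List (Fin N)) (x : Fin N)

theorem tree_rt (m : Bool) : evT hN V (rt m) p x ↔ dirOf p = m := by
  cases m <;> rfl

theorem tree_ac : evT hN V ac p x ↔ (V p).2 = true := Iff.rfl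

theorem tree_vr (k : ℕ) : evT hN V (vr k) p x ↔ x ∈ (V p).1 k := by
  unfold vr; rw [Nat.add_comm 3 k]; rfl

theorem tree_vc (k : ℕ) (i : ℕ) : evT hN V (.pred (3 + k) (.const (i + 1))) p x ↔
    topEl hN ((V p).1 i) ∈ (V p).1 k := by
  rw [Nat.add_comm 3 k]; rfl

theorem tree_eqc (k : ℕ) : evT hN V (.eq .var (.const (k+1))) p x ↔
    x = topEl hN ((V p).1 k) := Iff.rfl

theorem tree_and (φ ψ : EF MM) : evT hN V (.and φ ψ) p x ↔ (evT hN V φ p x ∧ evT hN V ψ p x) :=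
  Iff.rfl
theorem tree_neg (φ : EF MM) : evT hN V (.neg φ) p x ↔ ¬ evT hN V φ p x := Iff.rfl
theorem tree_tt : evT hN V tt p x ↔ True := eval_tt (treeModel hN V) p x
theorem tree_imp (φ ψ : EF MM) : evT hN V (.imp φ ψ) p x ↔ (evT hN V φ p x → evT hN V ψ p x) :=
  eval_imp (treeModel hN V) p x φ ψ
theorem tree_or (φ ψ : EF MM) : evT hN V (.or φ ψ) p x ↔ (evT hN V φ p x ∨ evT hN V ψ p x) :=
  eval_or (treeModel hN V) p x φ ψ
theorem tree_iff (φ ψ : EF MM) : evT hN V (.iff φ ψ) p x ↔ (evT hN V φ p x ↔ evT hN V ψ p x) :=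
  eval_iff (treeModel hN V) p x φ ψ
theorem tree_conj (l : List (EF MM)) : evT hN V (conj l) p x ↔ ∀ φ ∈ l, evT hN V φ p x :=
  eval_conj (treeModel hN V) p x l

theorem tree_all (φ : EF MM) : evT hN V (EF.all φ) p x ↔ ∀ y : Fin N, evT hN V φ p y :=
  (eval_all (treeModel hN V) p x φ).trans ⟨fun h y => h y trivial, fun h y _ => h y⟩

theorem tree_ex (φ : EF MM) : evT hN V (EF.ex φ) p x ↔ ∃ y : Fin N, evT hN V φ p y :=
  (eval_ex (treeModel hN V) p x φ).trans ⟨fun ⟨y, _, h⟩ => ⟨y, h⟩, fun ⟨y, h⟩ => ⟨y, trivial, h⟩⟩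

theorem tree_bx {m : Bool} (hm : dirOf p = m) (φ : EF MM) : evT hN V (bx m φ) p x ↔
    ∀ j : Fin N, evT hN V φ (j :: p) x := by
  refine (eval_bx (treeModel hN V) p x m φ).trans ?_
  constructor
  · intro h j; exact h _ ((treeFrame_R_dir hm _).2 ⟨j, rfl⟩)
  · intro h v hv
    obtain ⟨j, rfl⟩ := (treeFrame_R_dir hm _).1 hv
    exact h j

theorem tree_di {m : Bool} (hm : dirOf p = m) (φ : EF MM) : evT hN V (di m φ) p x ↔
    ∃ j : Fin N, evT hN V φ (j :: p) x := by
  refine (eval_di (treeModel hN V) p x m φ).trans ?_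
  constructor
  · rintro ⟨v, hv, h⟩
    obtain ⟨j, rfl⟩ := (treeFrame_R_dir hm _).1 hv
    exact ⟨j, h⟩
  · rintro ⟨j, h⟩
    exact ⟨_, (treeFrame_R_dir hm _).2 ⟨j, rfl⟩, h⟩

/-- boxing from a child: siblings and the parent -/
theorem tree_bx' {m : Bool} (hm : dirOf p = m) (j : Fin N) (φ : EF MM)
    (h1 : evT hN V φ p x) (h2 : ∀ i, i ≠ j → evT hN V φ (i :: p) x) :
    evT hN V (bx m φ) (j :: p) x := by
  refine (eval_bx (treeModel hN V) (j :: p) x m φ).2 ?_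
  intro v hv
  replace hv := (treeFrame_R N m (j :: p) v).1 hv
  rw [clsOf_cons j hm] at hv
  rcases clsOf_eq_some hv.1.symm with rfl | ⟨i, rfl⟩
  · exact h1
  · exact h2 i (by rintro rfl; exact hv.2 rfl)
end

/-! ### representable relations -/

noncomputable def cnt {F : KFrame MM} (𝔪 : EModel F) (w : F.W) (k : ℕ) : ℕ :=
  (𝔪.I w (3 + k) ∩ 𝔪.dom w).ncard

def Sound (α : EF MM) (ρ : (ℕ → ℕ) → Prop) : Prop :=
  ∀ F ∈ Fus, ∀ (𝔪 : EModel F) (w : F.W) (a : 𝔪.D), (𝔪.dom w).Finite → 𝔪.eval α w a →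
    ρ (cnt 𝔪 w)

def Agree {N : ℕ} (V J : List (Fin N) → ND N) (q : List (Fin N)) : Prop :=
  (∀ p, (V (p.reverseAux q)).1 = (J p).1) ∧ (∀ p, p ≠ [] → (V (p.reverseAux q)).2 = (J p).2)

def Compl (m : Bool) (K : ℕ) (α : EF MM) (ρ : (ℕ → ℕ) → Prop) : Prop :=
  ∀ e, ρ e → ∃ N₀, ∀ N, N₀ ≤ N → ∀ hN : 0 < N, ∀ P : ℕ → Finset (Fin N),
    (∀ k < K, (P k).card = e k) → ∃ J : List (Fin N) → ND N, (J []).1 = P ∧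
      ∀ V q, dirOf q = m → Agree V J q → ∀ a, evT hN V α q a

def Rep (K : ℕ) (ρ : (ℕ → ℕ) → Prop) : Prop :=
  ∀ m, ∃ α, Sound α ρ ∧ Compl m K α ρ

inductive Kind | rigid | sum | free
  deriving DecidableEq

def sumClause (m : Bool) (kind : ℕ → Kind) (k : ℕ) : EF MM :=
  match kind k with
  | .rigid => .and (.all (.imp (vr k) (bx m (.imp ac (vr k)))))
      (.all (.imp (.neg (vr k)) (bx m (.imp ac (.neg (vr k))))))
  | .sum => .and (.all (.iff (vr k) (di m (.and ac (vr k)))))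
      (.all (bx m (.imp (.and ac (vr k)) (bx m (.imp (.and ac (vr k)) (rt m))))))
  | .free => tt

def sumForm (m : Bool) (K' : ℕ) (kind : ℕ → Kind) (α : EF MM) : EF MM :=
  .and (bx m (.neg (rt m))) (.and (di m ac) (.and (bx m (.imp ac α))
    (conj ((List.range K').map (sumClause m kind)))))

def SumRel (K' : ℕ) (kind : ℕ → Kind) (ρ : (ℕ → ℕ) → Prop) (e : ℕ → ℕ) : Prop :=
  ∃ l : List (ℕ → ℕ), l ≠ [] ∧ (∀ f ∈ l, ρ f ∧ ∀ k < K', kind k = .rigid → f k = e k) ∧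
    ∀ k < K', kind k = .sum → e k = (l.map (fun f => f k)).sum

theorem cnt_rigid {F : KFrame MM} (hF : F ∈ Fus) (𝔪 : EModel F) (w v : F.W) (a : 𝔪.D) (m : Bool)
    (hR : F.R (op m) w v) (hac : ∀ b, 𝔪.eval ac v b) (kind : ℕ → Kind) (k : ℕ)
    (hk : kind k = .rigid) (h : 𝔪.eval (sumClause m kind k) w a) : cnt 𝔪 v k = cnt 𝔪 w k := by
  simp only [sumClause, hk, eval_and, eval_all, eval_imp, eval_bx, eval_vr, eval_neg] at h
  unfold cnt
  congr 1
  rw [Fus.dom_eq hF 𝔪 hR]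
  ext x
  simp only [Set.mem_inter_iff]
  constructor
  · rintro ⟨h1, h2⟩
    refine ⟨?_, h2⟩
    by_contra h3
    exact h.2 x h2 h3 v hR (hac x) h1
  · rintro ⟨h1, h2⟩
    exact ⟨h.1 x h2 h1 v hR (hac x), h2⟩

theorem sound_sum {m : Bool} {K' : ℕ} {kind : ℕ → Kind} {α : EF MM} {ρ : (ℕ → ℕ) → Prop}
    (h : Sound α ρ) : Sound (sumForm m K' kind α) (SumRel K' kind ρ) := by
  classical
  intro F hF 𝔪 w a hfin hev
  simp only [sumForm, eval_and, eval_bx, eval_neg, eval_di, eval_imp, eval_conj] at hev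
  obtain ⟨hrt, ⟨v0, hv0, hac0⟩, hα, hcl⟩ := hev
  have hcl' : ∀ k < K', 𝔪.eval (sumClause m kind k) w a := by
    intro k hk; apply hcl; simp only [List.mem_map, List.mem_range]; exact ⟨k, hk, rfl⟩
  have hch : ∀ k < K', kind k = .sum → ∀ x ∈ 𝔪.dom w, x ∈ 𝔪.I w (3 + k) → ∃ v,
      F.R (op m) w v ∧ 𝔪.eval ac v a ∧ x ∈ 𝔪.I v (3 + k) := by
    intro k hk hs x hx hxk
    have := hcl' k hk
    simp only [sumClause, hs, eval_and, eval_all, eval_iff, eval_di, eval_vr] at this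
    obtain ⟨v, h1, h2, h3⟩ := (this.1 x hx).1 hxk
    exact ⟨v, h1, h2, h3⟩
  let g : ℕ × 𝔪.D → F.W := fun p =>
    if h : p.1 < K' ∧ kind p.1 = .sum ∧ p.2 ∈ 𝔪.dom w ∧ p.2 ∈ 𝔪.I w (3 + p.1) then
      (hch p.1 h.1 h.2.1 p.2 h.2.2.1 h.2.2.2).choose else v0
  have hg : ∀ p, F.R (op m) w (g p) ∧ 𝔪.eval ac (g p) a := by
    intro p
    by_cases h : p.1 < K' ∧ kind p.1 = .sum ∧ p.2 ∈ 𝔪.dom w ∧ p.2 ∈ 𝔪.I w (3 + p.1)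
    · simp only [g, dif_pos h]
      have := (hch p.1 h.1 h.2.1 p.2 h.2.2.1 h.2.2.2).choose_spec
      exact ⟨this.1, this.2.1⟩
    · simp only [g, dif_neg h]; exact ⟨hv0, hac0⟩
  have hg2 : ∀ k < K', kind k = .sum → ∀ x ∈ 𝔪.dom w, x ∈ 𝔪.I w (3 + k) →
      x ∈ 𝔪.I (g (k, x)) (3 + k) := by
    intro k hk hs x hx hxk
    have hh : (k, x).1 < K' ∧ kind (k, x).1 = .sum ∧ (k, x).2 ∈ 𝔪.dom w ∧
      (k, x).2 ∈ 𝔪.I w (3 + (k, x).1) := ⟨hk, hs, hx, hxk⟩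
    simp only [g, dif_pos hh]
    exact (hch k hk hs x hx hxk).choose_spec.2.2
  let C : Finset F.W := insert v0 (((Finset.range K') ×ˢ hfin.toFinset).image g)
  have hC : ∀ v ∈ C, F.R (op m) w v ∧ 𝔪.eval ac v a := by
    intro v hv
    simp only [C, Finset.mem_insert, Finset.mem_image] at hv
    rcases hv with rfl | ⟨p, -, rfl⟩
    · exact ⟨hv0, hac0⟩
    · exact hg p
  refine ⟨C.toList.map (cnt 𝔪), ?_, ?_, ?_⟩
  · have : v0 ∈ C.toList := by simp [C]
    intro h0
    rw [List.map_eq_nil_iff] at h0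
    rw [h0] at this; simp at this
  · intro f hf
    simp only [List.mem_map, Finset.mem_toList] at hf
    obtain ⟨v, hv, rfl⟩ := hf
    obtain ⟨h1, h2⟩ := hC v hv
    refine ⟨h F hF 𝔪 v a ?_ (hα v h1 h2), ?_⟩
    · rw [Fus.dom_eq hF 𝔪 h1]; exact hfin
    · intro k hk hr
      exact cnt_rigid hF 𝔪 w v a m h1 (fun b => h2) kind k hr (hcl' k hk)
  · intro k hk hs
    have hcl'' := hcl' k hk
    simp only [sumClause, hs, eval_and, eval_all, eval_iff, eval_di, eval_vr, eval_bx, eval_imp]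
      at hcl''
    obtain ⟨c1, c2⟩ := hcl''
    have hfs : ∀ v ∈ C, (𝔪.I v (3 + k) ∩ 𝔪.dom v).Finite := by
      intro v hv
      rw [Fus.dom_eq hF 𝔪 (hC v hv).1]
      exact hfin.subset Set.inter_subset_right
    have hun : 𝔪.I w (3 + k) ∩ 𝔪.dom w = ⋃ v ∈ C, (𝔪.I v (3 + k) ∩ 𝔪.dom v) := by
      ext x
      simp only [Set.mem_inter_iff, Set.mem_iUnion, exists_prop]
      constructor
      · rintro ⟨h1, h2⟩
        refine ⟨g (k, x), ?_, hg2 k hk hs x h2 h1, ?_⟩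
        · apply Finset.mem_insert_of_mem
          apply Finset.mem_image_of_mem
          simp [hk, h2]
        · rw [Fus.dom_eq hF 𝔪 (hg (k, x)).1]; exact h2
      · rintro ⟨v, hv, h1, h2⟩
        rw [Fus.dom_eq hF 𝔪 (hC v hv).1] at h2
        exact ⟨(c1 x h2).2 ⟨v, (hC v hv).1, (hC v hv).2, h1⟩, h2⟩
    rw [List.map_map]
    change cnt 𝔪 w k = (C.toList.map (fun v => cnt 𝔪 v k)).sum
    rw [Finset.sum_map_toList]
    unfold cnt
    rw [hun]
    have hdis : (C : Set F.W).PairwiseDisjoint (fun v => 𝔪.I v (3 + k) ∩ 𝔪.dom v) := by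
      intro v hv v' hv' hne
      rw [Function.onFun, Set.disjoint_left]
      rintro x ⟨h1, h2⟩ ⟨h1', h2'⟩
      rw [Fus.dom_eq hF 𝔪 (hC v hv).1] at h2
      have := c2 x h2 v (hC v hv).1 ⟨(hC v hv).2, h1⟩ v'
        (Fus.sib hF (hC v hv).1 (hC v' hv').1 hne) ⟨(hC v' hv').2, h1'⟩
      exact hrt v' (hC v' hv').1 this
    have key : ∀ s : Finset F.W, (∀ v ∈ s, v ∈ C) →
        (⋃ v ∈ s, (𝔪.I v (3 + k) ∩ 𝔪.dom v)).ncard = ∑ v ∈ s, (𝔪.I v (3 + k) ∩ 𝔪.dom v).ncard := by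
      intro s
      induction s using Finset.induction_on with
      | empty => intro _; simp
      | insert v s hvs ih =>
        intro hs
        rw [Finset.sum_insert hvs, Finset.set_biUnion_insert, Set.ncard_union_eq ?_ ?_ ?_, ih]
        · intro u hu; exact hs u (Finset.mem_insert_of_mem hu)
        · rw [Set.disjoint_iUnion₂_right]
          intro u hu
          exact hdis (hs v (Finset.mem_insert_self _ _)) (hs u (Finset.mem_insert_of_mem hu))
            (by rintro rfl; exact hvs hu)
        · exact hfs v (hs v (Finset.mem_insert_self _ _))
        · apply Set.Finite.biUnion (Finset.finite_toSet s)
          intro u hu; exact hfs u (hs u (Finset.mem_insert_of_mem hu))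
    exact key C (fun v hv => hv)

end OneVarEq

namespace OneVarEq
open Fm

theorem exists_pieces {γ : Type} [DecidableEq γ] {n : ℕ} (c : Fin n → ℕ) (s : Finset γ)
    (h : s.card = ∑ i, c i) : ∃ A : Fin n → Finset γ, (∀ i, (A i).card = c i) ∧
      (∀ x, x ∈ s ↔ ∃ i, x ∈ A i) ∧ ∀ i j x, x ∈ A i → x ∈ A j → i = j := by
  have : Fintype.card s = Fintype.card (Σ i, Fin (c i)) := by simp [h]
  let E := Fintype.equivOfCardEq this
  refine ⟨fun i => (Finset.univ : Finset (Fin (c i))).map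
    ⟨fun y => ((E.symm ⟨i, y⟩ : s) : γ), ?_⟩, ?_, ?_, ?_⟩
  · intro y y' hy
    have := E.symm.injective (Subtype.ext hy)
    simpa using this
  · intro i; simp
  · intro x
    constructor
    · intro hx
      refine ⟨(E ⟨x, hx⟩).1, ?_⟩
      simp only [Finset.mem_map, Finset.mem_univ, true_and]
      exact ⟨(E ⟨x, hx⟩).2, congrArg Subtype.val (E.symm_apply_apply ⟨x, hx⟩)⟩
    · rintro ⟨i, hi⟩
      simp only [Finset.mem_map, Finset.mem_univ, true_and] at hi
      obtain ⟨y, rfl⟩ := hi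
      exact (E.symm ⟨i, y⟩).2
  · intro i j x hi hj
    simp only [Finset.mem_map, Finset.mem_univ, true_and] at hi hj
    obtain ⟨y, hy⟩ := hi
    obtain ⟨z, hz⟩ := hj
    have := E.symm.injective (Subtype.ext (hy.trans hz.symm))
    exact congrArg Sigma.fst this

theorem compl_sum {m : Bool} {K K' : ℕ} {kind : ℕ → Kind} {α : EF MM} {ρ : (ℕ → ℕ) → Prop}
    (h : Compl (!m) K α ρ) : Compl m K' (sumForm m K' kind α) (SumRel K' kind ρ) := by
  classical
  rintro e ⟨l, hl, h1, h2⟩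
  obtain ⟨n, hn⟩ : ∃ n, n = l.length := ⟨_, rfl⟩
  have hn0 : 0 < n := by rw [hn]; exact List.length_pos_iff.2 hl
  let f : Fin n → ℕ → ℕ := fun i => l.get (i.cast hn)
  have hf1 : ∀ i, ρ (f i) ∧ ∀ k < K', kind k = .rigid → f i k = e k := fun i =>
    h1 _ (List.get_mem _ _)
  have hf2 : ∀ k < K', kind k = .sum → e k = ∑ i, f i k := by
    intro k hk hs
    rw [h2 k hk hs]
    subst hn
    rw [← List.sum_ofFn]
    congr 1
    apply List.ext_get <;> simp [f]
  choose N0 hN0 using fun i => h (f i) (hf1 i).1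
  refine ⟨n + ∑ i, N0 i + ∑ i, ∑ k ∈ Finset.range K, f i k, ?_⟩
  intro N hN hNpos P hP
  have hNn : n ≤ N := by omega
  have hNi : ∀ i, N0 i ≤ N := by
    intro i
    have := Finset.single_le_sum (f := N0) (fun _ _ => Nat.zero_le _) (Finset.mem_univ i)
    omega
  have hNk : ∀ i, ∀ k < K, f i k ≤ N := by
    intro i k hk
    have e1 := Finset.single_le_sum (f := fun k => f i k) (fun _ _ => Nat.zero_le _)
      (Finset.mem_range.2 hk)
    have e2 := Finset.single_le_sum (f := fun i => ∑ k ∈ Finset.range K, f i k)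
      (fun _ _ => Nat.zero_le _) (Finset.mem_univ i)
    omega
  have hA : ∀ k, ∃ A : Fin n → Finset (Fin N), k < K' → kind k = .sum →
      (∀ i, (A i).card = f i k) ∧
      (∀ x, x ∈ P k ↔ ∃ i, x ∈ A i) ∧ ∀ i j x, x ∈ A i → x ∈ A j → i = j := by
    intro k
    by_cases hk : k < K' ∧ kind k = .sum
    · obtain ⟨A, hA⟩ := exists_pieces (fun i => f i k) (P k) (by rw [hP k hk.1, hf2 k hk.1 hk.2])
      exact ⟨A, fun _ _ => hA⟩
    · exact ⟨fun _ => ∅, fun a b => absurd ⟨a, b⟩ hk⟩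
  choose A hA using hA
  have hB : ∀ i k, ∃ B : Finset (Fin N), k < K → B.card = f i k := by
    intro i k
    by_cases hk : k < K
    · obtain ⟨B, -, hB⟩ := Finset.exists_subset_card_eq (s := (Finset.univ : Finset (Fin N)))
        (n := f i k) (by simpa using hNk i k hk)
      exact ⟨B, fun _ => hB⟩
    · exact ⟨∅, fun a => absurd a hk⟩
  choose B hB using hB
  let Pc : Fin n → ℕ → Finset (Fin N) := fun i k =>
    if k < K' ∧ kind k = .rigid then P k else if k < K' ∧ kind k = .sum then A k i else B i k
  have hPc : ∀ i, ∀ k < K, (Pc i k).card = f i k := by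
    intro i k hk
    simp only [Pc]
    split_ifs with c1 c2
    · rw [hP k c1.1, (hf1 i).2 k c1.1 c1.2]
    · exact (hA k c2.1 c2.2).1 i
    · exact hB i k hk
  choose Jc hJ0 hJ using fun i => hN0 i N (hNi i) hNpos (Pc i) (hPc i)
  let J : List (Fin N) → ND N := fun p => match p with
    | [] => (P, false)
    | j :: p => if hj : j.1 < n then ((Jc ⟨j.1, hj⟩ p).1, if p = [] then true else (Jc ⟨j.1, hj⟩ p).2)
      else (fun _ => ∅, false)
  refine ⟨J, rfl, ?_⟩
  rintro V q hq ⟨hV1, hV2⟩ a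
  have hq' : ∀ j : Fin N, dirOf (j :: q) = !m := by intro j; simp [dirOf, hq]
  have hVq : (V q).1 = P := hV1 []
  have hact : ∀ j : Fin N, (V (j :: q)).2 = true ↔ j.1 < n := by
    intro j
    have := hV2 [j] (by simp)
    simp only [List.reverseAux] at this
    rw [this]
    by_cases hj : j.1 < n <;> simp [J, hj]
  have hch : ∀ (j : Fin N) (hj : j.1 < n), (V (j :: q)).1 = Pc ⟨j.1, hj⟩ := by
    intro j hj
    have := hV1 [j]
    simp only [List.reverseAux] at this
    rw [this]
    simp [J, hj, hJ0]
  have hag : ∀ (j : Fin N) (hj : j.1 < n), Agree V (Jc ⟨j.1, hj⟩) (j :: q) := by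
    intro j hj
    constructor
    · intro p
      have := hV1 (j :: p)
      simp only [List.reverseAux] at this
      rw [this]; simp [J, hj]
    · intro p hp
      have := hV2 (j :: p) (by simp)
      simp only [List.reverseAux] at this
      rw [this]; simp [J, hj, hp]
  have hrt : ∀ j : Fin N, ¬ dirOf (j :: q) = m := by intro j; rw [hq']; simp
  simp only [sumForm, tree_and, tree_bx hNpos V q _ hq, tree_di hNpos V q _ hq, tree_conj,
    tree_imp, tree_neg, tree_rt, tree_ac]
  refine ⟨hrt, ⟨⟨0, hNpos⟩, (hact _).2 hn0⟩, ?_, ?_⟩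
  · intro j hj
    have hj' := (hact j).1 hj
    exact hJ ⟨j.1, hj'⟩ V (j :: q) (hq' j) (hag j hj') a
  · intro φ hφ
    simp only [List.mem_map, List.mem_range] at hφ
    obtain ⟨k, hk, rfl⟩ := hφ
    unfold sumClause
    cases hkk : kind k with
    | rigid =>
      simp only [tree_and, tree_all, tree_imp, tree_bx hNpos V q _ hq, tree_vr, tree_ac, tree_neg]
      constructor
      · intro x hx j hj
        have hj' := (hact j).1 hj
        rw [hch j hj']; simp only [Pc, hk, hkk, and_self, if_true]; rwa [hVq] at hx
      · intro x hx j hj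
        have hj' := (hact j).1 hj
        rw [hch j hj']; simp only [Pc, hk, hkk, and_self, if_true]; rwa [hVq] at hx
    | sum =>
      obtain ⟨a1, a2, a3⟩ := hA k hk hkk
      have hPk : ∀ i, Pc i k = A k i := by intro i; simp [Pc, hk, hkk]
      simp only [tree_and, tree_all, tree_iff, tree_bx hNpos V q _ hq, tree_di hNpos V q _ hq,
        tree_vr, tree_ac]
      constructor
      · intro x
        rw [hVq, a2]
        constructor
        · rintro ⟨i, hi⟩
          refine ⟨⟨i.1, by omega⟩, (hact _).2 i.2, ?_⟩
          rw [hch _ i.2, hPk]; exact hi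
        · rintro ⟨j, hj, hx⟩
          have hj' := (hact j).1 hj
          rw [hch j hj', hPk] at hx
          exact ⟨_, hx⟩
      · intro x j
        rw [tree_imp]
        intro hx
        simp only [tree_and, tree_ac, tree_vr] at hx
        have hj' := (hact j).1 hx.1
        have hx2 := hx.2
        rw [hch j hj', hPk] at hx2
        apply tree_bx' hNpos V q x hq
        · rw [tree_imp, tree_rt]; intro _; exact hq
        · intro i hi
          rw [tree_imp]
          intro hx'
          simp only [tree_and, tree_ac, tree_vr] at hx'
          have hi' := (hact i).1 hx'.1
          have hx3 := hx'.2
          rw [hch i hi', hPk] at hx3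
          exact absurd (a3 _ _ x hx3 hx2) (by
            intro hc; apply hi; apply Fin.ext; simpa using hc)
    | free => simp only [tree_tt]

theorem Rep.sum {K : ℕ} {ρ : (ℕ → ℕ) → Prop} (h : Rep K ρ) (K' : ℕ) (kind : ℕ → Kind) :
    Rep K' (SumRel K' kind ρ) := by
  intro m
  obtain ⟨α, h1, h2⟩ := h (!m)
  exact ⟨_, sound_sum h1, compl_sum h2⟩

theorem Rep.or {K : ℕ} {ρ σ : (ℕ → ℕ) → Prop} (h : Rep K ρ) (h' : Rep K σ) :
    Rep K (fun e => ρ e ∨ σ e) := by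
  intro m
  obtain ⟨α, h1, h2⟩ := h m
  obtain ⟨β, h3, h4⟩ := h' m
  refine ⟨.or α β, ?_, ?_⟩
  · intro F hF 𝔪 w a hfin hev
    rw [eval_or] at hev
    rcases hev with hev | hev
    · exact Or.inl (h1 F hF 𝔪 w a hfin hev)
    · exact Or.inr (h3 F hF 𝔪 w a hfin hev)
  · intro e he
    rcases he with he | he
    · obtain ⟨N0, hN⟩ := h2 e he
      refine ⟨N0, fun N hN' hp P hP => ?_⟩
      obtain ⟨J, hJ, hJ'⟩ := hN N hN' hp P hP
      exact ⟨J, hJ, fun V q hq hag a => (tree_or ..).2 (Or.inl (hJ' V q hq hag a))⟩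
    · obtain ⟨N0, hN⟩ := h4 e he
      refine ⟨N0, fun N hN' hp P hP => ?_⟩
      obtain ⟨J, hJ, hJ'⟩ := hN N hN' hp P hP
      exact ⟨J, hJ, fun V q hq hag a => (tree_or ..).2 (Or.inr (hJ' V q hq hag a))⟩

theorem Rep.true (K : ℕ) : Rep K (fun _ => True) := by
  intro m
  refine ⟨tt, fun _ _ _ _ _ _ _ => trivial, ?_⟩
  intro e _
  exact ⟨0, fun N _ hp P hP => ⟨fun _ => (P, false), rfl, fun V q _ _ a => (tree_tt ..).2 trivial⟩⟩

theorem Rep.congr {K : ℕ} {ρ σ : (ℕ → ℕ) → Prop} (h : Rep K ρ) (h' : ∀ e, ρ e ↔ σ e) :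
    Rep K σ := by
  have : ρ = σ := funext fun e => propext (h' e)
  rwa [← this]

theorem Rep.mono {K K' : ℕ} {ρ : (ℕ → ℕ) → Prop} (h : Rep K ρ) (hK : K ≤ K') : Rep K' ρ := by
  intro m
  obtain ⟨α, h1, h2⟩ := h m
  refine ⟨α, h1, fun e he => ?_⟩
  obtain ⟨N0, hN⟩ := h2 e he
  exact ⟨N0, fun N hN' hp P hP => hN N hN' hp P (fun k hk => hP k (lt_of_lt_of_le hk hK))⟩

theorem Rep.and_zero {K : ℕ} {ρ : (ℕ → ℕ) → Prop} (h : Rep K ρ) {k : ℕ} (hk : k < K) :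
    Rep K (fun e => e k = 0 ∧ ρ e) := by
  intro m
  obtain ⟨α, h1, h2⟩ := h m
  refine ⟨.and (.neg (.ex (vr k))) α, ?_, ?_⟩
  · rintro F hF 𝔪 w a hfin ⟨hev, hev'⟩
    refine ⟨?_, h1 F hF 𝔪 w a hfin hev'⟩
    rw [eval_neg, eval_ex] at hev
    unfold cnt
    rw [Set.ncard_eq_zero (hfin.subset Set.inter_subset_right)]
    ext x
    simp only [Set.mem_inter_iff, Set.mem_empty_iff_false, iff_false]
    rintro ⟨hx, hx'⟩
    exact hev ⟨x, hx', hx⟩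
  · rintro e ⟨he0, he⟩
    obtain ⟨N0, hN⟩ := h2 e he
    refine ⟨N0, fun N hN' hp P hP => ?_⟩
    obtain ⟨J, hJ, hJ'⟩ := hN N hN' hp P hP
    refine ⟨J, hJ, fun V q hq hag a => (tree_and ..).2 ⟨?_, hJ' V q hq hag a⟩⟩
    rw [tree_neg, tree_ex]
    rintro ⟨y, hy⟩
    have h3 : (V q).1 = P := (hag.1 []).trans hJ
    have h4 : P k = ∅ := Finset.card_eq_zero.1 ((hP k hk).trans he0)
    rw [tree_vr, h3, h4] at hy
    simp at hy

theorem Rep.and_one {K : ℕ} {ρ : (ℕ → ℕ) → Prop} (h : Rep K ρ) {k : ℕ} (hk : k < K) :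
    Rep K (fun e => e k = 1 ∧ ρ e) := by
  intro m
  obtain ⟨α, h1, h2⟩ := h m
  refine ⟨.and (.all (.iff (vr k) (.eq .var (.const (k+1))))) α, ?_, ?_⟩
  · rintro F hF 𝔪 w a hfin ⟨hev, hev'⟩
    refine ⟨?_, h1 F hF 𝔪 w a hfin hev'⟩
    rw [eval_all] at hev
    unfold cnt
    rw [Set.ncard_eq_one]
    refine ⟨𝔪.cst w (k+1), ?_⟩
    ext x
    simp only [Set.mem_inter_iff, Set.mem_singleton_iff]
    constructor
    · rintro ⟨hx, hx'⟩
      exact ((eval_iff ..).1 (hev x hx')).1 hx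
    · rintro rfl
      exact ⟨((eval_iff ..).1 (hev _ (𝔪.cstMem w _))).2 rfl, 𝔪.cstMem w _⟩
  · rintro e ⟨he0, he⟩
    obtain ⟨N0, hN⟩ := h2 e he
    refine ⟨N0, fun N hN' hp P hP => ?_⟩
    obtain ⟨J, hJ, hJ'⟩ := hN N hN' hp P hP
    refine ⟨J, hJ, fun V q hq hag a => (tree_and ..).2 ⟨?_, hJ' V q hq hag a⟩⟩
    have h3 : (V q).1 = P := (hag.1 []).trans hJ
    obtain ⟨x, hx⟩ := Finset.card_eq_one.1 ((hP k hk).trans he0)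
    rw [tree_all]
    intro y
    rw [tree_iff, tree_vr, tree_eqc, h3, hx]
    simp [topEl]

end OneVarEq

namespace OneVarEq

def Rp (ρ : (ℕ → ℕ) → Prop) : Prop :=
  ∃ K, Rep K ρ ∧ ∀ e e' : ℕ → ℕ, (∀ k < K, e k = e' k) → ρ e → ρ e'

theorem Rp.congr {ρ σ : (ℕ → ℕ) → Prop} (h : Rp ρ) (h' : ∀ e, ρ e ↔ σ e) : Rp σ := by
  have : ρ = σ := funext fun e => propext (h' e)
  rwa [← this]

theorem Rp.exA {ρ : (ℕ → ℕ) → Prop} (h : Rp ρ) (A : Finset ℕ) :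
    Rp (fun e => ∃ f, ρ f ∧ ∀ k ∈ A, f k = e k) := by
  obtain ⟨K, hK, -⟩ := h
  have hA : ∀ k ∈ A, k < A.sup id + 1 := fun k hk => Nat.lt_succ_of_le (Finset.le_sup (f := id) hk)
  refine ⟨A.sup id + 1, (hK.sum (A.sup id + 1) (fun k => if k ∈ A then .rigid else .free)).congr ?_,
    ?_⟩
  · intro e
    constructor
    · rintro ⟨l, hl, h1, -⟩
      obtain ⟨f, hf⟩ := List.exists_mem_of_ne_nil l hl
      exact ⟨f, (h1 f hf).1, fun k hk => (h1 f hf).2 k (hA k hk) (by simp [hk])⟩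
    · rintro ⟨f, hf, hf'⟩
      refine ⟨[f], by simp, ?_, ?_⟩
      · intro g hg
        rw [List.mem_singleton] at hg; subst hg
        refine ⟨hf, fun k _ hk' => hf' k ?_⟩
        by_contra hc; simp [hc] at hk'
      · intro k _ hk'
        by_cases hc : k ∈ A <;> simp [hc] at hk'
  · rintro e e' hee ⟨f, hf, hf'⟩
    exact ⟨f, hf, fun k hk => (hf' k hk).trans (hee k (hA k hk))⟩

theorem Rp.or {ρ σ : (ℕ → ℕ) → Prop} (h : Rp ρ) (h' : Rp σ) : Rp (fun e => ρ e ∨ σ e) := by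
  obtain ⟨K, hK, hd⟩ := h
  obtain ⟨K', hK', hd'⟩ := h'
  refine ⟨max K K', (hK.mono (le_max_left _ _)).or (hK'.mono (le_max_right _ _)), ?_⟩
  rintro e e' hee (h | h)
  · exact Or.inl (hd e e' (fun k hk => hee k (lt_of_lt_of_le hk (le_max_left _ _))) h)
  · exact Or.inr (hd' e e' (fun k hk => hee k (lt_of_lt_of_le hk (le_max_right _ _))) h)

theorem Rp.true : Rp (fun _ => True) := ⟨0, Rep.true 0, fun _ _ _ _ => trivial⟩

theorem Rp.and_zero {ρ : (ℕ → ℕ) → Prop} (h : Rp ρ) (k : ℕ) : Rp (fun e => e k = 0 ∧ ρ e) := by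
  obtain ⟨K, hK, hd⟩ := h
  refine ⟨max K (k + 1), (hK.mono (le_max_left _ _)).and_zero (by simp), ?_⟩
  rintro e e' hee ⟨h1, h2⟩
  exact ⟨(hee k (by simp)).symm.trans h1,
    hd e e' (fun k hk => hee k (lt_of_lt_of_le hk (le_max_left _ _))) h2⟩

theorem Rp.and_one {ρ : (ℕ → ℕ) → Prop} (h : Rp ρ) (k : ℕ) : Rp (fun e => e k = 1 ∧ ρ e) := by
  obtain ⟨K, hK, hd⟩ := h
  refine ⟨max K (k + 1), (hK.mono (le_max_left _ _)).and_one (by simp), ?_⟩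
  rintro e e' hee ⟨h1, h2⟩
  exact ⟨(hee k (by simp)).symm.trans h1,
    hd e e' (fun k hk => hee k (lt_of_lt_of_le hk (le_max_left _ _))) h2⟩

theorem Rp.sum {ρ : (ℕ → ℕ) → Prop} (h : Rp ρ) (K' : ℕ) (kind : ℕ → Kind) :
    Rp (SumRel K' kind ρ) := by
  obtain ⟨K, hK, -⟩ := h
  refine ⟨K', hK.sum K' kind, ?_⟩
  rintro e e' hee ⟨l, hl, h1, h2⟩
  exact ⟨l, hl, fun f hf => ⟨(h1 f hf).1, fun k hk hr => ((h1 f hf).2 k hk hr).trans (hee k hk)⟩,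
    fun k hk hs => (hee k hk).symm.trans (h2 k hk hs)⟩

theorem Rp.and {ρ σ : (ℕ → ℕ) → Prop} (h : Rp ρ) (h' : Rp σ) : Rp (fun e => ρ e ∧ σ e) := by
  have h0 := h; have h0' := h'
  obtain ⟨K₁, -, hd⟩ := h0
  obtain ⟨K₂, -, hd'⟩ := h0'
  obtain ⟨K, hK⟩ : ∃ K, K = max K₁ K₂ := ⟨_, rfl⟩
  have hg := ((((h.and_zero (K+1)).and_one K).or ((h'.and_one (K+1)).and_zero K)).sum (K+2)
    (fun k => if k < K then .rigid else .sum))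
  have hg2 := (((hg.and_one K).and_one (K+1)).exA (Finset.range K))
  refine hg2.congr ?_
  intro e
  constructor
  · rintro ⟨e₁, ⟨hz2, hz1, l, hl, h1, h2⟩, hee⟩
    have key : ∀ z, z = K ∨ z = K + 1 → e₁ z = 1 → ∃ f ∈ l, f z ≠ 0 := by
      intro z hz hz1
      by_contra hc
      push Not at hc
      have := h2 z (by omega) (if_neg (by omega))
      rw [hz1, List.sum_eq_zero] at this
      · exact one_ne_zero this
      · intro x hx
        obtain ⟨f, hf, rfl⟩ := List.mem_map.1 hx
        exact hc f hf
    have hfe : ∀ f ∈ l, ∀ k < K, f k = e k := by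
      intro f hf k hk
      rw [(h1 f hf).2 k (by omega) (if_pos hk)]
      exact hee k (Finset.mem_range.2 hk)
    constructor
    · obtain ⟨f, hf, hfz⟩ := key K (Or.inl rfl) hz1
      rcases (h1 f hf).1 with hh | hh
      · exact hd f e (fun k hk => hfe f hf k (by omega)) hh.2.2
      · exact absurd hh.1 hfz
    · obtain ⟨f, hf, hfz⟩ := key (K+1) (Or.inr rfl) hz2
      rcases (h1 f hf).1 with hh | hh
      · exact absurd hh.2.1 hfz
      · exact hd' f e (fun k hk => hfe f hf k (by omega)) hh.2.2
  · rintro ⟨hρ, hσ⟩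
    let f1 : ℕ → ℕ := fun k => if k < K then e k else if k = K then 1 else 0
    let f2 : ℕ → ℕ := fun k => if k < K then e k else if k = K then 0 else 1
    let e₁ : ℕ → ℕ := fun k => if k < K then e k else 1
    refine ⟨e₁, ⟨by simp [e₁], by simp [e₁], [f1, f2], by simp, ?_, ?_⟩, ?_⟩
    · intro f hf
      simp only [List.mem_cons, List.not_mem_nil, or_false] at hf
      rcases hf with rfl | rfl
      · refine ⟨Or.inl ⟨by simp [f1], by simp [f1],
          hd e f1 (fun k hk => by simp [f1, show k < K by omega]) hρ⟩, ?_⟩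
        intro k _ hk
        have : k < K := by by_contra hc; simp [hc] at hk
        simp [f1, e₁, this]
      · refine ⟨Or.inr ⟨by simp [f2], by simp [f2],
          hd' e f2 (fun k hk => by simp [f2, show k < K by omega]) hσ⟩, ?_⟩
        intro k _ hk
        have : k < K := by by_contra hc; simp [hc] at hk
        simp [f2, e₁, this]
    · intro k _ hk
      have : ¬ k < K := by intro hc; simp [hc] at hk
      by_cases hk' : k = K <;> simp [f1, f2, e₁, this, hk']
    · intro k hk
      simp [e₁, Finset.mem_range.1 hk]

theorem Rp.forall_lt (n : ℕ) (ρ : ℕ → (ℕ → ℕ) → Prop) (h : ∀ k < n, Rp (ρ k)) :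
    Rp (fun e => ∀ k < n, ρ k e) := by
  induction n with
  | zero => exact Rp.true.congr (fun e => by simp)
  | succ n ih =>
    refine ((ih (fun k hk => h k (by omega))).and (h n (by omega))).congr (fun e => ?_)
    constructor
    · rintro ⟨h1, h2⟩ k hk
      rcases Nat.lt_succ_iff_lt_or_eq.1 hk with hk | rfl
      · exact h1 k hk
      · exact h2
    · intro h1; exact ⟨fun k hk => h1 k (by omega), h1 n (by omega)⟩

theorem Rp.eq (i j : ℕ) : Rp (fun e => e i = e j) := by
  have := (((Rp.true.and_one i).and_one j).or ((Rp.true.and_zero i).and_zero j)).sum (max i j + 1)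
    (fun k => if k = i ∨ k = j then .sum else .free)
  refine this.congr (fun e => ?_)
  constructor
  · rintro ⟨l, -, h1, h2⟩
    rw [h2 i (by omega) (by simp), h2 j (by omega) (by simp)]
    congr 1
    apply List.map_congr_left
    intro f hf
    rcases (h1 f hf).1 with hh | hh
    · rw [hh.1, hh.2.1]
    · rw [hh.1, hh.2.1]
  · intro he
    refine ⟨List.replicate (e i) (fun _ => 1) ++ [fun _ => 0], by simp, ?_, ?_⟩
    · intro f hf
      refine ⟨?_, fun k _ hk => ?_⟩
      · simp only [List.mem_append, List.mem_replicate, List.mem_singleton] at hf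
        rcases hf with ⟨-, rfl⟩ | rfl <;> simp
      · by_cases hc : k = i ∨ k = j <;> simp [hc] at hk
    · intro k _ hk
      have : k = i ∨ k = j := by by_contra hc; simp [hc] at hk
      rcases this with rfl | rfl <;> simp [he]

theorem Rp.rename {ρ : (ℕ → ℕ) → Prop} (h : Rp ρ) (σ : ℕ → ℕ) :
    Rp (fun e => ρ (fun k => e (σ k))) := by
  have h0 := h
  obtain ⟨K, -, hd⟩ := h0
  obtain ⟨K', hK'⟩ : ∃ K', K' = (Finset.range K).sup σ + 1 := ⟨_, rfl⟩
  have hσ : ∀ k < K, σ k < K' := fun k hk => by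
    rw [hK']; exact Nat.lt_succ_of_le (Finset.le_sup (Finset.mem_range.2 hk))
  obtain ⟨L, hL⟩ : ∃ L, L = K + K' := ⟨_, rfl⟩
  have h1 := h.and (Rp.forall_lt K (fun k g => g k = g (L + σ k)) (fun k _ => Rp.eq _ _))
  have h2 := h1.exA ((Finset.range K').image (fun j => L + j))
  have h3 := (h2.and (Rp.forall_lt K' (fun k g => g k = g (L + k)) (fun k _ => Rp.eq _ _))).exA
    (Finset.range K')
  refine h3.congr (fun e => ?_)
  constructor
  · rintro ⟨f, ⟨⟨g, ⟨hg, hg'⟩, hgf⟩, hf⟩, hfe⟩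
    refine hd _ _ (fun k hk => ?_) hg
    rw [hg' k hk, hgf (L + σ k) (Finset.mem_image_of_mem _ (Finset.mem_range.2 (hσ k hk))),
      ← hf _ (hσ k hk), hfe _ (Finset.mem_range.2 (hσ k hk))]
  · intro he
    refine ⟨fun k => if k < L then e k else e (k - L), ⟨⟨fun k => if k < K then e (σ k) else
      e (k - L), ⟨hd _ _ (fun k hk => by simp [hk]) he, ?_⟩, ?_⟩, ?_⟩, ?_⟩
    · intro k hk
      simp [hk, show ¬ L + σ k < K by omega]
    · intro k hk
      obtain ⟨j, -, rfl⟩ := Finset.mem_image.1 hk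
      simp [show ¬ L + j < K by omega]
    · intro k hk
      simp [show k < L by omega]
    · intro k hk
      simp [show k < L by have := Finset.mem_range.1 hk; omega]

/-- existential quantification in de Bruijn style -/
theorem Rp.ex {ρ : ℕ → (ℕ → ℕ) → Prop} (h : Rp (fun e => ρ (e 0) (fun n => e (n + 1)))) :
    Rp (fun e => ∃ v, ρ v e) := by
  have h0 := h
  obtain ⟨K, -, hd⟩ := h0
  have h1 := (h.exA ((Finset.range K).erase 0)).rename (fun k => k - 1)
  refine h1.congr (fun e => ?_)
  constructor
  · rintro ⟨f, hf, hfe⟩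
    refine ⟨f 0, ?_⟩
    refine hd f (fun k => if k = 0 then f 0 else e (k - 1)) (fun k hk => ?_) hf
    by_cases hk0 : k = 0
    · simp [hk0]
    · simp [hk0, hfe k (Finset.mem_erase.2 ⟨hk0, Finset.mem_range.2 hk⟩)]
  · rintro ⟨v, hv⟩
    refine ⟨fun k => if k = 0 then v else e (k - 1), by simpa using hv, ?_⟩
    intro k hk
    simp [(Finset.mem_erase.1 hk).1]

theorem Rp.zero (i : ℕ) : Rp (fun e => e i = 0) := (Rp.true.and_zero i).congr (by simp)
theorem Rp.one (i : ℕ) : Rp (fun e => e i = 1) := (Rp.true.and_one i).congr (by simp)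

theorem Rp.rel1 {R : ℕ → Prop} (h : Rp (fun e => R (e 0))) (i : ℕ) : Rp (fun e => R (e i)) :=
  h.rename (fun _ => i)
theorem Rp.rel2 {R : ℕ → ℕ → Prop} (h : Rp (fun e => R (e 0) (e 1))) (i j : ℕ) :
    Rp (fun e => R (e i) (e j)) :=
  h.rename (fun k => if k = 0 then i else j)
theorem Rp.rel3 {R : ℕ → ℕ → ℕ → Prop} (h : Rp (fun e => R (e 0) (e 1) (e 2))) (i j k : ℕ) :
    Rp (fun e => R (e i) (e j) (e k)) :=
  h.rename (fun n => if n = 0 then i else if n = 1 then j else k)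

theorem Rp.add (i j k : ℕ) : Rp (fun e => e i + e j = e k) := by
  have h : Rp (fun e => e 0 + e 1 = e 2) := by
    have := ((((Rp.one 2).and_zero 1).and_one 0).or ((((Rp.one 2).and_one 1).and_zero 0).or
      (((Rp.zero 2).and_zero 1).and_zero 0))).sum 3 (fun _ => .sum)
    refine this.congr (fun e => ?_)
    constructor
    · rintro ⟨l, -, h1, h2⟩
      rw [h2 0 (by omega) rfl, h2 1 (by omega) rfl, h2 2 (by omega) rfl, ← List.sum_map_add]
      congr 1
      apply List.map_congr_left
      intro f hf
      rcases (h1 f hf).1 with hh | hh | hh <;> omega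
    · intro he
      refine ⟨List.replicate (e 0) (fun n => if n = 1 then 0 else 1) ++
        (List.replicate (e 1) (fun n => if n = 0 then 0 else 1) ++ [fun _ => 0]), by simp, ?_, ?_⟩
      · intro f hf
        refine ⟨?_, fun k _ hk => by simp at hk⟩
        simp only [List.mem_append, List.mem_replicate, List.mem_singleton] at hf
        rcases hf with ⟨-, rfl⟩ | ⟨-, rfl⟩ | rfl <;> simp
      · intro k hk _
        interval_cases k <;> simp [he]
  exact Rp.rel3 (R := fun a b c => a + b = c) h i j k

theorem Rp.mul (i j k : ℕ) : Rp (fun e => e i * e j = e k) := by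
  have h : Rp (fun e => e 0 * e 1 = e 2) := by
    have := (((Rp.eq 2 0).and_one 1).or ((Rp.zero 2).and_zero 1)).sum 3
      (fun k => if k = 0 then .rigid else .sum)
    refine this.congr (fun e => ?_)
    constructor
    · rintro ⟨l, -, h1, h2⟩
      rw [h2 1 (by omega) rfl, h2 2 (by omega) rfl, ← List.sum_map_mul_left]
      congr 1
      apply List.map_congr_left
      intro f hf
      have := (h1 f hf).2 0 (by omega) rfl
      rcases (h1 f hf).1 with hh | hh
      · rw [hh.1, hh.2, this, mul_one]
      · rw [hh.1, hh.2, mul_zero]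
    · intro he
      refine ⟨List.replicate (e 1) (fun n => if n = 1 then 1 else e 0) ++
        [fun n => if n = 0 then e 0 else 0], by simp, ?_, ?_⟩
      · intro f hf
        simp only [List.mem_append, List.mem_replicate, List.mem_singleton] at hf
        refine ⟨?_, fun k _ hk => ?_⟩
        · rcases hf with ⟨-, rfl⟩ | rfl <;> simp
        · have : k = 0 := by by_contra hc; simp [hc] at hk
          subst this
          rcases hf with ⟨-, rfl⟩ | rfl <;> simp
      · intro k hk hk'
        interval_cases k
        · simp at hk'
        · simp
        · simp [← he, mul_comm]
  exact Rp.rel3 (R := fun a b c => a * b = c) h i j k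

theorem Rp.const (c i : ℕ) : Rp (fun e => e i = c) := by
  induction c generalizing i with
  | zero => exact Rp.zero i
  | succ c ih =>
    have : Rp (fun e => ∃ a, ∃ b, a = c ∧ b = 1 ∧ a + b = e i) :=
      Rp.ex (Rp.ex ((ih 1).and ((Rp.one 0).and (Rp.add 1 0 (i+2)))))
    exact this.congr (fun e => by simp [eq_comm])

/-! functions with representable graph -/
def RpF (g : (ℕ → ℕ) → ℕ) : Prop := Rp (fun e => g (fun k => e (k + 1)) = e 0)

theorem RpF.at {g : (ℕ → ℕ) → ℕ} (h : RpF g) (i : ℕ) (σ : ℕ → ℕ) :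
    Rp (fun e => g (fun k => e (σ k)) = e i) :=
  h.rename (fun k => if k = 0 then i else σ (k - 1))

theorem RpF.proj (i : ℕ) : RpF (fun e => e i) := Rp.eq _ _
theorem RpF.const (c : ℕ) : RpF (fun _ => c) := (Rp.const c 0).congr (fun e => eq_comm)
theorem RpF.add {f g : (ℕ → ℕ) → ℕ} (hf : RpF f) (hg : RpF g) : RpF (fun e => f e + g e) := by
  have : Rp (fun e => ∃ a, ∃ b, f (fun k => e (k + 1)) = a ∧ g (fun k => e (k + 1)) = b ∧
      a + b = e 0) :=
    Rp.ex (Rp.ex ((hf.at 1 (fun k => k + 3)).and ((hg.at 0 (fun k => k + 3)).and (Rp.add 1 0 2))))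
  exact this.congr (fun e => by simp)
theorem RpF.mul {f g : (ℕ → ℕ) → ℕ} (hf : RpF f) (hg : RpF g) : RpF (fun e => f e * g e) := by
  have : Rp (fun e => ∃ a, ∃ b, f (fun k => e (k + 1)) = a ∧ g (fun k => e (k + 1)) = b ∧
      a * b = e 0) :=
    Rp.ex (Rp.ex ((hf.at 1 (fun k => k + 3)).and ((hg.at 0 (fun k => k + 3)).and (Rp.mul 1 0 2))))
  exact this.congr (fun e => by simp)
theorem RpF.eq {f g : (ℕ → ℕ) → ℕ} (hf : RpF f) (hg : RpF g) : Rp (fun e => f e = g e) := by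
  have : Rp (fun e => ∃ a, f e = a ∧ g e = a) :=
    Rp.ex ((hf.at 0 (fun k => k + 1)).and (hg.at 0 (fun k => k + 1)))
  exact this.congr (fun e => by simp [eq_comm])

/-! Diophantine sets are representable -/
def PolyRep {γ : Type} (f : (γ → ℕ) → ℤ) : Prop :=
  ∃ s : Finset γ, ∀ nm : γ → ℕ, ∃ P Q : (ℕ → ℕ) → ℕ, RpF P ∧ RpF Q ∧
    ∀ (v : γ → ℕ) (e : ℕ → ℕ), (∀ c ∈ s, e (nm c) = v c) → f v = (P e : ℤ) - Q e

theorem polyRep {γ : Type} (f : (γ → ℕ) → ℤ) (hf : IsPoly f) : PolyRep f := by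
  classical
  induction hf with
  | proj c =>
    exact ⟨{c}, fun nm => ⟨_, _, RpF.proj (nm c), RpF.const 0, fun v e h => by simp [h c]⟩⟩
  | const n =>
    exact ⟨∅, fun nm => ⟨_, _, RpF.const n.toNat, RpF.const (-n).toNat, fun v e h => by
      show n = _; omega⟩⟩
  | sub _ _ ih1 ih2 =>
    obtain ⟨s1, h1⟩ := ih1
    obtain ⟨s2, h2⟩ := ih2
    refine ⟨s1 ∪ s2, fun nm => ?_⟩
    obtain ⟨P1, Q1, p1, q1, e1⟩ := h1 nm
    obtain ⟨P2, Q2, p2, q2, e2⟩ := h2 nm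
    refine ⟨_, _, p1.add q2, q1.add p2, fun v e h => ?_⟩
    beta_reduce
    rw [e1 v e (fun c hc => h c (Finset.mem_union_left _ hc)),
      e2 v e (fun c hc => h c (Finset.mem_union_right _ hc))]
    push_cast; ring
  | mul _ _ ih1 ih2 =>
    obtain ⟨s1, h1⟩ := ih1
    obtain ⟨s2, h2⟩ := ih2
    refine ⟨s1 ∪ s2, fun nm => ?_⟩
    obtain ⟨P1, Q1, p1, q1, e1⟩ := h1 nm
    obtain ⟨P2, Q2, p2, q2, e2⟩ := h2 nm
    refine ⟨_, _, (p1.mul p2).add (q1.mul q2), (p1.mul q2).add (q1.mul p2), fun v e h => ?_⟩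
    beta_reduce
    rw [e1 v e (fun c hc => h c (Finset.mem_union_left _ hc)),
      e2 v e (fun c hc => h c (Finset.mem_union_right _ hc))]
    push_cast; ring

theorem Rp.of_dioph {S : Set (ℕ → ℕ)} (h : Dioph S) : Rp (fun e => e ∈ S) := by
  classical
  obtain ⟨β, p, hp⟩ := h
  obtain ⟨s, hs⟩ := polyRep p p.2
  have hcount : {b : β | (Sum.inr b : ℕ ⊕ β) ∈ s}.Countable := by
    apply Set.Finite.countable
    exact Set.Finite.preimage (Sum.inr_injective.injOn) (Finset.finite_toSet s)
  obtain ⟨idx, hidx⟩ := Set.countable_iff_exists_injOn.1 hcount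
  obtain ⟨P, Q, hP, hQ, hPQ⟩ := hs (Sum.elim (fun a => 2 * a) (fun b => 2 * idx b + 1))
  have hR := hP.eq hQ
  have hR0 := hR
  obtain ⟨K, -, hd⟩ := hR0
  have h2 := (hR.exA ((Finset.range K).filter (fun k => k % 2 = 0))).rename (fun k => k / 2)
  refine h2.congr (fun v => ?_)
  have hp' : v ∈ S ↔ _ := hp v
  rw [hp']
  constructor
  · rintro ⟨e, he, hev⟩
    let e' : ℕ → ℕ := fun k => if k % 2 = 0 then v (k / 2) else e k
    have he' : P e' = Q e' := by
      refine hd e e' (fun k hk => ?_) he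
      by_cases hk2 : k % 2 = 0
      · simp only [e', hk2, if_true]
        exact hev k (by simp [hk, hk2])
      · simp [e', hk2]
    refine ⟨fun b => e' (2 * idx b + 1), ?_⟩
    rw [hPQ _ e']
    · simp [he']
    · rintro (a | b) -
      · simp [e']
      · simp
  · rintro ⟨t, ht⟩
    let e : ℕ → ℕ := fun k => if k % 2 = 0 then v (k / 2) else
      if h : ∃ b, (Sum.inr b : ℕ ⊕ β) ∈ s ∧ idx b = k / 2 then t h.choose else 0
    refine ⟨e, ?_, ?_⟩
    · rw [hPQ _ e] at ht
      · omega
      · rintro (a | b) hc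
        · simp [e]
        · have hex : ∃ b', (Sum.inr b' : ℕ ⊕ β) ∈ s ∧ idx b' = idx b := ⟨b, hc, rfl⟩
          have e1 : (2 * idx b + 1) / 2 = idx b := by omega
          have e2 : ¬ (2 * idx b + 1) % 2 = 0 := by omega
          simp only [Sum.elim_inr, e, e2, if_false]
          simp only [e1]
          rw [dif_pos hex]
          congr 1
          exact hidx hex.choose_spec.1 hc hex.choose_spec.2
    · intro k hk
      simp only [Finset.mem_filter] at hk
      simp [e, hk.2]

theorem Rp.pow (i j k : ℕ) : Rp (fun e => e i ^ e j = e k) :=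
  Rp.of_dioph (Dioph.eq_dioph (Dioph.pow_dioph (Dioph.proj_dioph i) (Dioph.proj_dioph j))
    (Dioph.proj_dioph k))

end OneVarEq

namespace OneVarEq

theorem digits_unique (B : ℕ) : ∀ (M : ℕ) (c d : ℕ → ℕ), (∀ u, c u < B) → (∀ u, d u < B) →
    ∑ u ∈ Finset.range M, c u * B ^ u = ∑ u ∈ Finset.range M, d u * B ^ u → ∀ u < M, c u = d u := by
  intro M
  induction M with
  | zero => intro c d _ _ _ u hu; omega
  | succ M ih =>
    intro c d hc hd h
    rw [Finset.sum_range_succ', Finset.sum_range_succ'] at h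
    have e : ∀ c : ℕ → ℕ, ∑ u ∈ Finset.range M, c (u+1) * B ^ (u+1) =
        B * ∑ u ∈ Finset.range M, c (u+1) * B ^ u := by
      intro c; rw [Finset.mul_sum]; apply Finset.sum_congr rfl; intro u _; ring
    rw [e c, e d] at h
    simp only [pow_zero, mul_one] at h
    have hB : 0 < B := lt_of_le_of_lt (Nat.zero_le _) (hc 0)
    have h0 : c 0 = d 0 := by
      have := congrArg (· % B) h
      simpa [Nat.mul_add_mod, Nat.mod_eq_of_lt (hc 0), Nat.mod_eq_of_lt (hd 0)] using this
    have h1 := ih (fun u => c (u+1)) (fun u => d (u+1)) (fun u => hc _) (fun u => hd _) (by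
      rw [h0] at h
      exact Nat.eq_of_mul_eq_mul_left hB (Nat.add_right_cancel h))
    intro u hu
    cases u with
    | zero => exact h0
    | succ u => exact h1 u (by omega)

theorem list_digits {B : ℕ} {l l' : List ℕ} (h : l.length < B) (h' : l'.length < B)
    (hs : (l.map (fun x => B ^ x)).sum = (l'.map (fun x => B ^ x)).sum) : l.Perm l' := by
  classical
  obtain ⟨M, hM⟩ : ∃ M, M = (l ++ l').sum + 1 := ⟨_, rfl⟩
  have hl : ∀ x ∈ l ++ l', x < M := by
    intro x hx; have := List.le_sum_of_mem hx; omega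
  have key : ∀ l'' : List ℕ, (∀ x ∈ l'', x < M) → (l''.map (fun x => B ^ x)).sum =
      ∑ u ∈ Finset.range M, l''.count u * B ^ u := by
    intro l'' hl''
    rw [Finset.sum_list_map_count]
    simp only [smul_eq_mul]
    apply Finset.sum_subset
    · intro x hx; exact Finset.mem_range.2 (hl'' x (List.mem_toFinset.1 hx))
    · intro x _ hx
      rw [List.count_eq_zero_of_not_mem (by simpa using hx)]; simp
  rw [key l (fun x hx => hl x (by simp [hx])), key l' (fun x hx => hl x (by simp [hx]))] at hs
  rw [List.perm_iff_count]
  intro u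
  by_cases hu : u < M
  · exact digits_unique B M _ _ (fun u => lt_of_le_of_lt List.count_le_length h)
      (fun u => lt_of_le_of_lt List.count_le_length h') hs u hu
  · rw [List.count_eq_zero_of_not_mem, List.count_eq_zero_of_not_mem]
    · intro hx; exact hu (hl u (by simp [hx]))
    · intro hx; exact hu (hl u (by simp [hx]))

/-- path condition through edge lists -/
theorem rtg_iff_list {S : ℕ → ℕ → Prop} (a b : ℕ) : Relation.ReflTransGen S a b ↔
    ∃ L : List (ℕ × ℕ), L ≠ [] ∧ (∀ x ∈ L, S x.1 x.2 ∨ x.1 = x.2) ∧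
      (L.map Prod.fst ++ [b]).Perm (L.map Prod.snd ++ [a]) := by
  classical
  constructor
  · intro h
    induction h with
    | refl => exact ⟨[(a, a)], by simp, by simp, List.Perm.refl _⟩
    | @tail c d _ hcd ih =>
      obtain ⟨L, h1, h2, h3⟩ := ih
      refine ⟨(c, d) :: L, by simp, ?_, ?_⟩
      · intro x hx
        rcases List.mem_cons.1 hx with rfl | hx
        · exact Or.inl hcd
        · exact h2 x hx
      · rw [List.perm_iff_count] at *
        intro u
        have := h3 u
        simp only [List.map_cons, List.cons_append, List.count_cons, List.count_append,
          List.count_nil] at *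
        omega
  · rintro ⟨L, -, h2, h3⟩
    have h4 := h3.countP_eq (fun u => decide (Relation.ReflTransGen S a u))
    have h5 : List.countP (fun u => decide (Relation.ReflTransGen S a u)) (L.map Prod.fst) ≤
        List.countP (fun u => decide (Relation.ReflTransGen S a u)) (L.map Prod.snd) := by
      rw [List.countP_map, List.countP_map]
      apply List.countP_mono_left
      intro x hx h
      simp only [Function.comp, decide_eq_true_eq] at *
      rcases h2 x hx with h' | h'
      · exact h.tail h'
      · rwa [← h']
    by_contra hc
    simp only [List.countP_append, List.countP_singleton, hc, decide_false,
      Relation.ReflTransGen.refl, decide_true, if_true] at h4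
    simp only [Bool.false_eq_true, if_false] at h4
    omega

theorem Rp.rtg {S : ℕ → ℕ → ℕ → Prop} (h : Rp (fun e => S (e 0) (e 1) (e 2))) :
    Rp (fun e => Relation.ReflTransGen (S (e 0)) (e 1) (e 2)) := by
  have hc : Rp (fun e => e 2 = 1 ∧ (S (e 0) (e 5) (e 6) ∨ e 5 = e 6) ∧ e 1 ^ e 5 = e 3 ∧
      e 1 ^ e 6 = e 4) :=
    (Rp.one 2).and (((h.rel3 0 5 6).or (Rp.eq 5 6)).and ((Rp.pow 1 5 3).and (Rp.pow 1 6 4)))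
  have hs := hc.sum 5 (fun k => if k ≤ 1 then .rigid else .sum)
  have hT : ∀ e, SumRel 5 (fun k => if k ≤ 1 then .rigid else .sum) (fun e => e 2 = 1 ∧
      (S (e 0) (e 5) (e 6) ∨ e 5 = e 6) ∧ e 1 ^ e 5 = e 3 ∧ e 1 ^ e 6 = e 4) e ↔
      ∃ L : List (ℕ × ℕ), L ≠ [] ∧ (∀ x ∈ L, S (e 0) x.1 x.2 ∨ x.1 = x.2) ∧ e 2 = L.length ∧
        e 3 = (L.map (fun x => (e 1) ^ x.1)).sum ∧ e 4 = (L.map (fun x => (e 1) ^ x.2)).sum := by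
    intro e
    constructor
    · rintro ⟨l, hl, h1, h2⟩
      have r0 : ∀ f ∈ l, f 0 = e 0 := fun f hf => (h1 f hf).2 0 (by omega) rfl
      have r1 : ∀ f ∈ l, f 1 = e 1 := fun f hf => (h1 f hf).2 1 (by omega) rfl
      refine ⟨l.map (fun f => (f 5, f 6)), by simpa using hl, ?_, ?_, ?_, ?_⟩
      · intro x hx
        obtain ⟨f, hf, rfl⟩ := List.mem_map.1 hx
        have := (h1 f hf).1.2.1
        rwa [r0 f hf] at this
      · rw [h2 2 (by omega) rfl, List.map_congr_left (g := fun _ => 1)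
          (fun f hf => (h1 f hf).1.1)]
        simp
      · rw [h2 3 (by omega) rfl, List.map_map]
        congr 1
        apply List.map_congr_left
        intro f hf
        have := (h1 f hf).1.2.2.1
        rw [r1 f hf] at this
        exact this.symm
      · rw [h2 4 (by omega) rfl, List.map_map]
        congr 1
        apply List.map_congr_left
        intro f hf
        have := (h1 f hf).1.2.2.2
        rw [r1 f hf] at this
        exact this.symm
    · rintro ⟨L, hL, h1, h2, h3, h4⟩
      let g : ℕ × ℕ → ℕ → ℕ := fun x k => if k = 0 then e 0 else if k = 1 then e 1 else
        if k = 2 then 1 else if k = 3 then (e 1) ^ x.1 else if k = 4 then (e 1) ^ x.2 else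
        if k = 5 then x.1 else x.2
      refine ⟨L.map g, by simpa using hL, ?_, ?_⟩
      · intro f hf
        obtain ⟨x, hx, rfl⟩ := List.mem_map.1 hf
        refine ⟨⟨rfl, h1 x hx, rfl, rfl⟩, ?_⟩
        intro k hk hk'
        have : k = 0 ∨ k = 1 := by by_contra hc; simp [show ¬ k ≤ 1 by omega] at hk'
        rcases this with rfl | rfl <;> rfl
      · intro k hk hk'
        rw [List.map_map]
        have : k = 2 ∨ k = 3 ∨ k = 4 := by
          by_contra hc; simp [show k ≤ 1 by omega] at hk'
        rcases this with rfl | rfl | rfl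
        · rw [h2]
          have : ((fun f : ℕ → ℕ => f 2) ∘ g) = fun _ => 1 := by funext x; rfl
          rw [this]; simp
        · rw [h3]; rfl
        · rw [h4]; rfl
  have hs2 := hs.congr hT
  have hs3 := hs2.rename (fun k => if k = 0 then 6 else 6 - k)
  -- e 0 = V, 1 = U, 2 = Z, 3 = Y, 4 = n, 5 = B, 6 = p, 7 = a, 8 = b
  have hfin : Rp (fun e => ∃ B n Y Z U V, (∃ L : List (ℕ × ℕ), L ≠ [] ∧
      (∀ x ∈ L, S (e 0) x.1 x.2 ∨ x.1 = x.2) ∧ n = L.length ∧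
        Y = (L.map (fun x => B ^ x.1)).sum ∧ Z = (L.map (fun x => B ^ x.2)).sum) ∧
        (∃ k, k = 2 ∧ n + k = B) ∧ B ^ e 1 = U ∧ B ^ e 2 = V ∧ ∃ s, Y + V = s ∧ Z + U = s) := by
    refine Rp.ex (Rp.ex (Rp.ex (Rp.ex (Rp.ex (Rp.ex ?_)))))
    refine Rp.and hs3 (Rp.and ?_ (Rp.and (Rp.pow 5 7 1) (Rp.and (Rp.pow 5 8 0) ?_)))
    · exact Rp.ex ((Rp.const 2 0).and (Rp.add 5 0 6))
    · exact Rp.ex ((Rp.add 4 1 0).and (Rp.add 3 2 0))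
  refine hfin.congr (fun e => ?_)
  rw [rtg_iff_list]
  constructor
  · rintro ⟨B, n, Y, Z, U, V, ⟨L, hL, h1, rfl, rfl, rfl⟩, ⟨k, rfl, hB⟩, rfl, rfl, s, hs1, hs2⟩
    refine ⟨L, hL, h1, ?_⟩
    apply list_digits (B := B)
    · simp; omega
    · simp; omega
    · simp only [List.map_append, List.map_map, List.sum_append, List.map_cons, List.map_nil,
        List.sum_cons, List.sum_nil, add_zero]
      exact hs1.trans hs2.symm
  · rintro ⟨L, hL, h1, h2⟩
    refine ⟨_, _, _, _, _, _, ⟨L, hL, h1, rfl, rfl, rfl⟩, ⟨2, rfl, rfl⟩, rfl, rfl, _, rfl, ?_⟩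
    have := (h2.map (fun x => (L.length + 2) ^ x)).sum_eq
    simp only [List.map_append, List.map_map, List.sum_append, List.map_cons, List.map_nil,
        List.sum_cons, List.sum_nil, add_zero] at this
    exact this.symm

theorem Rp.lt (i j : ℕ) : Rp (fun e => e i < e j) := by
  have : Rp (fun e => ∃ c, ∃ d, ∃ u, u = 1 ∧ e i + c = d ∧ d + u = e j) :=
    Rp.ex (Rp.ex (Rp.ex ((Rp.one 0).and ((Rp.add (i+3) 2 1).and (Rp.add 1 0 (j+3))))))
  refine this.congr (fun e => ?_)
  constructor
  · rintro ⟨c, d, u, rfl, rfl, h⟩; omega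
  · intro h; exact ⟨e j - e i - 1, _, 1, rfl, rfl, by omega⟩

theorem Rp.pair (i j k : ℕ) : Rp (fun e => Nat.pair (e i) (e j) = e k) := by
  have h1 := (Rp.lt i j).and ((((RpF.proj j).mul (RpF.proj j)).add (RpF.proj i)).eq (RpF.proj k))
  have h2 := (((Rp.lt j i).or (Rp.eq j i))).and
    ((((RpF.proj i).mul (RpF.proj i)).add ((RpF.proj i).add (RpF.proj j))).eq (RpF.proj k))
  refine (h1.or h2).congr (fun e => ?_)
  unfold Nat.pair
  split_ifs with h
  · constructor
    · rintro (h' | h')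
      · exact h'.2
      · omega
    · intro h'; exact Or.inl ⟨h, h'⟩
  · constructor
    · rintro (h' | h')
      · omega
      · rw [← h'.2]; ring
    · intro h'; refine Or.inr ⟨by omega, ?_⟩
      rw [← h']; ring

theorem Rp.of_partrec {f : ℕ →. ℕ} (hf : Nat.Partrec f) : Rp (fun e => e 1 ∈ f (e 0)) := by
  induction hf with
  | zero => exact (Rp.zero 1).congr (fun e => (Part.mem_some_iff).symm)
  | succ =>
    refine ((RpF.proj 1).eq ((RpF.proj 0).add (RpF.const 1))).congr (fun e => ?_)
    exact (Part.mem_some_iff).symm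
  | left =>
    have : Rp (fun e => ∃ b, Nat.pair (e 1) b = e 0) := Rp.ex (Rp.pair 2 0 1)
    refine this.congr (fun e => ?_)
    have hm : e 1 ∈ ((fun n : ℕ => (Nat.unpair n).1 : ℕ → ℕ) : ℕ →. ℕ) (e 0) ↔
      e 1 = (Nat.unpair (e 0)).1 := Part.mem_some_iff
    refine Iff.trans ?_ hm.symm
    constructor
    · rintro ⟨b, h⟩; rw [← h]; simp
    · intro h; exact ⟨(Nat.unpair (e 0)).2, by rw [h]; exact Nat.pair_unpair _⟩
  | right =>
    have : Rp (fun e => ∃ b, Nat.pair b (e 1) = e 0) := Rp.ex (Rp.pair 0 2 1)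
    refine this.congr (fun e => ?_)
    have hm : e 1 ∈ ((fun n : ℕ => (Nat.unpair n).2 : ℕ → ℕ) : ℕ →. ℕ) (e 0) ↔
      e 1 = (Nat.unpair (e 0)).2 := Part.mem_some_iff
    refine Iff.trans ?_ hm.symm
    constructor
    · rintro ⟨b, h⟩; rw [← h]; simp
    · intro h; exact ⟨(Nat.unpair (e 0)).1, by rw [h]; exact Nat.pair_unpair _⟩
  | @pair f g _ _ ihf ihg =>
    have : Rp (fun e => ∃ a b, a ∈ f (e 0) ∧ b ∈ g (e 0) ∧ Nat.pair a b = e 1) :=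
      Rp.ex (Rp.ex ((Rp.rel2 (R := fun x y => y ∈ f x) ihf 2 1).and
        ((Rp.rel2 (R := fun x y => y ∈ g x) ihg 2 0).and (Rp.pair 1 0 3))))
    refine this.congr (fun e => ?_)
    simp [Seq.seq]
  | @comp f g _ _ ihf ihg =>
    have : Rp (fun e => ∃ b, b ∈ g (e 0) ∧ e 1 ∈ f b) :=
      Rp.ex ((Rp.rel2 (R := fun x y => y ∈ g x) ihg 1 0).and
        (Rp.rel2 (R := fun x y => y ∈ f x) ihf 0 2))
    refine this.congr (fun e => ?_)
    exact Part.mem_bind_iff.symm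
  | @prec f g _ _ ihf ihg =>
    have hS : Rp (fun e => ∃ m y y' u m', Nat.pair m y = e 1 ∧ (∃ t s, Nat.pair m y = t ∧
        Nat.pair (e 0) t = s ∧ y' ∈ g s) ∧ u = 1 ∧ m + u = m' ∧ Nat.pair m' y' = e 2) := by
      refine Rp.ex (Rp.ex (Rp.ex (Rp.ex (Rp.ex ?_))))
      refine Rp.and (Rp.pair 4 3 6) (Rp.and ?_ ((Rp.one 1).and ((Rp.add 4 1 0).and (Rp.pair 0 2 7))))
      exact Rp.ex (Rp.ex ((Rp.pair 6 5 1).and ((Rp.pair 7 1 0).and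
        (Rp.rel2 (R := fun x y => y ∈ g x) ihg 0 4))))
    have hS' : Rp (fun e => (fun a s s' => ∃ m y y', s = Nat.pair m y ∧
        y' ∈ g (Nat.pair a (Nat.pair m y)) ∧ s' = Nat.pair (m+1) y') (e 0) (e 1) (e 2)) := by
      refine hS.congr (fun e => ?_)
      constructor
      · rintro ⟨m, y, y', u, m', h1, ⟨t, s, rfl, rfl, h2⟩, rfl, rfl, h3⟩
        exact ⟨m, y, y', h1.symm, h2, h3.symm⟩
      · rintro ⟨m, y, y', h1, h2, h3⟩
        exact ⟨m, y, y', 1, _, h1.symm, ⟨_, _, rfl, rfl, h2⟩, rfl, rfl, h3.symm⟩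
    have hT := Rp.rtg (S := fun a s s' => ∃ m y y', s = Nat.pair m y ∧
        y' ∈ g (Nat.pair a (Nat.pair m y)) ∧ s' = Nat.pair (m+1) y') hS'
    have : Rp (fun e => ∃ a n y0 z s s', Nat.pair a n = e 0 ∧ y0 ∈ f a ∧ z = 0 ∧
        Nat.pair z y0 = s ∧ Nat.pair n (e 1) = s' ∧
        Relation.ReflTransGen ((fun a s s' => ∃ m y y', s = Nat.pair m y ∧
        y' ∈ g (Nat.pair a (Nat.pair m y)) ∧ s' = Nat.pair (m+1) y') a) s s') := by
      refine Rp.ex (Rp.ex (Rp.ex (Rp.ex (Rp.ex (Rp.ex ?_)))))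
      exact (Rp.pair 5 4 6).and ((Rp.rel2 (R := fun x y => y ∈ f x) ihf 5 3).and ((Rp.zero 2).and
        ((Rp.pair 2 3 1).and ((Rp.pair 4 7 0).and (Rp.rel3 (R := fun x y z =>
          Relation.ReflTransGen ((fun a s s' => ∃ m y y', s = Nat.pair m y ∧
        y' ∈ g (Nat.pair a (Nat.pair m y)) ∧ s' = Nat.pair (m+1) y') x) y z) hT 5 1 0)))))
    refine this.congr (fun e => ?_)
    have key : ∀ a n w, w ∈ (Nat.rec (f a) (fun y IH => do
        let i ← IH
        g (Nat.pair a (Nat.pair y i))) n : Part ℕ) ↔ ∃ y0 ∈ f a, Relation.ReflTransGen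
        (fun s s' => ∃ m y y', s = Nat.pair m y ∧
        y' ∈ g (Nat.pair a (Nat.pair m y)) ∧ s' = Nat.pair (m+1) y') (Nat.pair 0 y0)
        (Nat.pair n w) := by
      intro a n w
      constructor
      · induction n generalizing w with
        | zero => intro h; exact ⟨w, h, Relation.ReflTransGen.refl⟩
        | succ n ih =>
          intro h
          obtain ⟨i, hi, hg⟩ := Part.mem_bind_iff.1 h
          obtain ⟨y0, hy0, hr⟩ := ih i hi
          exact ⟨y0, hy0, hr.tail ⟨n, i, w, rfl, hg, rfl⟩⟩
      · rintro ⟨y0, hy0, hr⟩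
        have : ∀ s, Relation.ReflTransGen (fun s s' => ∃ m y y', s = Nat.pair m y ∧
            y' ∈ g (Nat.pair a (Nat.pair m y)) ∧ s' = Nat.pair (m+1) y') (Nat.pair 0 y0) s →
            (Nat.unpair s).2 ∈ (Nat.rec (f a) (fun y IH => do
              let i ← IH
              g (Nat.pair a (Nat.pair y i))) (Nat.unpair s).1 : Part ℕ) := by
          intro s hs
          induction hs with
          | refl => simpa using hy0
          | tail _ h ih =>
            obtain ⟨m, y, y', rfl, h2, rfl⟩ := h
            simp only [Nat.unpair_pair] at ih ⊢
            exact Part.mem_bind_iff.2 ⟨y, ih, h2⟩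
        simpa using this _ hr
    have key2 : e 1 ∈ (Nat.rec (f (Nat.unpair (e 0)).1) (fun y IH => do
        let i ← IH
        g (Nat.pair (Nat.unpair (e 0)).1 (Nat.pair y i))) (Nat.unpair (e 0)).2 : Part ℕ) ↔ _ :=
      key (Nat.unpair (e 0)).1 (Nat.unpair (e 0)).2 (e 1)
    refine Iff.trans ?_ key2.symm
    constructor
    · rintro ⟨a, n, y0, z, s, s', h1, h2, rfl, rfl, rfl, h3⟩
      rw [← h1, Nat.unpair_pair]
      exact ⟨y0, h2, h3⟩
    · rintro ⟨y0, h2, h3⟩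
      exact ⟨_, _, y0, 0, _, _, Nat.pair_unpair _, h2, rfl, rfl, rfl, h3⟩
  | @rfind f _ ihf =>
    have hS : Rp (fun e => ∃ u s k z, u = 1 ∧ e 1 + u = e 2 ∧ Nat.pair (e 0) (e 1) = s ∧
        k ∈ f s ∧ z = 0 ∧ z < k) :=
      Rp.ex (Rp.ex (Rp.ex (Rp.ex ((Rp.one 3).and ((Rp.add 5 3 6).and ((Rp.pair 4 5 2).and
        ((Rp.rel2 (R := fun x y => y ∈ f x) ihf 2 1).and ((Rp.zero 0).and (Rp.lt 0 1)))))))))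
    have hS' : Rp (fun e => (fun a m m' => m + 1 = m' ∧ ∃ k, k ∈ f (Nat.pair a m) ∧ 0 < k)
        (e 0) (e 1) (e 2)) := by
      refine hS.congr (fun e => ?_)
      constructor
      · rintro ⟨u, s, k, z, rfl, h1, rfl, h2, rfl, h3⟩
        exact ⟨h1, k, h2, h3⟩
      · rintro ⟨h1, k, h2, h3⟩
        exact ⟨1, _, k, 0, rfl, h1, rfl, h2, rfl, h3⟩
    have hT := Rp.rtg (S := fun a m m' => m + 1 = m' ∧ ∃ k, k ∈ f (Nat.pair a m) ∧ 0 < k) hS'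
    have : Rp (fun e => ∃ s z, Nat.pair (e 0) (e 1) = s ∧ z = 0 ∧ z ∈ f s ∧
        Relation.ReflTransGen ((fun a m m' => m + 1 = m' ∧ ∃ k, k ∈ f (Nat.pair a m) ∧ 0 < k)
          (e 0)) z (e 1)) := by
      refine Rp.ex (Rp.ex ?_)
      exact (Rp.pair 2 3 1).and ((Rp.zero 0).and ((Rp.rel2 (R := fun x y => y ∈ f x) ihf 1 0).and
        (Rp.rel3 (R := fun x y z => Relation.ReflTransGen ((fun a m m' => m + 1 = m' ∧
          ∃ k, k ∈ f (Nat.pair a m) ∧ 0 < k) x) y z) hT 2 0 3)))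
    refine this.congr (fun e => ?_)
    refine Iff.trans ?_ (Nat.mem_rfind (p := fun n => (fun m => decide (m = 0)) <$> f (Nat.pair (e 0) n))).symm
    have key : ∀ n, Relation.ReflTransGen (fun m m' => m + 1 = m' ∧
        ∃ k, k ∈ f (Nat.pair (e 0) m) ∧ 0 < k) 0 n ↔
        ∀ m < n, ∃ k, k ∈ f (Nat.pair (e 0) m) ∧ 0 < k := by
      intro n
      constructor
      · intro h
        induction h with
        | refl => intro m hm; omega
        | tail _ h ih =>
          obtain ⟨rfl, h⟩ := h
          intro m hm
          rcases Nat.lt_succ_iff_lt_or_eq.1 hm with hm | rfl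
          · exact ih m hm
          · exact h
      · induction n with
        | zero => intro _; exact Relation.ReflTransGen.refl
        | succ n ih =>
          intro h
          exact (ih (fun m hm => h m (by omega))).tail ⟨rfl, h n (by omega)⟩
    constructor
    · rintro ⟨s, z, rfl, rfl, h1, h2⟩
      refine ⟨by simpa using h1, fun {m} hm => ?_⟩
      obtain ⟨k, hk, hk'⟩ := (key _).1 h2 m hm
      simp only [Part.map_eq_map, Part.mem_map_iff]
      exact ⟨k, hk, by simp; omega⟩
    · rintro ⟨h1, h2⟩
      refine ⟨_, 0, rfl, rfl, by simpa using h1, (key _).2 (fun m hm => ?_)⟩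
      have := h2 hm
      simp only [Part.map_eq_map, Part.mem_map_iff] at this
      obtain ⟨k, hk, hk'⟩ := this
      exact ⟨k, hk, by simp at hk'; omega⟩

end OneVarEq

namespace OneVarEq
open Fm

/-- numeral formulas -/
def numStep (B i : ℕ) : EF MM :=
  .and (.pred (3 + (B + (i+1))) (.const (B + (i+1) + 1)))
    (.all (.iff (vr (B + i)) (.and (vr (B + (i+1))) (.neg (.eq .var (.const (B + (i+1) + 1)))))))

def numF (B : ℕ) : ℕ → EF MM
  | 0 => .neg (.ex (vr (B + 0)))
  | n+1 => .and (numF B n) (numStep B n)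

def redF (B : ℕ) (α : EF MM) (n : ℕ) : EF MM :=
  .neg (.and (.all (.or (.eq .var (.const 0)) (di true (.eq .var (.const 0)))))
    (di true (.and (numF B n) (.and (.all (.iff (vr 0) (vr (B + n)))) α))))

theorem numF_sound {F : KFrame MM} (𝔪 : EModel F) (w : F.W) (a : 𝔪.D) (hfin : (𝔪.dom w).Finite)
    (B n : ℕ) (h : 𝔪.eval (numF B n) w a) : cnt 𝔪 w (B + n) = n := by
  induction n with
  | zero =>
    simp only [numF, eval_neg, eval_ex, eval_vr] at h
    unfold cnt
    rw [Set.ncard_eq_zero (hfin.subset Set.inter_subset_right)]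
    ext x
    simp only [Set.mem_inter_iff, Set.mem_empty_iff_false, iff_false]
    rintro ⟨h1, h2⟩
    exact h ⟨x, h2, h1⟩
  | succ n ih =>
    simp only [numF, eval_and, numStep, eval_all, eval_iff, eval_vr, eval_neg] at h
    obtain ⟨h1, h2, h3⟩ := h
    have hih := ih h1
    have h2' : 𝔪.cst w (B + (n+1) + 1) ∈ 𝔪.I w (3 + (B + (n+1))) := h2
    have : 𝔪.I w (3 + (B + (n+1))) ∩ 𝔪.dom w =
        insert (𝔪.cst w (B + (n+1) + 1)) (𝔪.I w (3 + (B + n)) ∩ 𝔪.dom w) := by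
      ext x
      simp only [Set.mem_inter_iff, Set.mem_insert_iff]
      constructor
      · rintro ⟨h4, h5⟩
        by_cases hx : x = 𝔪.cst w (B + (n+1) + 1)
        · left; exact hx
        · right; exact ⟨(h3 x h5).2 ⟨h4, hx⟩, h5⟩
      · rintro (rfl | ⟨h4, h5⟩)
        · exact ⟨h2', 𝔪.cstMem _ _⟩
        · exact ⟨((h3 x h5).1 h4).1, h5⟩
    unfold cnt at hih ⊢
    rw [this, Set.ncard_insert_of_notMem ?_ (hfin.subset Set.inter_subset_right), hih]
    rintro ⟨h4, h5⟩
    exact ((h3 _ h5).1 h4).2 rfl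

theorem redF_sound {B : ℕ} {α : EF MM} {ρ : (ℕ → ℕ) → Prop} (hα : Sound α ρ) (n : ℕ)
    {F : KFrame MM} (hF : F ∈ Fus) (𝔪 : EModel F) (w : F.W) (a : 𝔪.D)
    (h : ¬ 𝔪.eval (redF B α n) w a) : ∃ e, e 0 = n ∧ ρ e := by
  simp only [redF, eval_neg, not_not, eval_and, eval_all, eval_or, eval_di, eval_iff, eval_vr] at h
  obtain ⟨h1, v, hv, h2, h3, h4⟩ := h
  have hfin : (𝔪.dom w).Finite := by
    obtain ⟨-, ι, f, hf, hfin⟩ := hF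
    refine ((hfin w).image (fun u : F.W => 𝔪.cst u 0)).subset ?_
    intro x hx
    rcases h1 x hx with h | ⟨u, hu, h⟩
    · exact ⟨w, rfl, (Eq.symm h : _)⟩
    · exact ⟨u, ((hf w u).1 hu).1.symm, (Eq.symm h : _)⟩
  have hfin' : (𝔪.dom v).Finite := by rw [Fus.dom_eq hF 𝔪 hv]; exact hfin
  refine ⟨cnt 𝔪 v, ?_, hα F hF 𝔪 v a hfin' h4⟩
  rw [← numF_sound 𝔪 v a hfin' B n h2]
  unfold cnt
  congr 1
  ext x
  simp only [Set.mem_inter_iff]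
  constructor
  · rintro ⟨h5, h6⟩; exact ⟨(h3 x h6).1 h5, h6⟩
  · rintro ⟨h5, h6⟩; exact ⟨(h3 x h6).2 h5, h6⟩

def below (N i : ℕ) : Finset (Fin N) := Finset.univ.filter (fun x => x.1 < i)

theorem card_below {N i : ℕ} (h : i ≤ N) : (below N i).card = i := by
  have : (below N i).map Fin.valEmbedding = Finset.range i := by
    ext x
    simp only [below, Finset.mem_map, Finset.mem_filter, Finset.mem_univ, true_and,
      Fin.valEmbedding_apply, Finset.mem_range]
    constructor
    · rintro ⟨y, h1, rfl⟩; exact h1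
    · intro hx; exact ⟨⟨x, by omega⟩, hx, rfl⟩
  rw [← Finset.card_map Fin.valEmbedding, this, Finset.card_range]

theorem top_below {N i : ℕ} (hN : 0 < N) (h : i < N) : topEl hN (below N (i+1)) = ⟨i, h⟩ := by
  have hm : (⟨i, h⟩ : Fin N) ∈ below N (i+1) := by simp [below]
  have hne : (below N (i+1)).Nonempty := ⟨_, hm⟩
  rw [topEl, dif_pos hne]
  apply le_antisymm
  · apply Finset.max'_le
    intro y hy
    simp only [below, Finset.mem_filter, Finset.mem_univ, true_and] at hy
    rw [Fin.le_def]; simp; omega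
  · exact Finset.le_max' _ _ hm

theorem redF_compl {K : ℕ} {α : EF MM} {ρ : (ℕ → ℕ) → Prop} (hα : Compl false K α ρ) (e : ℕ → ℕ)
    (he : ρ e) (hdep : ∀ k < K, k ≠ 0 → e k = 0) :
    ∃ (F : KFrame MM) (_ : F ∈ Fus) (𝔪 : EModel F) (_ : ∀ w, 𝔪.dom w = Set.univ)
      (w : F.W) (a : 𝔪.D), ¬ 𝔪.eval (redF (K+1) α (e 0)) w a := by
  obtain ⟨N₀, h⟩ := hα e he
  let n := e 0
  let N := max N₀ (n + 1)
  have hN : 0 < N := by simp only [N]; omega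
  have hn : n < N := by simp only [N]; omega
  let P : ℕ → Finset (Fin N) := fun k => if k = 0 then below N n else
    if k ≤ K then ∅ else below N (k - (K+1))
  obtain ⟨J, hJ, hJ'⟩ := h N (le_max_left _ _) hN P (by
    intro k hk
    by_cases h0 : k = 0
    · subst h0; simp only [P, if_true]; exact card_below hn.le
    · simp only [P, if_neg h0, if_pos hk.le]; rw [hdep k hk h0]; rfl)
  let V : List (Fin N) → ND N := fun r => J r.dropLast.reverse
  have hV : ∀ p, V (p.reverseAux [⟨0, hN⟩]) = J p := by
    intro p; simp [V, List.reverseAux_eq]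
  have key := hJ' V [⟨0, hN⟩] rfl ⟨fun p => by rw [hV], fun p _ => by rw [hV]⟩
  have hVP : (V [⟨0, hN⟩]).1 = P := by rw [← hJ]; rfl
  have hPn : ∀ i, P (K + 1 + i) = below N i := by
    intro i
    have h1 : ¬ (K + 1 + i = 0) := by omega
    have h2 : ¬ (K + 1 + i ≤ K) := by omega
    simp only [P, if_neg h1, if_neg h2]; congr 1; omega
  refine ⟨treeFrame N, treeFrame_mem N, treeModel hN V, fun _ => rfl, ([] : List (Fin N)),
    (⟨0, hN⟩ : Fin N), ?_⟩
  change ¬ evT hN V (redF (K+1) α n) [] ⟨0, hN⟩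
  rw [redF, tree_neg, not_not, tree_and]
  constructor
  · rw [tree_all]
    intro y
    rw [tree_or, tree_di hN V [] y (m := true) rfl]
    right; exact ⟨y, rfl⟩
  · rw [tree_di hN V [] _ (m := true) rfl]
    refine ⟨⟨0, hN⟩, ?_⟩
    rw [tree_and, tree_and]
    refine ⟨?_, ?_, key _⟩
    · have : ∀ i ≤ n, evT hN V (numF (K+1) i) [⟨0, hN⟩] ⟨0, hN⟩ := by
        intro i
        induction i with
        | zero =>
          intro _
          rw [numF, tree_neg, tree_ex]
          rintro ⟨y, hy⟩
          rw [tree_vr, hVP, hPn] at hy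
          simp [below] at hy
        | succ i ih =>
          intro hi
          rw [numF, tree_and, numStep, tree_and]
          refine ⟨ih (by omega), ?_, ?_⟩
          · rw [tree_vc, hVP, hPn, top_below hN (by omega)]
            simp [below]
          · rw [tree_all]
            intro y
            rw [tree_iff, tree_and, tree_neg, tree_vr, tree_vr, tree_eqc, hVP, hPn, hPn,
              top_below hN (by omega : i < N)]
            simp only [below, Finset.mem_filter, Finset.mem_univ, true_and, Fin.ext_iff]
            omega
      exact this n le_rfl
    · rw [tree_all]
      intro y
      rw [tree_iff, tree_vr, tree_vr, hVP, hPn]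
      simp only [P, if_true]

/-! ### computability of the reduction -/
section comp
open Primrec
def PE (f : ℕ → EF MM) : Prop := Primrec (fun n => EF.encode eUU (f n))
def PN (f : ℕ → ℕ) : Prop := Primrec f
theorem PN.c (k : ℕ) : PN (fun _ => k) := Primrec.const k
theorem PN.id : PN (fun n => n) := Primrec.id
theorem PN.add {f g : ℕ → ℕ} (hf : PN f) (hg : PN g) : PN (fun n => f n + g n) :=
  Primrec.nat_add.comp hf hg
theorem PE.c (φ : EF MM) : PE (fun _ => φ) := Primrec.const _
theorem PE.neg {f : ℕ → EF MM} (hf : PE f) : PE (fun n => .neg (f n)) :=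
  Primrec₂.natPair.comp (Primrec.const 2) hf
theorem PE.ex {f : ℕ → EF MM} (hf : PE f) : PE (fun n => .ex (f n)) :=
  Primrec₂.natPair.comp (Primrec.const 4) hf
theorem PE.box {f : ℕ → EF MM} (m : MM) (hf : PE f) : PE (fun n => .box m (f n)) :=
  Primrec₂.natPair.comp (Primrec.const 5) (Primrec₂.natPair.comp (Primrec.const (eUU m)) hf)
theorem PE.and {f g : ℕ → EF MM} (hf : PE f) (hg : PE g) : PE (fun n => .and (f n) (g n)) :=
  Primrec₂.natPair.comp (Primrec.const 3) (Primrec₂.natPair.comp hf hg)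
theorem PE.predc {f g : ℕ → ℕ} (hf : PN f) (hg : PN g) : PE (fun n => .pred (f n) (.const (g n))) :=
  Primrec₂.natPair.comp (Primrec.const 0) (Primrec₂.natPair.comp hf (Primrec.succ.comp hg))
theorem PE.vr {f : ℕ → ℕ} (hf : PN f) : PE (fun n => vr (f n)) :=
  Primrec₂.natPair.comp (Primrec.const 0) (Primrec₂.natPair.comp ((PN.c 3).add hf) (Primrec.const 0))
theorem PE.eqc {f : ℕ → ℕ} (hf : PN f) : PE (fun n => .eq .var (.const (f n))) :=
  Primrec₂.natPair.comp (Primrec.const 1) (Primrec₂.natPair.comp (Primrec.const 0)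
    (Primrec.succ.comp hf))
theorem PE.all {f : ℕ → EF MM} (hf : PE f) : PE (fun n => .all (f n)) := hf.neg.ex.neg
theorem PE.imp {f g : ℕ → EF MM} (hf : PE f) (hg : PE g) : PE (fun n => .imp (f n) (g n)) :=
  (hf.and hg.neg).neg
theorem PE.iff {f g : ℕ → EF MM} (hf : PE f) (hg : PE g) : PE (fun n => .iff (f n) (g n)) :=
  (hf.imp hg).and (hg.imp hf)

theorem redF_primrec (B : ℕ) (α : EF MM) : PE (redF B α) := by
  have hi : PN (fun i => B + (i+1)) := (PN.c B).add (PN.id.add (PN.c 1))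
  have hi' : PN (fun i => B + (i+1) + 1) := hi.add (PN.c 1)
  have hstep : PE (numStep B) :=
    (PE.predc ((PN.c 3).add hi) hi').and (((PE.vr ((PN.c B).add PN.id)).iff
      ((PE.vr hi).and (PE.eqc hi').neg)).all)
  have hnum : PE (numF B) := by
    have := Primrec.nat_rec' (f := fun n : ℕ => n) (g := fun _ => EF.encode eUU (numF B 0))
      (h := fun _ p => Nat.pair 3 (Nat.pair p.2 (EF.encode eUU (numStep B p.1))))
      Primrec.id (Primrec.const _) (Primrec₂.natPair.comp (Primrec.const 3)
        (Primrec₂.natPair.comp (Primrec.snd.comp Primrec.snd)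
          (Primrec.comp (f := fun n => EF.encode eUU (numStep B n)) hstep
            (Primrec.fst.comp Primrec.snd))))
    refine this.of_eq (fun n => ?_)
    induction n with
    | zero => rfl
    | succ n ih =>
      change Nat.pair 3 (Nat.pair _ _) = Nat.pair 3 (Nat.pair _ _)
      rw [← ih]
  exact ((PE.c _).and (PE.neg (PE.box _ (PE.neg (hnum.and ((PE.all ((PE.c _).iff
    (PE.vr ((PN.c B).add PN.id)))).and (PE.c α))))))).neg
end comp

theorem encode_inj {M : Type} {eM : M → ℕ} (he : Function.Injective eM) (φ ψ : EF M)
    (h : EF.encode eM φ = EF.encode eM ψ) : φ = ψ := by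
  have ht : ∀ t s : ETm, t.code = s.code → t = s := by
    intro t s; cases t <;> cases s <;> simp [ETm.code]
  induction φ generalizing ψ with
  | pred n t =>
    cases ψ <;> simp [EF.encode] at h ⊢
    exact ⟨h.1, ht _ _ h.2⟩
  | eq t s =>
    cases ψ <;> simp [EF.encode] at h ⊢
    exact ⟨ht _ _ h.1, ht _ _ h.2⟩
  | neg φ ih =>
    cases ψ <;> simp [EF.encode] at h ⊢
    exact ih _ h
  | and φ χ ih1 ih2 =>
    cases ψ <;> simp [EF.encode] at h ⊢
    exact ⟨ih1 _ h.1, ih2 _ h.2⟩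
  | ex φ ih =>
    cases ψ <;> simp [EF.encode] at h ⊢
    exact ih _ h
  | box m φ ih =>
    cases ψ <;> simp [EF.encode] at h ⊢
    exact ⟨he h.1, ih _ h.2⟩

theorem eUU_inj : Function.Injective eUU := by
  intro a b h; rcases a with a | a <;> rcases b with b | b <;> simp_all [eUU]

theorem fus_not_re (d : DSem) : ¬ REELogic eUU (LogED d Fus) := by
  intro hre
  let U : ℕ →. ℕ := fun n => Nat.Partrec.Code.eval (Denumerable.ofNat Nat.Partrec.Code n) 0
  have hU : Nat.Partrec U := by
    rw [← Partrec.nat_iff]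
    exact Nat.Partrec.Code.eval_part.comp (Computable.ofNat _) (Computable.const 0)
  have hRp : Rp (fun e => ∃ y, y ∈ U (e 0)) :=
    Rp.ex (ρ := fun y e => y ∈ U (e 0)) (Rp.rel2 (R := fun x y => y ∈ U x) (Rp.of_partrec hU) 1 0)
  obtain ⟨K, hrep, hdep⟩ := hRp
  obtain ⟨α, hs, hc⟩ := hrep false
  have key : ∀ n, (∃ φ ∈ LogED d Fus, EF.encode eUU φ = EF.encode eUU (redF (K+1) α n)) ↔
      ¬ (U n).Dom := by
    intro n
    constructor
    · rintro ⟨φ, hφ, he⟩ hn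
      rw [encode_inj eUU_inj _ _ he] at hφ
      obtain ⟨y, hy⟩ := Part.dom_iff_mem.1 hn
      obtain ⟨F, hF, 𝔪, hd, w, a, hw⟩ := redF_compl hc (fun k => if k = 0 then n else 0)
        ⟨y, by simpa using hy⟩ (by intro k _ hk; simp [hk])
      exact hw (hφ F hF 𝔪 (fun _ => hd) w a (by rw [hd]; trivial))
    · intro hn
      refine ⟨_, ?_, rfl⟩
      intro F hF 𝔪 _ w a _
      by_contra h
      obtain ⟨e, he, y, hy⟩ := redF_sound hs n hF 𝔪 w a h
      rw [he] at hy
      exact hn (Part.dom_iff_mem.2 ⟨y, hy⟩)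
  have h1 : REPred (fun n => ¬ (U n).Dom) := by
    have : REPred (fun n => ∃ φ ∈ LogED d Fus, EF.encode eUU φ =
      EF.encode eUU (redF (K+1) α n)) := hre.comp (Primrec.to_comp (redF_primrec (K+1) α))
    exact this.of_eq key
  have h2 : REPred (fun c : Nat.Partrec.Code => ¬ (Nat.Partrec.Code.eval c 0).Dom) := by
    have : REPred (fun c : Nat.Partrec.Code => ¬ (U (Encodable.encode c)).Dom) :=
      h1.comp (Computable.encode (α := Nat.Partrec.Code))
    refine this.of_eq (fun c => ?_)
    simp [U]
  exact ComputablePred.halting_problem_not_re 0 h2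

theorem fus_conseq (d : DSem) (ψ : EF MM) : GlobalConseqE (LogED d Fus) tt ψ ↔ ψ ∈ LogED d Fus := by
  refine ⟨fun h => ?_, fun h => .ax h⟩
  induction h with
  | ax h => exact h
  | prem => intro F _ 𝔪 _ w a _; exact (eval_tt 𝔪 w a).2 trivial
  | mp _ _ ih1 ih2 =>
    intro F hF 𝔪 hd w a ha
    exact (eval_imp 𝔪 w a _ _).1 (ih1 F hF 𝔪 hd w a ha) (ih2 F hF 𝔪 hd w a ha)
  | gen _ ih =>
    intro F hF 𝔪 hd w a ha
    exact (eval_all 𝔪 w a _).2 (fun b hb => ih F hF 𝔪 hd w b hb)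
  | nec m _ ih =>
    intro F hF 𝔪 hd w a ha v hv
    exact ih F hF 𝔪 hd v a (𝔪.expand _ _ _ hv ha)

theorem fus_not_dec (d : DSem) : ¬ DecidableELogic eUU (LogED d Fus) :=
  fun h => fus_not_re d (ComputablePred.to_re h)

theorem fus_not_gdec (d : DSem) : ¬ GloballyDecidableE eUU (LogED d Fus) := by
  intro h
  apply fus_not_dec d
  have : ComputablePred (fun n : ℕ => ∃ φ ψ, GlobalConseqE (LogED d Fus) φ ψ ∧
      EF.encode eUU φ = (EF.encode eUU tt, n).1 ∧ EF.encode eUU ψ = (EF.encode eUU tt, n).2) := 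
    ComputablePred.computable_of_manyOneReducible (q := fun p : ℕ × ℕ =>
    ∃ φ ψ, GlobalConseqE (LogED d Fus) φ ψ ∧ EF.encode eUU φ = p.1 ∧ EF.encode eUU ψ = p.2)
      ⟨_, Computable.pair (Computable.const _) Computable.id, fun n => Iff.rfl⟩ h
  refine this.of_eq (fun n => ?_)
  constructor
  · rintro ⟨φ, ψ, h1, h2, h3⟩
    rw [encode_inj eUU_inj _ _ h2] at h1
    exact ⟨ψ, (fus_conseq d ψ).1 h1, h3⟩
  · rintro ⟨ψ, h1, h2⟩
    exact ⟨tt, ψ, .ax h1, rfl, h2⟩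

end OneVarEq

namespace OneVarEq

/-! ### Part B: decidability of the component logics -/

/-- a matrix constraint system over colours `T` -/
structure Sys (T : Type) where
  A : T → Prop
  B : T → Prop
  RR : Set T → Prop
  CC : Set T → Prop

def Sys.swap {T : Type} (σ : Sys T) : Sys T := ⟨σ.B, σ.A, σ.CC, σ.RR⟩

/-- row half of validity -/
def HValid {T W D : Type} (σ : Sys T) (X : W → D → T) : Prop :=
  (∀ w, σ.RR (Set.range (X w))) ∧ ∀ w d d', σ.A (X w d) → X w d = X w d' → d = d'

def MValid {T W D : Type} (σ : Sys T) (X : W → D → T) : Prop :=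
  HValid σ X ∧ HValid σ.swap (fun d w => X w d)

/-- row stubs: colours which still have to be realised; kinds: 0 closed, 2 replicated,
otherwise open -/
def RStub {T R C : Type} (kr : R → ℕ) (kc : C → ℕ) (X : R → C → T) (P : R → Set T) (r : R) (t : T) :
    Prop :=
  kr r ≠ 0 ∧ t ∈ P r ∧ ∀ c, (kr r ≠ 2 → kc c ≠ 2) → (kr r = 2 → kc c = 0) → X r c ≠ t

/-- row half of the certificate conditions -/
structure HCert {T R C : Type} (σ : Sys T) (kr : R → ℕ) (kc : C → ℕ) (X : R → C → T)
    (P : R → Set T) (Q : C → Set T) : Prop where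
  mem : ∀ r c, X r c ∈ P r
  rr : ∀ r, σ.RR (P r)
  ovr : ∀ r c, kr r ≠ 0 → kc c ≠ 0 → (kr r = 2 ∨ kc c = 2) → ¬ σ.A (X r c)
  repl : ∀ r c, kc c = 2 → ¬ σ.A (X r c)
  exact' : ∀ r c c', σ.A (X r c) → X r c = X r c' → c = c'
  closed : ∀ r, kr r = 0 → ∀ t ∈ P r, ∃ c, kc c ≠ 2 ∧ X r c = t
  stub : ∀ t, ((∃ r, RStub kr kc X P r t) ∨ (∃ c, RStub kc kr (fun c r => X r c) Q c t)) →
    ∃ i, kr i = 2 ∧ t ∈ P i ∧ (σ.A t → RStub kr kc X P i t)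

structure Cert {T R C : Type} (σ : Sys T) (kr : R → ℕ) (kc : C → ℕ) (X : R → C → T)
    (P : R → Set T) (Q : C → Set T) : Prop where
  row : HCert σ kr kc X P Q
  col : HCert σ.swap kc kr (fun c r => X r c) Q P

theorem Cert.swap {T R C : Type} {σ : Sys T} {kr : R → ℕ} {kc : C → ℕ} {X : R → C → T}
    {P : R → Set T} {Q : C → Set T} (h : Cert σ kr kc X P Q) :
    Cert σ.swap kc kr (fun c r => X r c) Q P := ⟨h.col, h.row⟩

/-- row half of the edge conditions -/
structure HEdge {T R C J : Type} (σ : Sys T) (kr : R → ℕ) (kc : C → ℕ) (X : R → C → T)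
    (P : R → Set T) (j0 : J) (E : R → J → C → J → T → Prop) : Prop where
  fn : ∀ r j c j' t t', E r j c j' t → E r j c j' t' → t = t'
  ovr : ∀ r j c j' t, E r j c j' t → kr r ≠ 0 ∧ kc c ≠ 0 ∧ (kr r = 2 ∨ kc c = 2)
  mem : ∀ r j c j' t, E r j c j' t → t ∈ P r
  stub : ∀ r j c j' t, E r j c j' t → σ.A t → RStub kr kc X P r t
  uniq : ∀ r j c j' t c1 j1, E r j c j' t → E r j c1 j1 t → σ.A t → c = c1 ∧ j' = j1
  ex : ∀ r j t, RStub kr kc X P r t → (kr r = 2 ∨ j = j0) →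
    ∃ c j', (kc c = 2 ∨ j' = j0) ∧ E r j c j' t

abbrev Blow {R J : Type} (kr : R → ℕ) (j0 : J) := {p : R × J // kr p.1 = 2 ∨ p.2 = j0}

theorem half_realise {T R C J : Type} {σ : Sys T} {kr : R → ℕ} {kc : C → ℕ} {X : R → C → T}
    {P : R → Set T} {Q : C → Set T} {j0 : J} {E : R → J → C → J → T → Prop}
    (hc : HCert σ kr kc X P Q) (hE : HEdge σ kr kc X P j0 E)
    (Y : Blow kr j0 → Blow kc j0 → T)
    (hY1 : ∀ p q t, E p.1.1 p.1.2 q.1.1 q.1.2 t → Y p q = t)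
    (hY2 : ∀ p q, (¬ ∃ t, E p.1.1 p.1.2 q.1.1 q.1.2 t) → Y p q = X p.1.1 q.1.1) :
    HValid σ Y := by
  have hno : ∀ p q, (kr p.1.1 = 0 ∨ kc q.1.1 = 0 ∨ (kr p.1.1 ≠ 2 ∧ kc q.1.1 ≠ 2)) →
      Y p q = X p.1.1 q.1.1 := by
    intro p q h
    apply hY2
    rintro ⟨t, ht⟩
    have := hE.ovr _ _ _ _ _ ht
    omega
  constructor
  · intro p
    have : Set.range (Y p) = P p.1.1 := by
      ext t
      constructor
      · rintro ⟨q, rfl⟩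
        by_cases h : ∃ t, E p.1.1 p.1.2 q.1.1 q.1.2 t
        · obtain ⟨t, ht⟩ := h
          rw [hY1 p q t ht]; exact hE.mem _ _ _ _ _ ht
        · rw [hY2 p q h]; exact hc.mem _ _
      · intro ht
        by_cases h0 : kr p.1.1 = 0
        · obtain ⟨c, hc1, hc2⟩ := hc.closed _ h0 t ht
          exact ⟨⟨(c, j0), Or.inr rfl⟩, by rw [hno _ _ (Or.inl h0)]; exact hc2⟩
        · by_cases hs : RStub kr kc X P p.1.1 t
          · obtain ⟨c, j', h1, h2⟩ := hE.ex _ p.1.2 t hs p.2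
            exact ⟨⟨(c, j'), h1⟩, hY1 _ _ _ h2⟩
          · have : ∃ c, (kr p.1.1 ≠ 2 → kc c ≠ 2) ∧ (kr p.1.1 = 2 → kc c = 0) ∧ X p.1.1 c = t := by
              by_contra hcon
              push Not at hcon
              exact hs ⟨h0, ht, hcon⟩
            obtain ⟨c, h1, h2, h3⟩ := this
            refine ⟨⟨(c, j0), Or.inr rfl⟩, ?_⟩
            rw [hno]
            · exact h3
            · dsimp only
              by_cases h4 : kr p.1.1 = 2
              · exact Or.inr (Or.inl (h2 h4))
              · exact Or.inr (Or.inr ⟨h4, h1 h4⟩)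
    rw [this]; exact hc.rr _
  · have hmix : ∀ p q q', σ.A (Y p q) → Y p q = Y p q' →
        (∃ t, E p.1.1 p.1.2 q.1.1 q.1.2 t) → (∃ t, E p.1.1 p.1.2 q'.1.1 q'.1.2 t) := by
      rintro p q q' hA heq ⟨t, ht⟩
      by_contra hcon
      have h1 := hY1 _ _ _ ht
      rw [hY2 _ _ hcon] at heq
      rw [h1] at hA heq
      have hs := hE.stub _ _ _ _ _ ht hA
      have h2 : kc q'.1.1 ≠ 2 := fun h => hc.repl p.1.1 q'.1.1 h (heq ▸ hA)
      refine hs.2.2 q'.1.1 (fun _ => h2) (fun h3 => ?_) heq.symm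
      by_contra h4
      exact hc.ovr p.1.1 q'.1.1 (by omega) h4 (Or.inl h3) (heq ▸ hA)
    intro p q q' hA heq
    by_cases h : ∃ t, E p.1.1 p.1.2 q.1.1 q.1.2 t
    · obtain ⟨t', ht'⟩ := hmix p q q' hA heq h
      obtain ⟨t, ht⟩ := h
      have e1 := hY1 _ _ _ ht
      have e2 := hY1 _ _ _ ht'
      rw [e1, e2] at heq
      subst heq
      rw [e1] at hA
      obtain ⟨h1, h2⟩ := hE.uniq _ _ _ _ _ _ _ ht ht' hA
      exact Subtype.ext (Prod.ext h1 h2)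
    · have h' : ¬ ∃ t, E p.1.1 p.1.2 q'.1.1 q'.1.2 t := by
        intro h'
        exact h (hmix p q' q (heq ▸ hA) heq.symm h')
      rw [hY2 _ _ h] at heq hA
      rw [hY2 _ _ h'] at heq
      have e1 := hc.exact' _ _ _ hA heq
      have h2 : kc q.1.1 ≠ 2 := fun h => hc.repl p.1.1 q.1.1 h hA
      have h3 : q.1.2 = j0 := q.2.resolve_left h2
      have h4 : q'.1.2 = j0 := q'.2.resolve_left (e1 ▸ h2)
      exact Subtype.ext (Prod.ext e1 (h3.trans h4.symm))

theorem realise {T R C J : Type} {σ : Sys T} {kr : R → ℕ} {kc : C → ℕ} {X : R → C → T}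
    {P : R → Set T} {Q : C → Set T} {j0 : J} {E : R → J → C → J → T → Prop}
    (hc : Cert σ kr kc X P Q) (hE : HEdge σ kr kc X P j0 E)
    (hE' : HEdge σ.swap kc kr (fun c r => X r c) Q j0 (fun c j' r j t => E r j c j' t)) :
    ∃ Y : Blow kr j0 → Blow kc j0 → T, MValid σ Y := by
  classical
  let Y : Blow kr j0 → Blow kc j0 → T := fun p q =>
    if h : ∃ t, E p.1.1 p.1.2 q.1.1 q.1.2 t then h.choose else X p.1.1 q.1.1
  have hY1 : ∀ p q t, E p.1.1 p.1.2 q.1.1 q.1.2 t → Y p q = t := by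
    intro p q t ht
    have h : ∃ t, E p.1.1 p.1.2 q.1.1 q.1.2 t := ⟨t, ht⟩
    simp only [Y, dif_pos h]
    exact hE.fn _ _ _ _ _ _ h.choose_spec ht
  have hY2 : ∀ p q, (¬ ∃ t, E p.1.1 p.1.2 q.1.1 q.1.2 t) → Y p q = X p.1.1 q.1.1 := by
    intro p q h
    simp only [Y, dif_neg h]
  exact ⟨Y, half_realise hc.row hE Y hY1 hY2,
    half_realise hc.col hE' (fun q p => Y p q) (fun q p => hY1 p q) (fun q p => hY2 p q)⟩

end OneVarEq

namespace OneVarEq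

/-- row half of finite partial edge relations -/
structure HGood {T R C : Type} (σ : Sys T) (kr : R → ℕ) (kc : C → ℕ) (X : R → C → T)
    (P : R → Set T) (E : R → ℕ → C → ℕ → T → Prop) : Prop where
  fn : ∀ r j c j' t t', E r j c j' t → E r j c j' t' → t = t'
  ovr : ∀ r j c j' t, E r j c j' t → kr r ≠ 0 ∧ kc c ≠ 0 ∧ (kr r = 2 ∨ kc c = 2)
  mem : ∀ r j c j' t, E r j c j' t → t ∈ P r
  stub : ∀ r j c j' t, E r j c j' t → σ.A t → RStub kr kc X P r t
  uniq : ∀ r j c j' t c1 j1, E r j c j' t → E r j c1 j1 t → σ.A t → c = c1 ∧ j' = j1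
  idx : ∀ r j c j' t, E r j c j' t → kr r = 2 ∨ j = 0
  fin : ∃ m, ∀ r j c j' t, E r j c j' t → j < m

def Good {T R C : Type} (σ : Sys T) (kr : R → ℕ) (kc : C → ℕ) (X : R → C → T)
    (P : R → Set T) (Q : C → Set T) (E : R → ℕ → C → ℕ → T → Prop) : Prop :=
  HGood σ kr kc X P E ∧ HGood σ.swap kc kr (fun c r => X r c) Q (fun c j' r j t => E r j c j' t)

theorem good_step {T R C : Type} {σ : Sys T} {kr : R → ℕ} {kc : C → ℕ} {X : R → C → T}
    {P : R → Set T} {Q : C → Set T} {E : R → ℕ → C → ℕ → T → Prop}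
    (hc : Cert σ kr kc X P Q) (hE : Good σ kr kc X P Q E) (r : R) (j : ℕ) (t : T)
    (hs : RStub kr kc X P r t) (hj : kr r = 2 ∨ j = 0) :
    ∃ E' : R → ℕ → C → ℕ → T → Prop, Good σ kr kc X P Q E' ∧ E ≤ E' ∧ ∃ c j', E' r j c j' t := by
  by_cases hex : ∃ c j', E r j c j' t
  · exact ⟨E, hE, le_rfl, hex⟩
  obtain ⟨κ, hκ, hκt, hκs⟩ := hc.col.stub t (Or.inr ⟨r, hs⟩)
  obtain ⟨m, hm⟩ := hE.2.fin
  obtain ⟨m', hm'⟩ := hE.1.fin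
  refine ⟨fun r1 j1 c1 j1' t1 => E r1 j1 c1 j1' t1 ∨ (r1 = r ∧ j1 = j ∧ c1 = κ ∧ j1' = m ∧ t1 = t),
    ⟨?_, ?_⟩, fun _ _ _ _ _ h => Or.inl h, κ, m, Or.inr ⟨rfl, rfl, rfl, rfl, rfl⟩⟩
  · constructor
    · rintro r1 j1 c1 j1' t1 t2 (h1 | ⟨rfl, rfl, rfl, rfl, rfl⟩) (h2 | ⟨h3, h4, h5, h6, h7⟩)
      · exact hE.1.fn _ _ _ _ _ _ h1 h2
      · subst h6; exact absurd (hm _ _ _ _ _ h1) (lt_irrefl _)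
      · exact absurd (hm _ _ _ _ _ h2) (lt_irrefl _)
      · exact h7.symm
    · rintro r1 j1 c1 j1' t1 (h1 | ⟨rfl, rfl, rfl, rfl, rfl⟩)
      · exact hE.1.ovr _ _ _ _ _ h1
      · exact ⟨hs.1, by omega, Or.inr hκ⟩
    · rintro r1 j1 c1 j1' t1 (h1 | ⟨rfl, rfl, rfl, rfl, rfl⟩)
      · exact hE.1.mem _ _ _ _ _ h1
      · exact hs.2.1
    · rintro r1 j1 c1 j1' t1 (h1 | ⟨rfl, rfl, rfl, rfl, rfl⟩) hA
      · exact hE.1.stub _ _ _ _ _ h1 hA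
      · exact hs
    · rintro r1 j1 c1 j1' t1 c2 j2 (h1 | ⟨rfl, rfl, rfl, rfl, rfl⟩) (h2 | ⟨h3, h4, h5, h6, h7⟩) hA
      · exact hE.1.uniq _ _ _ _ _ _ _ h1 h2 hA
      · subst h3; subst h4; subst h7; exact absurd ⟨_, _, h1⟩ hex
      · exact absurd ⟨_, _, h2⟩ hex
      · exact ⟨h5.symm, h6.symm⟩
    · rintro r1 j1 c1 j1' t1 (h1 | ⟨rfl, rfl, rfl, rfl, rfl⟩)
      · exact hE.1.idx _ _ _ _ _ h1
      · exact hj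
    · refine ⟨max m' (j+1), ?_⟩
      rintro r1 j1 c1 j1' t1 (h1 | ⟨rfl, rfl, rfl, rfl, rfl⟩)
      · exact lt_of_lt_of_le (hm' _ _ _ _ _ h1) (le_max_left _ _)
      · exact lt_of_lt_of_le (Nat.lt_succ_self _) (le_max_right _ _)
  · constructor
    · rintro c1 j1' r1 j1 t1 t2 (h1 | ⟨rfl, rfl, rfl, rfl, rfl⟩) (h2 | ⟨h3, h4, h5, h6, h7⟩)
      · exact hE.1.fn _ _ _ _ _ _ h1 h2
      · subst h6; exact absurd (hm _ _ _ _ _ h1) (lt_irrefl _)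
      · exact absurd (hm _ _ _ _ _ h2) (lt_irrefl _)
      · exact h7.symm
    · rintro c1 j1' r1 j1 t1 (h1 | ⟨rfl, rfl, rfl, rfl, rfl⟩)
      · exact hE.2.ovr _ _ _ _ _ h1
      · exact ⟨by omega, hs.1, Or.inl hκ⟩
    · rintro c1 j1' r1 j1 t1 (h1 | ⟨rfl, rfl, rfl, rfl, rfl⟩)
      · exact hE.2.mem _ _ _ _ _ h1
      · exact hκt
    · rintro c1 j1' r1 j1 t1 (h1 | ⟨rfl, rfl, rfl, rfl, rfl⟩) hA
      · exact hE.2.stub _ _ _ _ _ h1 hA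
      · exact hκs hA
    · rintro c1 j1' r1 j1 t1 r2 j2 (h1 | ⟨rfl, rfl, rfl, rfl, rfl⟩) (h2 | ⟨h3, h4, h5, h6, h7⟩) hA
      · exact hE.2.uniq _ _ _ _ _ _ _ h1 h2 hA
      · subst h6; exact absurd (hm _ _ _ _ _ h1) (lt_irrefl _)
      · exact absurd (hm _ _ _ _ _ h2) (lt_irrefl _)
      · exact ⟨h3.symm, h4.symm⟩
    · rintro c1 j1' r1 j1 t1 (h1 | ⟨rfl, rfl, rfl, rfl, rfl⟩)
      · exact hE.2.idx _ _ _ _ _ h1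
      · exact Or.inl hκ
    · refine ⟨m + 1, ?_⟩
      rintro c1 j1' r1 j1 t1 (h1 | ⟨rfl, rfl, rfl, rfl, rfl⟩)
      · exact lt_of_lt_of_le (hm _ _ _ _ _ h1) (Nat.le_succ _)
      · exact Nat.lt_succ_self _

theorem good_bot {T R C : Type} {σ : Sys T} {kr : R → ℕ} {kc : C → ℕ} {X : R → C → T}
    {P : R → Set T} : HGood σ kr kc X P (fun _ _ _ _ _ => False) :=
  ⟨fun _ _ _ _ _ _ h => h.elim, fun _ _ _ _ _ h => h.elim, fun _ _ _ _ _ h => h.elim,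
    fun _ _ _ _ _ h => h.elim, fun _ _ _ _ _ _ _ h => h.elim, fun _ _ _ _ _ h => h.elim,
    0, fun _ _ _ _ _ h => h.elim⟩

theorem good_lim {T R C ι : Type} {σ : Sys T} {kr : R → ℕ} {kc : C → ℕ} {X : R → C → T}
    {P : R → Set T} (I : Set ι) (E : ι → R → ℕ → C → ℕ → T → Prop)
    (hg : ∀ x ∈ I, HGood σ kr kc X P (E x))
    (hd : ∀ x ∈ I, ∀ y ∈ I, ∃ z ∈ I, E x ≤ E z ∧ E y ≤ E z)
    (hex : ∀ r j t, RStub kr kc X P r t → (kr r = 2 ∨ j = 0) → ∃ x ∈ I, ∃ c j', 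
      (kc c = 2 ∨ j' = 0) ∧ E x r j c j' t) :
    HEdge σ kr kc X P 0 (fun r j c j' t => ∃ x ∈ I, E x r j c j' t) := by
  constructor
  · rintro r j c j' t t' ⟨x, hx, h1⟩ ⟨y, hy, h2⟩
    obtain ⟨z, hz, hxz, hyz⟩ := hd x hx y hy
    exact (hg z hz).fn _ _ _ _ _ _ (hxz _ _ _ _ _ h1) (hyz _ _ _ _ _ h2)
  · rintro r j c j' t ⟨x, hx, h1⟩
    exact (hg x hx).ovr _ _ _ _ _ h1
  · rintro r j c j' t ⟨x, hx, h1⟩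
    exact (hg x hx).mem _ _ _ _ _ h1
  · rintro r j c j' t ⟨x, hx, h1⟩ hA
    exact (hg x hx).stub _ _ _ _ _ h1 hA
  · rintro r j c j' t c1 j1 ⟨x, hx, h1⟩ ⟨y, hy, h2⟩ hA
    obtain ⟨z, hz, hxz, hyz⟩ := hd x hx y hy
    exact (hg z hz).uniq _ _ _ _ _ _ _ (hxz _ _ _ _ _ h1) (hyz _ _ _ _ _ h2) hA
  · intro r j t hs hj
    obtain ⟨x, hx, c, j', h1, h2⟩ := hex r j t hs hj
    exact ⟨c, j', h1, x, hx, h2⟩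

theorem realise_inf {T R C : Type} [Countable T] [Countable R] [Countable C] {σ : Sys T}
    {kr : R → ℕ} {kc : C → ℕ} {X : R → C → T}
    {P : R → Set T} {Q : C → Set T} (hc : Cert σ kr kc X P Q) :
    ∃ Y : Blow kr 0 → Blow kc 0 → T, MValid σ Y := by
  classical
  let G := {E : R → ℕ → C → ℕ → T → Prop // Good σ kr kc X P Q E}
  let req : (R × ℕ × T) ⊕ (C × ℕ × T) → Set G := fun q =>
    match q with
    | .inl (r, j, t) => {E | RStub kr kc X P r t → (kr r = 2 ∨ j = 0) → ∃ c j', E.1 r j c j' t}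
    | .inr (c, j', t) => {E | RStub kc kr (fun c r => X r c) Q c t → (kc c = 2 ∨ j' = 0) →
        ∃ r j, E.1 r j c j' t}
  have hcof : ∀ q, IsCofinal (req q) := by
    rintro (⟨r, j, t⟩ | ⟨c, j', t⟩) E
    · by_cases hs : RStub kr kc X P r t ∧ (kr r = 2 ∨ j = 0)
      · obtain ⟨E', h1, h2, h3⟩ := good_step hc E.2 r j t hs.1 hs.2
        exact ⟨⟨E', h1⟩, fun _ _ => h3, h2⟩
      · exact ⟨E, fun h1 h2 => absurd ⟨h1, h2⟩ hs, le_rfl⟩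
    · by_cases hs : RStub kc kr (fun c r => X r c) Q c t ∧ (kc c = 2 ∨ j' = 0)
      · obtain ⟨E', h1, h2, h3⟩ := good_step hc.swap (E := fun c j' r j t => E.1 r j c j' t)
          ⟨E.2.2, E.2.1⟩ c j' t hs.1 hs.2
        exact ⟨⟨fun r j c j' t => E' c j' r j t, ⟨h1.2, h1.1⟩⟩, fun _ _ => h3,
          fun r j c j' t h => h2 c j' r j t h⟩
      · exact ⟨E, fun h1 h2 => absurd ⟨h1, h2⟩ hs, le_rfl⟩
  haveI : Encodable ((R × ℕ × T) ⊕ (C × ℕ × T)) := Encodable.ofCountable _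
  let 𝒟 : (R × ℕ × T) ⊕ (C × ℕ × T) → Order.Cofinal G := fun q => ⟨req q, hcof q⟩
  let p0 : G := ⟨fun _ _ _ _ _ => False, good_bot, good_bot⟩
  let I := Order.idealOfCofinals p0 𝒟
  have hI : ∀ q, ∃ x, x ∈ req q ∧ x ∈ I := Order.cofinal_meets_idealOfCofinals p0 𝒟
  have hdir : ∀ x ∈ I, ∀ y ∈ I, ∃ z ∈ I, x ≤ z ∧ y ≤ z := I.directed
  refine realise (j0 := 0) hc
    (E := fun r j c j' t => ∃ x ∈ (I : Set G), x.1 r j c j' t) ?_ ?_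
  · refine good_lim (I : Set G) (fun x => x.1) (fun x _ => x.2.1) hdir ?_
    intro r j t hs hj
    obtain ⟨x, hx, hxI⟩ := hI (.inl (r, j, t))
    obtain ⟨c, j', h⟩ := hx hs hj
    exact ⟨x, hxI, c, j', x.2.2.idx _ _ _ _ _ h, h⟩
  · refine good_lim (I : Set G) (fun x c j' r j t => x.1 r j c j' t) (fun x _ => x.2.2) ?_ ?_
    · intro x hx y hy
      obtain ⟨z, hz, h1, h2⟩ := hdir x hx y hy
      exact ⟨z, hz, fun c j' r j t h => h1 r j c j' t h, fun c j' r j t h => h2 r j c j' t h⟩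
    · intro r j t hs hj
      obtain ⟨x, hx, hxI⟩ := hI (.inr (r, j, t))
      obtain ⟨c, j', h⟩ := hx hs hj
      exact ⟨x, hxI, c, j', x.2.1.idx _ _ _ _ _ h, h⟩

end OneVarEq

namespace OneVarEq

/-- the edge relation of the finite realisation -/
def FE {T R C G : Type} [AddCommGroup G] (S M : R → C → T → Prop) (er : R → C → T → R)
    (ec : R → C → T → C) (sh p q : R → C → T → G) (VR : R → T → Prop) (vk : R → T → C)
    (vs : R → T → G) (VC : C → T → Prop) (vi : C → T → R) (vt : C → T → G)
    (r : R) (j : G) (c : C) (j' : G) (t : T) : Prop :=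
  (S r c t ∧ j' = j + sh r c t ∧
      ¬ ∃ r1 c1, M r1 c1 t ∧ er r1 c1 t = r ∧ ec r1 c1 t = c ∧ p r1 c1 t = j) ∨
  (j = 0 ∧ ∃ c1, M r c1 t ∧ ec r c1 t = c ∧ q r c1 t = j') ∨
  (j' = 0 ∧ ∃ r1, M r1 c t ∧ er r1 c t = r ∧ p r1 c t = j) ∨
  (j = 0 ∧ VR r t ∧ vk r t = c ∧ vs r t = j') ∨
  (j' = 0 ∧ VC c t ∧ vi c t = r ∧ vt c t = j)

/-- row half of the conditions on the data of the finite realisation -/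
structure HF {T R C G : Type} [AddCommGroup G] (σ : Sys T) (kr : R → ℕ) (kc : C → ℕ)
    (X : R → C → T) (P : R → Set T) (Q : C → Set T)
    (S M : R → C → T → Prop) (er : R → C → T → R)
    (ec : R → C → T → C) (sh p q : R → C → T → G) (VR : R → T → Prop) (vk : R → T → C)
    (vs : R → T → G) : Prop where
  kS : ∀ r c t, S r c t → kr r = 2
  memS : ∀ r c t, S r c t → t ∈ P r
  stS : ∀ r c t, S r c t → σ.A t → RStub kr kc X P r t
  unS : ∀ r c c' t, S r c t → S r c' t → σ.A t → c = c'
  exS : ∀ r t, RStub kr kc X P r t → kr r = 2 → ∃ c, S r c t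
  shi : ∀ r c t t', sh r c t = sh r c t' → t = t'
  MS : ∀ r c t, M r c t → S (er r c t) (ec r c t) t
  stM : ∀ r c t, M r c t → RStub kr kc X P r t
  kM : ∀ r c t, M r c t → kr r ≠ 2
  unM : ∀ r c c' t, M r c t → M r c' t → c = c'
  qi : ∀ r c t r' c' t', q r c t = q r' c' t' → r = r' ∧ c = c' ∧ t = t'
  qp : ∀ r c t, q r c t = p r c t + sh (er r c t) (ec r c t) t
  vsi : ∀ r t r' t', vs r t = vs r' t' → t = t'
  qv : ∀ r c t r' t', q r c t ≠ vs r' t'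
  stV : ∀ r t, VR r t → RStub kr kc X P r t
  kV : ∀ r t, VR r t → kr r ≠ 2
  kvV : ∀ r t, VR r t → kc (vk r t) = 2
  memV : ∀ r t, VR r t → t ∈ Q (vk r t)
  nbV : ∀ r t, VR r t → ¬ σ.B t
  nMV : ∀ r t, VR r t → ¬ ∃ c, M r c t
  exV : ∀ r t, RStub kr kc X P r t → kr r ≠ 2 → VR r t ∨ ∃ c, M r c t

theorem hf_edge {T R C G : Type} [AddCommGroup G] {σ : Sys T} {kr : R → ℕ} {kc : C → ℕ}
    {X : R → C → T} {P : R → Set T} {Q : C → Set T}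
    {S M : R → C → T → Prop} {er : R → C → T → R}
    {ec : R → C → T → C} {sh p q : R → C → T → G} {VR : R → T → Prop} {vk : R → T → C}
    {vs : R → T → G} {VC : C → T → Prop} {vi : C → T → R} {vt : C → T → G}
    (h : HF σ kr kc X P Q S M er ec sh p q VR vk vs)
    (h' : HF σ.swap kc kr (fun c r => X r c) Q P (fun c r => S r c) (fun c r => M r c)
      (fun c r => ec r c) (fun c r => er r c) (fun c r => sh r c) (fun c r => q r c)
      (fun c r => p r c) VC vi vt) :
    HEdge σ kr kc X P (0 : G) (FE S M er ec sh p q VR vk vs VC vi vt) := by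
  have kS' : ∀ r c t, S r c t → kc c = 2 := fun r c t hh => h'.kS c r t hh
  have kM' : ∀ r c t, M r c t → kc c ≠ 2 := fun r c t hh => h'.kM c r t hh
  have kVR' := h.kvV
  have k0 : ∀ r c t, M r c t → kr r ≠ 0 := fun r c t hh => (h.stM r c t hh).1
  have k0' : ∀ r c t, M r c t → kc c ≠ 0 := fun r c t hh => (h'.stM c r t hh).1
  have ke : ∀ r c t, M r c t → kr (er r c t) = 2 := fun r c t hh => h.kS _ _ _ (h.MS _ _ _ hh)
  have ke' : ∀ r c t, M r c t → kc (ec r c t) = 2 := fun r c t hh => kS' _ _ _ (h.MS _ _ _ hh)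
  have unM' : ∀ r r' c t, M r c t → M r' c t → r = r' := fun r r' c t h1 h2 => h'.unM c r r' t h1 h2
  have pi : ∀ r c t r' c' t', p r c t = p r' c' t' → r = r' ∧ c = c' ∧ t = t' := by
    intro r c t r' c' t' hh
    obtain ⟨h1, h2, h3⟩ := h'.qi c r t c' r' t' hh
    exact ⟨h2, h1, h3⟩
  have pv : ∀ r c t c' t', p r c t ≠ vt c' t' := fun r c t c' t' => h'.qv c r t c' t'
  have kinds : ∀ r j c j' t, FE S M er ec sh p q VR vk vs VC vi vt r j c j' t →
      kr r ≠ 0 ∧ kc c ≠ 0 ∧ (kr r = 2 ∨ kc c = 2) := by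
    rintro r j c j' t (⟨a, -, -⟩ | ⟨-, c1, a, rfl, -⟩ | ⟨-, r1, a, rfl, -⟩ | ⟨-, a, rfl, -⟩ | ⟨-, a, rfl, -⟩)
    · have := h.kS _ _ _ a; have := kS' _ _ _ a; omega
    · have := k0 _ _ _ a; have := ke' _ _ _ a; omega
    · have := k0' _ _ _ a; have := ke _ _ _ a; omega
    · have := (h.stV _ _ a).1; have := h.kvV _ _ a; omega
    · have := (h'.stV _ _ a).1; have := h'.kvV _ _ a; omega
  refine ⟨?_, kinds, ?_, ?_, ?_, ?_⟩
  · rintro r j c j' t t' (⟨a, a1, a2⟩ | ⟨a0, c1, a, a1, a2⟩ | ⟨a0, r1, a, a1, a2⟩ | ⟨a0, a, a1, a2⟩ | ⟨a0, a, a1, a2⟩)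
      (⟨b, b1, b2⟩ | ⟨b0, c2, b, b1, b2⟩ | ⟨b0, r2, b, b1, b2⟩ | ⟨b0, b, b1, b2⟩ | ⟨b0, b, b1, b2⟩)
    · exact h.shi r c t t' (add_left_cancel (a1.symm.trans b1))
    · exact absurd (h.kS _ _ _ a) (h.kM _ _ _ b)
    · exact absurd (kS' _ _ _ a) (kM' _ _ _ b)
    · exact absurd (h.kS _ _ _ a) (h.kV _ _ b)
    · exact absurd (kS' _ _ _ a) (h'.kV _ _ b)
    · exact absurd (h.kS _ _ _ b) (h.kM _ _ _ a)
    · exact (h.qi _ _ _ _ _ _ (a2.trans b2.symm)).2.2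
    · have := ke _ _ _ b; rw [b1] at this; exact absurd this (h.kM _ _ _ a)
    · exact absurd (a2.trans b2.symm) (h.qv _ _ _ _ _)
    · have := h'.kvV _ _ b; rw [b1] at this; exact absurd this (h.kM _ _ _ a)
    · exact absurd (kS' _ _ _ b) (kM' _ _ _ a)
    · have := ke _ _ _ a; rw [a1] at this; exact absurd this (h.kM _ _ _ b)
    · exact (pi _ _ _ _ _ _ (a2.trans b2.symm)).2.2
    · have := h.kvV _ _ b; rw [b1] at this; exact absurd this (kM' _ _ _ a)
    · exact absurd (a2.trans b2.symm) (pv _ _ _ _ _)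
    · exact absurd (h.kS _ _ _ b) (h.kV _ _ a)
    · exact absurd (b2.trans a2.symm) (h.qv _ _ _ _ _)
    · have := h.kvV _ _ a; rw [a1] at this; exact absurd this (kM' _ _ _ b)
    · exact h.vsi _ _ _ _ (a2.trans b2.symm)
    · have := h.kvV _ _ a; rw [a1] at this; exact absurd this (h'.kV _ _ b)
    · exact absurd (kS' _ _ _ b) (h'.kV _ _ a)
    · have := h'.kvV _ _ a; rw [a1] at this; exact absurd this (h.kM _ _ _ b)
    · exact absurd (b2.trans a2.symm) (pv _ _ _ _ _)
    · have := h.kvV _ _ b; rw [b1] at this; exact absurd this (h'.kV _ _ a)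
    · exact h'.vsi _ _ _ _ (a2.trans b2.symm)
  · rintro r j c j' t (⟨a, -, -⟩ | ⟨-, c1, a, rfl, -⟩ | ⟨-, r1, a, rfl, -⟩ | ⟨-, a, rfl, -⟩ | ⟨-, a, rfl, -⟩)
    · exact h.memS _ _ _ a
    · exact (h.stM _ _ _ a).2.1
    · exact h.memS _ _ _ (h.MS _ _ _ a)
    · exact (h.stV _ _ a).2.1
    · exact h'.memV _ _ a
  · rintro r j c j' t (⟨a, -, -⟩ | ⟨-, c1, a, rfl, -⟩ | ⟨-, r1, a, rfl, -⟩ | ⟨-, a, rfl, -⟩ | ⟨-, a, rfl, -⟩) hA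
    · exact h.stS _ _ _ a hA
    · exact h.stM _ _ _ a
    · exact h.stS _ _ _ (h.MS _ _ _ a) hA
    · exact h.stV _ _ a
    · exact absurd hA (h'.nbV _ _ a)
  · rintro r j c j' t d jd hE1 hE2 hA
    have h5 : ∀ c, ¬ VC c t := fun c hh => h'.nbV _ _ hh hA
    rcases hE1 with (⟨a, a1, a2⟩ | ⟨a0, c1, a, a1, a2⟩ | ⟨a0, r1, a, a1, a2⟩ | ⟨a0, a, a1, a2⟩ | ⟨a0, a, a1, a2⟩) <;>
    rcases hE2 with (⟨b, b1, b2⟩ | ⟨b0, c2, b, b1, b2⟩ | ⟨b0, r2, b, b1, b2⟩ | ⟨b0, b, b1, b2⟩ | ⟨b0, b, b1, b2⟩)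
    · obtain rfl := h.unS _ _ _ _ a b hA
      exact ⟨rfl, a1.trans b1.symm⟩
    · exact absurd (h.kS _ _ _ a) (h.kM _ _ _ b)
    · have h1 := h.MS _ _ _ b
      rw [b1] at h1
      exact absurd ⟨r2, d, b, b1, h.unS _ _ _ _ h1 a hA, b2⟩ a2
    · exact absurd (h.kS _ _ _ a) (h.kV _ _ b)
    · exact absurd b (h5 _)
    · exact absurd (h.kS _ _ _ b) (h.kM _ _ _ a)
    · obtain rfl := h.unM _ _ _ _ a b
      exact ⟨a1.symm.trans b1, a2.symm.trans b2⟩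
    · have := ke _ _ _ b; rw [b1] at this; exact absurd this (h.kM _ _ _ a)
    · exact absurd ⟨_, a⟩ (h.nMV _ _ b)
    · exact absurd b (h5 _)
    · have h1 := h.MS _ _ _ a
      rw [a1] at h1
      exact absurd ⟨r1, c, a, a1, h.unS _ _ _ _ h1 b hA, a2⟩ b2
    · have := ke _ _ _ a; rw [a1] at this; exact absurd this (h.kM _ _ _ b)
    · have := pi _ _ _ _ _ _ (a2.trans b2.symm)
      exact ⟨this.2.1, a0.trans b0.symm⟩
    · have := ke _ _ _ a; rw [a1] at this; exact absurd this (h.kV _ _ b)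
    · exact absurd b (h5 _)
    · exact absurd (h.kS _ _ _ b) (h.kV _ _ a)
    · exact absurd ⟨_, b⟩ (h.nMV _ _ a)
    · have := ke _ _ _ b; rw [b1] at this; exact absurd this (h.kV _ _ a)
    · exact ⟨a1.symm.trans b1, a2.symm.trans b2⟩
    · exact absurd b (h5 _)
    all_goals exact absurd a (h5 _)
  · intro r j t hs hj
    by_cases h2 : kr r = 2
    · obtain ⟨c, hS⟩ := h.exS _ _ hs h2
      by_cases hcut : ∃ r1 c1, M r1 c1 t ∧ er r1 c1 t = r ∧ ec r1 c1 t = c ∧ p r1 c1 t = j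
      · obtain ⟨r1, c1, a, a1, a2, a3⟩ := hcut
        exact ⟨c1, 0, Or.inr rfl, Or.inr (Or.inr (Or.inl ⟨rfl, r1, a, a1, a3⟩))⟩
      · exact ⟨c, j + sh r c t, Or.inl (kS' _ _ _ hS), Or.inl ⟨hS, rfl, hcut⟩⟩
    · have hj0 := hj.resolve_left h2
      rcases h.exV _ _ hs h2 with a | ⟨c, a⟩
      · exact ⟨_, _, Or.inl (h.kvV _ _ a), Or.inr (Or.inr (Or.inr (Or.inl ⟨hj0, a, rfl, rfl⟩)))⟩
      · exact ⟨_, _, Or.inl (ke' _ _ _ a), Or.inr (Or.inl ⟨hj0, c, a, rfl, rfl⟩)⟩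

theorem fe_swap {T R C G : Type} [AddCommGroup G] {σ : Sys T} {kr : R → ℕ} {kc : C → ℕ}
    {X : R → C → T} {P : R → Set T} {Q : C → Set T}
    {S M : R → C → T → Prop} {er : R → C → T → R}
    {ec : R → C → T → C} {sh p q : R → C → T → G} {VR : R → T → Prop} {vk : R → T → C}
    {vs : R → T → G} {VC : C → T → Prop} {vi : C → T → R} {vt : C → T → G}
    (h2 : ∀ x : G, x + x = 0)
    (h : HF σ kr kc X P Q S M er ec sh p q VR vk vs) :
    (fun c j' r j t => FE S M er ec sh p q VR vk vs VC vi vt r j c j' t) =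
      FE (fun c r => S r c) (fun c r => M r c)
      (fun c r => ec r c) (fun c r => er r c) (fun c r => sh r c) (fun c r => q r c)
      (fun c r => p r c) VC vi vt VR vk vs := by
  funext c j' r j t
  have key : ∀ x y z : G, x = y + z → y = x + z := by
    rintro x y z rfl
    rw [add_assoc, h2, add_zero]
  apply propext
  have e1 : (S r c t ∧ j' = j + sh r c t ∧
      ¬ ∃ r1 c1, M r1 c1 t ∧ er r1 c1 t = r ∧ ec r1 c1 t = c ∧ p r1 c1 t = j) ↔
      (S r c t ∧ j = j' + sh r c t ∧
      ¬ ∃ c1 r1, M r1 c1 t ∧ ec r1 c1 t = c ∧ er r1 c1 t = r ∧ q r1 c1 t = j') := by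
    constructor
    · rintro ⟨a, a1, a2⟩
      refine ⟨a, key _ _ _ a1, ?_⟩
      rintro ⟨c1, r1, b, b1, b2, b3⟩
      refine a2 ⟨r1, c1, b, b2, b1, ?_⟩
      rw [h.qp, b1, b2, a1] at b3
      exact add_right_cancel b3
    · rintro ⟨a, a1, a2⟩
      refine ⟨a, key _ _ _ a1, ?_⟩
      rintro ⟨r1, c1, b, b1, b2, b3⟩
      refine a2 ⟨c1, r1, b, b2, b1, ?_⟩
      rw [h.qp, b1, b2, b3, a1, add_assoc, h2, add_zero]
  unfold FE
  rw [e1]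
  constructor
  · rintro (a | a | a | a | a)
    · exact Or.inl a
    · exact Or.inr (Or.inr (Or.inl a))
    · exact Or.inr (Or.inl a)
    · exact Or.inr (Or.inr (Or.inr (Or.inr a)))
    · exact Or.inr (Or.inr (Or.inr (Or.inl a)))
  · rintro (a | a | a | a | a)
    · exact Or.inl a
    · exact Or.inr (Or.inr (Or.inl a))
    · exact Or.inr (Or.inl a)
    · exact Or.inr (Or.inr (Or.inr (Or.inr a)))
    · exact Or.inr (Or.inr (Or.inr (Or.inl a)))

end OneVarEq

namespace OneVarEq

/-- row half of the balance conditions -/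
structure HBal {T R C : Type} (σ : Sys T) (kr : R → ℕ) (kc : C → ℕ) (X : R → C → T)
    (P : R → Set T) (Q : C → Set T) : Prop where
  s : ∀ t, σ.A t → {c | RStub kc kr (fun c r => X r c) Q c t ∧ kc c = 2}.ncard ≤
    {r | RStub kr kc X P r t ∧ kr r = 2}.ncard
  u : ∀ t, σ.A t → {c | RStub kc kr (fun c r => X r c) Q c t ∧ kc c ≠ 2}.ncard ≤
    {r | RStub kr kc X P r t ∧ kr r ≠ 2}.ncard

structure MatchA {R C : Type} (Rs : Set R) (Ra : Set R) (a : Prop) (ρ : R → C → Prop) : Prop where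
  mem : ∀ r c, ρ r c → r ∈ Ra
  st : ∀ r c, ρ r c → a → r ∈ Rs
  un : ∀ r c c', ρ r c → ρ r c' → a → c = c'
  ex : ∀ r ∈ Rs, ∃ c, ρ r c

theorem match_core {R C : Type} [Finite R] [Finite C] (Rs Ra : Set R) (Cs Ca : Set C) (a b : Prop)
    (hR : Rs ⊆ Ra) (hC : Cs ⊆ Ca) (ha : a) (h1 : a → Cs.ncard ≤ Rs.ncard)
    (h2 : b → Rs.ncard ≤ Cs.ncard)
    (i0 : R) (k0 : C) (hk : k0 ∈ Ca) (hk' : b → k0 ∈ Cs) :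
    ∃ ρ : R → C → Prop, MatchA Rs Ra a ρ ∧ MatchA Cs Ca b (fun c r => ρ r c) := by
  haveI : Nonempty R := ⟨i0⟩
  have hle : Cs.encard ≤ Rs.encard := by
    rw [← (Set.toFinite Cs).cast_ncard_eq, ← (Set.toFinite Rs).cast_ncard_eq]
    exact_mod_cast h1 ha
  obtain ⟨f, hf, hinj⟩ := (Set.toFinite Cs).exists_injOn_of_encard_le hle
  have hsurj : b → ∀ r ∈ Rs, ∃ c ∈ Cs, f c = r := by
    intro hb r hr
    have h3 : f '' Cs = Rs := by
      apply Set.eq_of_subset_of_ncard_le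
      · rintro _ ⟨c, hc, rfl⟩; exact hf hc
      · rw [Set.ncard_image_of_injOn hinj]; exact h2 hb
      · exact Set.toFinite _
    rw [← h3] at hr
    obtain ⟨c, hc, rfl⟩ := hr
    exact ⟨c, hc, rfl⟩
  refine ⟨fun r c => r ∈ Rs ∧ ((c ∈ Cs ∧ f c = r) ∨ (c = k0 ∧ ∀ c ∈ Cs, f c ≠ r)), ⟨?_, ?_, ?_, ?_⟩,
    ⟨?_, ?_, ?_, ?_⟩⟩
  · rintro r c ⟨h, -⟩; exact hR h
  · rintro r c ⟨h, -⟩ _; exact h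
  · rintro r c c' ⟨h, ⟨h3, h4⟩ | ⟨h3, h4⟩⟩ ⟨h', ⟨h3', h4'⟩ | ⟨h3', h4'⟩⟩ _
    · exact hinj h3 h3' (h4.trans h4'.symm)
    · exact absurd h4 (h4' _ h3)
    · exact absurd h4' (h4 _ h3')
    · exact h3.trans h3'.symm
  · intro r hr
    by_cases h : ∃ c ∈ Cs, f c = r
    · obtain ⟨c, hc, h⟩ := h; exact ⟨c, hr, Or.inl ⟨hc, h⟩⟩
    · push Not at h; exact ⟨k0, hr, Or.inr ⟨rfl, h⟩⟩
  · rintro c r ⟨h, ⟨h3, h4⟩ | ⟨rfl, h4⟩⟩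
    · exact hC h3
    · exact hk
  · rintro c r ⟨h, ⟨h3, h4⟩ | ⟨rfl, h4⟩⟩ hb
    · exact h3
    · exact hk' hb
  · rintro c r r' ⟨h, ⟨h3, h4⟩ | ⟨h3, h4⟩⟩ ⟨h', ⟨h3', h4'⟩ | ⟨h3', h4'⟩⟩ hb
    · exact h4.symm.trans h4'
    · obtain ⟨c1, hc1, h5⟩ := hsurj hb _ h'
      exact absurd h5 (h4' _ hc1)
    · obtain ⟨c1, hc1, h5⟩ := hsurj hb _ h
      exact absurd h5 (h4 _ hc1)
    · obtain ⟨c1, hc1, h5⟩ := hsurj hb _ h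
      exact absurd h5 (h4 _ hc1)
  · intro c hc
    exact ⟨f c, hf hc, Or.inl ⟨hc, rfl⟩⟩

theorem match_S {R C : Type} [Finite R] [Finite C] (Rs Ra : Set R) (Cs Ca : Set C) (a b : Prop)
    (hR : Rs ⊆ Ra) (hC : Cs ⊆ Ca) (h1 : a → Cs.ncard ≤ Rs.ncard)
    (h2 : b → Rs.ncard ≤ Cs.ncard)
    (i0 : R) (hi : i0 ∈ Ra) (hi' : a → i0 ∈ Rs) (k0 : C) (hk : k0 ∈ Ca) (hk' : b → k0 ∈ Cs) :
    ∃ ρ : R → C → Prop, MatchA Rs Ra a ρ ∧ MatchA Cs Ca b (fun c r => ρ r c) := by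
  by_cases ha : a
  · exact match_core Rs Ra Cs Ca a b hR hC ha h1 h2 i0 k0 hk hk'
  by_cases hb : b
  · obtain ⟨ρ, h, h'⟩ := match_core Cs Ca Rs Ra b a hC hR hb h2 h1 k0 i0 hi hi'
    exact ⟨fun r c => ρ c r, h', h⟩
  refine ⟨fun r c => (r ∈ Rs ∧ c = k0) ∨ (c ∈ Cs ∧ r = i0), ⟨?_, ?_, ?_, ?_⟩, ⟨?_, ?_, ?_, ?_⟩⟩
  · rintro r c (⟨h, -⟩ | ⟨-, rfl⟩)
    · exact hR h
    · exact hi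
  · intro _ _ _ h; exact absurd h ha
  · intro _ _ _ _ _ h; exact absurd h ha
  · intro r hr; exact ⟨k0, Or.inl ⟨hr, rfl⟩⟩
  · rintro c r (⟨-, rfl⟩ | ⟨h, -⟩)
    · exact hk
    · exact hC h
  · intro _ _ _ h; exact absurd h hb
  · intro _ _ _ _ _ h; exact absurd h hb
  · intro c hc; exact ⟨i0, Or.inr ⟨hc, rfl⟩⟩

theorem match_M_core {R C : Type} [Finite R] [Finite C] (Rs : Set R) (Cs : Set C)
    (a b : Prop) (ha : a) (h1 : a → Cs.ncard ≤ Rs.ncard) (h2 : b → Rs.ncard ≤ Cs.ncard) :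
    ∃ ρ : R → C → Prop, (∀ r c, ρ r c → r ∈ Rs ∧ c ∈ Cs) ∧ (∀ r c c', ρ r c → ρ r c' → c = c') ∧
      (∀ r r' c, ρ r c → ρ r' c → r = r') ∧ (a → ∀ c ∈ Cs, ∃ r, ρ r c) ∧
      (b → ∀ r ∈ Rs, ∃ c, ρ r c) := by
  by_cases hne : Nonempty R
  · have hle : Cs.encard ≤ Rs.encard := by
      rw [← (Set.toFinite Cs).cast_ncard_eq, ← (Set.toFinite Rs).cast_ncard_eq]
      exact_mod_cast h1 ha
    obtain ⟨f, hf, hinj⟩ := (Set.toFinite Cs).exists_injOn_of_encard_le hle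
    refine ⟨fun r c => c ∈ Cs ∧ f c = r, ?_, ?_, ?_, ?_, ?_⟩
    · rintro r c ⟨h, rfl⟩; exact ⟨hf h, h⟩
    · rintro r c c' ⟨h, h3⟩ ⟨h', h3'⟩; exact hinj h h' (h3.trans h3'.symm)
    · rintro r r' c ⟨h, h3⟩ ⟨h', h3'⟩; exact h3.symm.trans h3'
    · intro _ c hc; exact ⟨_, hc, rfl⟩
    · intro hb r hr
      have h3 : f '' Cs = Rs := by
        apply Set.eq_of_subset_of_ncard_le
        · rintro _ ⟨c, hc, rfl⟩; exact hf hc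
        · rw [Set.ncard_image_of_injOn hinj]; exact h2 hb
        · exact Set.toFinite _
      rw [← h3] at hr
      obtain ⟨c, hc, rfl⟩ := hr
      exact ⟨c, hc, rfl⟩
  · have hRs : Rs = ∅ := by
      ext r; exact absurd ⟨r⟩ hne
    have hCs : Cs = ∅ := by
      have := h1 ha
      rw [hRs, Set.ncard_empty] at this
      exact (Set.ncard_eq_zero (Set.toFinite _)).1 (by omega)
    refine ⟨fun _ _ => False, ?_, ?_, ?_, ?_, ?_⟩
    · intro _ _ h; exact h.elim
    · intro _ _ _ h; exact h.elim
    · intro _ _ _ h; exact h.elim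
    · intro _ c hc; rw [hCs] at hc; exact hc.elim
    · intro _ c hc; rw [hRs] at hc; exact hc.elim

theorem match_M {R C : Type} [Finite R] [Finite C] (Rs : Set R) (Cs : Set C)
    (a b : Prop) (h1 : a → Cs.ncard ≤ Rs.ncard) (h2 : b → Rs.ncard ≤ Cs.ncard) :
    ∃ ρ : R → C → Prop, (∀ r c, ρ r c → r ∈ Rs ∧ c ∈ Cs) ∧ (∀ r c c', ρ r c → ρ r c' → c = c') ∧
      (∀ r r' c, ρ r c → ρ r' c → r = r') ∧ (a → ∀ c ∈ Cs, ∃ r, ρ r c) ∧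
      (b → ∀ r ∈ Rs, ∃ c, ρ r c) ∧ (∀ r c, ρ r c → a ∨ b) := by
  by_cases ha : a
  · obtain ⟨ρ, g1, g2, g3, g4, g5⟩ := match_M_core Rs Cs a b ha h1 h2
    exact ⟨ρ, g1, g2, g3, g4, g5, fun _ _ _ => Or.inl ha⟩
  by_cases hb : b
  · obtain ⟨ρ, g1, g2, g3, g4, g5⟩ := match_M_core Cs Rs b a hb h2 h1
    exact ⟨fun r c => ρ c r, fun r c h => (g1 c r h).symm, fun r c c' h h' => g3 c c' r h h',
      fun r r' c h h' => g2 c r r' h h', g5, g4, fun _ _ _ => Or.inr hb⟩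
  · exact ⟨fun _ _ => False, fun _ _ h => h.elim, fun _ _ _ h => h.elim, fun _ _ _ h => h.elim,
      fun h => absurd h ha, fun h => absurd h hb, fun _ _ h => h.elim⟩

/-- index type of the copies in the finite realisation -/
abbrev FIdx (R C T : Type) := ((R × C × T) ⊕ (R × C × T)) ⊕ ((R × T) ⊕ (C × T))
abbrev FG (R C T : Type) := FIdx R C T → ZMod 2

theorem realise_fin {T R C : Type} [Finite R] [Finite C] [Finite T] {σ : Sys T}
    {kr : R → ℕ} {kc : C → ℕ} {X : R → C → T} {P : R → Set T} {Q : C → Set T}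
    (hc : Cert σ kr kc X P Q) (hb : HBal σ kr kc X P Q)
    (hb' : HBal σ.swap kc kr (fun c r => X r c) Q P) :
    ∃ Y : Blow kr (0 : FG R C T) → Blow kc (0 : FG R C T) → T, MValid σ Y := by
  classical
  set rs : R → T → Prop := RStub kr kc X P with hrs
  set cs : C → T → Prop := RStub kc kr (fun c r => X r c) Q with hcs
  have hS : ∀ t, ∃ ρ : R → C → Prop,
      MatchA {r | rs r t ∧ kr r = 2} {r | kr r = 2 ∧ t ∈ P r} (σ.A t) ρ ∧
      MatchA {c | cs c t ∧ kc c = 2} {c | kc c = 2 ∧ t ∈ Q c} (σ.B t) (fun c r => ρ r c) := by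
    intro t
    by_cases hne : (∃ r, rs r t) ∨ (∃ c, cs c t)
    · obtain ⟨i, hi1, hi2, hi3⟩ := hc.row.stub t hne
      obtain ⟨k, hk1, hk2, hk3⟩ := hc.col.stub t hne.symm
      refine match_S _ _ _ _ _ _ ?_ ?_ ?_ ?_ i ⟨hi1, hi2⟩ (fun h => ⟨hi3 h, hi1⟩) k ⟨hk1, hk2⟩
        (fun h => ⟨hk3 h, hk1⟩)
      · rintro r ⟨h1, h2⟩; exact ⟨h2, h1.2.1⟩
      · rintro r ⟨h1, h2⟩; exact ⟨h2, h1.2.1⟩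
      · exact hb.s t
      · exact hb'.s t
    · push Not at hne
      refine ⟨fun _ _ => False, ⟨fun _ _ h => h.elim, fun _ _ h => h.elim, fun _ _ _ h => h.elim, ?_⟩,
        ⟨fun _ _ h => h.elim, fun _ _ h => h.elim, fun _ _ _ h => h.elim, ?_⟩⟩
      · rintro r ⟨h, -⟩; exact absurd h (hne.1 r)
      · rintro r ⟨h, -⟩; exact absurd h (hne.2 r)
  choose ρ hρ hρ' using hS
  have hM : ∀ t, ∃ μ : R → C → Prop, _ := fun t => match_M {r | rs r t ∧ kr r ≠ 2}
    {c | cs c t ∧ kc c ≠ 2} (σ.A t) (σ.B t) (hb.u t) (hb'.u t)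
  choose μ m1 m2 m3 m4 m5 m6 using hM
  have hE : ∀ r c t, ∃ e : R × C, μ t r c → ρ t e.1 e.2 := by
    intro r c t
    by_cases h : μ t r c
    · have hst := (m1 t r c h).1.1
      rcases m6 t r c h with hA | hB
      · obtain ⟨i, hi1, hi2, hi3⟩ := hc.row.stub t (Or.inl ⟨r, hst⟩)
        obtain ⟨k, hk⟩ := (hρ t).ex i ⟨hi3 hA, hi1⟩
        exact ⟨(i, k), fun _ => hk⟩
      · obtain ⟨i, hi1, hi2, hi3⟩ := hc.col.stub t (Or.inr ⟨r, hst⟩)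
        obtain ⟨k, hk⟩ := (hρ' t).ex i ⟨hi3 hB, hi1⟩
        exact ⟨(k, i), fun _ => hk⟩
    · exact ⟨(r, c), fun h' => absurd h' h⟩
  choose e he using hE
  have hV : ∀ r t, ∃ k : Option C, rs r t → ∃ k', k = some k' ∧ kc k' = 2 ∧ t ∈ Q k' := by
    intro r t
    by_cases h : rs r t
    · obtain ⟨i, hi1, hi2, hi3⟩ := hc.col.stub t (Or.inr ⟨r, h⟩)
      exact ⟨some i, fun _ => ⟨i, rfl, hi1, hi2⟩⟩
    · exact ⟨none, fun h' => absurd h' h⟩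
  have hV' : ∀ c t, ∃ k : Option R, cs c t → ∃ k', k = some k' ∧ kr k' = 2 ∧ t ∈ P k' := by
    intro r t
    by_cases h : cs r t
    · obtain ⟨i, hi1, hi2, hi3⟩ := hc.row.stub t (Or.inr ⟨r, h⟩)
      exact ⟨some i, fun _ => ⟨i, rfl, hi1, hi2⟩⟩
    · exact ⟨none, fun hh => absurd hh h⟩
  -- trivial cases when a side is empty
  by_cases hR : Nonempty R
  swap
  · refine ⟨fun p => absurd ⟨p.1.1⟩ hR, ⟨fun w => absurd ⟨w.1.1⟩ hR, fun w => absurd ⟨w.1.1⟩ hR⟩, ?_, ?_⟩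
    · intro d
      have h1 := hc.col.rr d.1.1
      have h2 : Q d.1.1 = ∅ := by
        by_contra hne
        obtain ⟨t, ht⟩ := Set.nonempty_iff_ne_empty.2 hne
        by_cases h0 : kc d.1.1 = 0
        · obtain ⟨r, -⟩ := hc.col.closed _ h0 t ht
          exact hR ⟨r⟩
        · obtain ⟨i, -⟩ := hc.row.stub t (Or.inr ⟨d.1.1, h0, ht, fun r => absurd ⟨r⟩ hR⟩)
          exact hR ⟨i⟩
      rw [h2] at h1
      convert h1
      rw [Set.range_eq_empty_iff]
      exact ⟨fun w => hR ⟨w.1.1⟩⟩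
    · intro d w; exact absurd ⟨w.1.1⟩ hR
  by_cases hC : Nonempty C
  swap
  · refine ⟨fun _ p => absurd ⟨p.1.1⟩ hC, ⟨?_, ?_⟩, fun w => absurd ⟨w.1.1⟩ hC, fun w => absurd ⟨w.1.1⟩ hC⟩
    · intro d
      have h1 := hc.row.rr d.1.1
      have h2 : P d.1.1 = ∅ := by
        by_contra hne
        obtain ⟨t, ht⟩ := Set.nonempty_iff_ne_empty.2 hne
        by_cases h0 : kr d.1.1 = 0
        · obtain ⟨r, -⟩ := hc.row.closed _ h0 t ht
          exact hC ⟨r⟩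
        · obtain ⟨i, -⟩ := hc.col.stub t (Or.inr ⟨d.1.1, h0, ht, fun r => absurd ⟨r⟩ hC⟩)
          exact hC ⟨i⟩
      rw [h2] at h1
      convert h1
      rw [Set.range_eq_empty_iff]
      exact ⟨fun w => hC ⟨w.1.1⟩⟩
    · intro d w; exact absurd ⟨w.1.1⟩ hC
  have hV1 : ∀ r t, ∃ k : C, rs r t → kc k = 2 ∧ t ∈ Q k := by
    intro r t
    obtain ⟨k, hk⟩ := hV r t
    by_cases h : rs r t
    · obtain ⟨k', -, h2⟩ := hk h; exact ⟨k', fun _ => h2⟩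
    · exact ⟨Classical.choice hC, fun h' => absurd h' h⟩
  have hV2 : ∀ r t, ∃ k : R, cs r t → kr k = 2 ∧ t ∈ P k := by
    intro r t
    obtain ⟨k, hk⟩ := hV' r t
    by_cases h : cs r t
    · obtain ⟨k', -, h2⟩ := hk h; exact ⟨k', fun _ => h2⟩
    · exact ⟨Classical.choice hR, fun h' => absurd h' h⟩
  choose vk hvk using hV1
  choose vi hvi using hV2
  let S : R → C → T → Prop := fun r c t => ρ t r c
  let M : R → C → T → Prop := fun r c t => μ t r c
  let er : R → C → T → R := fun r c t => (e r c t).1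
  let ec : R → C → T → C := fun r c t => (e r c t).2
  let sh : R → C → T → FG R C T := fun r c t => Pi.single (Sum.inl (Sum.inl (r, c, t))) 1
  let p : R → C → T → FG R C T := fun r c t => Pi.single (Sum.inl (Sum.inr (r, c, t))) 1
  let q : R → C → T → FG R C T := fun r c t => p r c t + sh (er r c t) (ec r c t) t
  let vs : R → T → FG R C T := fun r t => Pi.single (Sum.inr (Sum.inl (r, t))) 1
  let vt : C → T → FG R C T := fun r t => Pi.single (Sum.inr (Sum.inr (r, t))) 1
  have hchar : ∀ x : FG R C T, x + x = 0 := by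
    intro x; funext i; simp only [Pi.add_apply, Pi.zero_apply]; exact CharTwo.add_self_eq_zero _
  have hpi : ∀ r c t r' c' t', p r c t = p r' c' t' → r = r' ∧ c = c' ∧ t = t' := by
    intro r c t r' c' t' h
    have := congrFun h (Sum.inl (Sum.inr (r, c, t)))
    simp only [p, Pi.single_apply] at this
    simpa using this
  have hqi : ∀ r c t r' c' t', q r c t = q r' c' t' → r = r' ∧ c = c' ∧ t = t' := by
    intro r c t r' c' t' h
    have := congrFun h (Sum.inl (Sum.inr (r, c, t)))
    simp only [p, q, sh, Pi.single_apply, Pi.add_apply] at this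
    simpa using this
  have hF : HF σ kr kc X P Q S M er ec sh p q
      (fun r t => rs r t ∧ kr r ≠ 2 ∧ ¬ ∃ c, M r c t) vk vs := by
    refine ⟨?_, ?_, ?_, ?_, ?_, ?_, ?_, ?_, ?_, ?_, hqi, ?_, ?_, ?_, ?_, ?_, ?_, ?_, ?_, ?_, ?_⟩
    · intro r c t h; exact ((hρ t).mem r c h).1
    · intro r c t h; exact ((hρ t).mem r c h).2
    · intro r c t h hA; exact ((hρ t).st r c h hA).1
    · intro r c c' t h h' hA; exact (hρ t).un r c c' h h' hA
    · intro r t h h2; exact (hρ t).ex r ⟨h, h2⟩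
    · intro r c t t' h
      have := congrFun h (Sum.inl (Sum.inl (r, c, t)))
      simp only [sh, Pi.single_apply] at this
      simpa using this
    · intro r c t h; exact he r c t h
    · intro r c t h; exact (m1 t r c h).1.1
    · intro r c t h; exact (m1 t r c h).1.2
    · intro r c c' t h h'; exact m2 t r c c' h h'
    · intro r c t; rfl
    · intro r t r' t' h
      have := congrFun h (Sum.inr (Sum.inl (r, t)))
      simp only [vs, Pi.single_apply] at this
      simp at this
      exact this.2
    · intro r c t r' t' h
      have := congrFun h (Sum.inr (Sum.inl (r', t')))
      simp [vs, p, q, sh, Pi.single_apply] at this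
    · rintro r t ⟨h, -, -⟩; exact h
    · rintro r t ⟨-, h, -⟩; exact h
    · rintro r t ⟨h, -, -⟩; exact (hvk r t h).1
    · rintro r t ⟨h, -, -⟩; exact (hvk r t h).2
    · rintro r t ⟨h, h2, h3⟩ hB; exact h3 (m5 t hB r ⟨h, h2⟩)
    · rintro r t ⟨-, -, h⟩; exact h
    · intro r t h h2
      by_cases h3 : ∃ c, M r c t
      · exact Or.inr h3
      · exact Or.inl ⟨h, h2, h3⟩
  have hF' : HF σ.swap kc kr (fun c r => X r c) Q P (fun c r => S r c) (fun c r => M r c)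
      (fun c r => ec r c) (fun c r => er r c) (fun c r => sh r c) (fun c r => q r c)
      (fun c r => p r c)
      (fun c t => cs c t ∧ kc c ≠ 2 ∧ ¬ ∃ r, M r c t) vi vt := by
    refine ⟨?_, ?_, ?_, ?_, ?_, ?_, ?_, ?_, ?_, ?_, ?_, ?_, ?_, ?_, ?_, ?_, ?_, ?_, ?_, ?_, ?_⟩
    · intro r c t h; exact ((hρ' t).mem r c h).1
    · intro r c t h; exact ((hρ' t).mem r c h).2
    · intro r c t h hA; exact ((hρ' t).st r c h hA).1
    · intro r c c' t h h' hA; exact (hρ' t).un r c c' h h' hA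
    · intro r t h h2; exact (hρ' t).ex r ⟨h, h2⟩
    · intro c r t t' h
      have := congrFun h (Sum.inl (Sum.inl (r, c, t)))
      simp only [sh, Pi.single_apply] at this
      simpa using this
    · intro c r t h; exact he r c t h
    · intro c r t h; exact (m1 t r c h).2.1
    · intro c r t h; exact (m1 t r c h).2.2
    · intro c r r' t h h'; exact m3 t r r' c h h'
    · intro c r t c' r' t' h
      obtain ⟨a1, a2, a3⟩ := hpi _ _ _ _ _ _ h
      exact ⟨a2, a1, a3⟩
    · intro c r t
      change p r c t = p r c t + sh (er r c t) (ec r c t) t + sh (er r c t) (ec r c t) t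
      rw [add_assoc, hchar, add_zero]
    · intro r t r' t' h
      have := congrFun h (Sum.inr (Sum.inr (r, t)))
      simp only [vt, Pi.single_apply] at this
      simp at this
      exact this.2
    · intro r c t r' t' h
      have := congrFun h (Sum.inr (Sum.inr (r', t')))
      simp [vt, p, Pi.single_apply] at this
    · rintro r t ⟨h, -, -⟩; exact h
    · rintro r t ⟨-, h, -⟩; exact h
    · rintro r t ⟨h, -, -⟩; exact (hvi r t h).1
    · rintro r t ⟨h, -, -⟩; exact (hvi r t h).2
    · rintro r t ⟨h, h2, h3⟩ hB; exact h3 (m4 t hB r ⟨h, h2⟩)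
    · rintro r t ⟨-, -, h⟩; exact h
    · intro c t h h2
      by_cases h3 : ∃ r, M r c t
      · exact Or.inr h3
      · exact Or.inl ⟨h, h2, h3⟩
  refine realise hc (hf_edge hF hF') ?_
  rw [fe_swap hchar hF]
  exact hf_edge hF' hF

end OneVarEq

namespace OneVarEq

/-- bound in the one-dimensional zero-sum lemma -/
def zh (M : ℕ) : ℕ := (M + 1) * (M * M) + 1

theorem zs_half (s : Finset ℕ) (f : ℕ → ℤ) (M : ℕ) (hM : ∀ x ∈ s, |f x| ≤ M)
    (h0 : ∑ x ∈ s, f x = 0) (hnz : ∀ x ∈ s, f x ≠ 0) (hc : (M + 1) * (M * M) < s.card) :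
    ∃ v : ℕ, 1 ≤ v ∧ v ≤ M ∧ M < (s.filter (fun x => f x = (v : ℤ))).card := by
  classical
  have hle : s.card ≤ (M + 1) * (s.filter (fun x => 0 < f x)).card := by
    have e1 : ∑ x ∈ s.filter (fun x => 0 < f x), f x + ∑ x ∈ s.filter (fun x => ¬ 0 < f x), f x = 0 := by
      rw [Finset.sum_filter_add_sum_filter_not, h0]
    have e2 : ∑ x ∈ s.filter (fun x => 0 < f x), f x ≤
        (s.filter (fun x => 0 < f x)).card • (M : ℤ) := by
      apply Finset.sum_le_card_nsmul
      intro x hx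
      exact (abs_le.1 (hM x (Finset.mem_filter.1 hx).1)).2
    have e3 : ∑ x ∈ s.filter (fun x => ¬ 0 < f x), f x ≤
        (s.filter (fun x => ¬ 0 < f x)).card • (-1 : ℤ) := by
      apply Finset.sum_le_card_nsmul
      intro x hx
      have h1 := Finset.mem_filter.1 hx
      have h2 := hnz x h1.1
      omega
    have e4 := Finset.card_filter_add_card_filter_not (s := s) (fun x => 0 < f x)
    simp only [nsmul_eq_mul] at e2 e3
    have e5 : ((s.filter (fun x => ¬ 0 < f x)).card : ℤ) ≤ (s.filter (fun x => 0 < f x)).card * (M : ℤ) := by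
      linarith
    have e6 : (s.filter (fun x => ¬ 0 < f x)).card ≤ (s.filter (fun x => 0 < f x)).card * M := by
      exact_mod_cast e5
    rw [← e4]
    nlinarith
  have hpos : M * M < (s.filter (fun x => 0 < f x)).card := by
    by_contra hcon
    push Not at hcon
    have := Nat.mul_le_mul_left (M + 1) hcon
    omega
  have := Finset.exists_lt_card_fiber_of_mul_lt_card_of_maps_to
    (s := s.filter (fun x => 0 < f x)) (t := Finset.Icc (1:ℤ) M) (f := f) (n := M) ?_ ?_
  · obtain ⟨y, hy, hlt⟩ := this
    rw [Finset.mem_Icc] at hy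
    refine ⟨y.toNat, by omega, by omega, lt_of_lt_of_le hlt (Finset.card_le_card ?_)⟩
    intro x hx
    rw [Finset.mem_filter, Finset.mem_filter] at hx
    rw [Finset.mem_filter]
    refine ⟨hx.1.1, ?_⟩
    rw [hx.2]
    omega
  · intro x hx
    rw [Finset.mem_filter] at hx
    rw [Finset.mem_Icc]
    have := (abs_le.1 (hM x hx.1)).2
    omega
  · simpa using hpos

theorem zs_sub (s : Finset ℕ) (f : ℕ → ℤ) (M : ℕ) (hM : ∀ x ∈ s, |f x| ≤ M)
    (h0 : ∑ x ∈ s, f x = 0) (hc : zh M < s.card) :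
    ∃ u ⊆ s, u.Nonempty ∧ u.card ≤ zh M ∧ ∑ x ∈ u, f x = 0 := by
  classical
  by_cases hz : ∃ x ∈ s, f x = 0
  · obtain ⟨x, hx, hx0⟩ := hz
    refine ⟨{x}, by simpa using hx, by simp, ?_, by simpa using hx0⟩
    simp [zh]
  push Not at hz
  unfold zh at hc
  obtain ⟨v, hv1, hv2, hv3⟩ := zs_half s f M hM h0 hz (by omega)
  obtain ⟨q, hq1, hq2, hq3⟩ := zs_half s (fun x => - f x) M (by simpa using hM) (by simp [h0])
    (by simpa using hz) (by omega)
  obtain ⟨u1, hu1, hu1c⟩ := Finset.exists_subset_card_eq (show q ≤ _ from by omega : q ≤ (s.filter (fun x => f x = (v : ℤ))).card)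
  obtain ⟨u2, hu2, hu2c⟩ := Finset.exists_subset_card_eq (show v ≤ _ from by omega : v ≤ (s.filter (fun x => - f x = (q : ℤ))).card)
  have f1 : ∀ x ∈ u1, x ∈ s ∧ f x = v := fun x hx => Finset.mem_filter.1 (hu1 hx)
  have f2 : ∀ x ∈ u2, x ∈ s ∧ - f x = q := fun x hx => Finset.mem_filter.1 (hu2 hx)
  have hd : Disjoint u1 u2 := by
    rw [Finset.disjoint_left]
    intro x h1 h2
    have := (f1 x h1).2
    have := (f2 x h2).2
    omega
  refine ⟨u1 ∪ u2, ?_, ?_, ?_, ?_⟩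
  · intro x hx
    rcases Finset.mem_union.1 hx with h | h
    · exact (f1 x h).1
    · exact (f2 x h).1
  · rw [← Finset.card_pos, Finset.card_union_of_disjoint hd]; omega
  · rw [Finset.card_union_of_disjoint hd, hu1c, hu2c]
    unfold zh
    have : 1 ≤ M := by omega
    nlinarith [Nat.mul_le_mul this this]
  · rw [Finset.sum_union hd, Finset.sum_congr rfl (fun x hx => (f1 x hx).2),
      Finset.sum_congr rfl (fun x hx => (show f x = -(q:ℤ) by have := (f2 x hx).2; omega))]
    simp only [Finset.sum_const, hu1c, hu2c, nsmul_eq_mul]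
    ring

theorem zs_one (M : ℕ) (f : ℕ → ℤ) : ∀ (n : ℕ) (s : Finset ℕ), s.card ≤ n → (∀ x ∈ s, |f x| ≤ M) →
    ∑ x ∈ s, f x = 0 → ∃ l : ℕ → ℕ, ∀ a, (s.filter (fun x => l x = a)).card ≤ zh M ∧
      ∑ x ∈ s.filter (fun x => l x = a), f x = 0 := by
  classical
  intro n
  induction n with
  | zero =>
    intro s hs hM h0
    have : s = ∅ := Finset.card_eq_zero.1 (by omega)
    subst this
    exact ⟨fun _ => 0, fun a => by simp⟩
  | succ n ih =>
    intro s hs hM h0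
    by_cases hc : zh M < s.card
    · obtain ⟨u, hus, hune, huc, hu0⟩ := zs_sub s f M hM h0 hc
      obtain ⟨l, hl⟩ := ih (s \ u) (by
        have := Finset.card_sdiff_add_card_eq_card hus
        have := hune.card_pos
        omega) (fun x hx => hM x (Finset.mem_sdiff.1 hx).1) (by
        have := Finset.sum_sdiff (f := f) hus
        omega)
      refine ⟨fun x => if x ∈ u then 0 else l x + 1, fun a => ?_⟩
      cases a with
      | zero =>
        have : s.filter (fun x => (if x ∈ u then 0 else l x + 1) = 0) = u := by
          ext x
          simp only [Finset.mem_filter]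
          constructor
          · rintro ⟨-, h⟩
            by_contra hx
            simp [hx] at h
          · intro hx; exact ⟨hus hx, by simp [hx]⟩
        rw [this]; exact ⟨huc, hu0⟩
      | succ a =>
        have : s.filter (fun x => (if x ∈ u then 0 else l x + 1) = a + 1) =
            (s \ u).filter (fun x => l x = a) := by
          ext x
          simp only [Finset.mem_filter, Finset.mem_sdiff]
          by_cases hx : x ∈ u <;> simp [hx]
        rw [this]; exact hl a
    · refine ⟨fun _ => 0, fun a => ?_⟩
      by_cases ha : a = 0
      · subst ha; simp only [Finset.filter_true]; exact ⟨by omega, h0⟩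
      · have : ∀ x ∈ s, ¬ ((0:ℕ) = a) := fun x _ h => ha h.symm
        rw [Finset.filter_false_of_mem this]; simp

/-- bound in the zero-sum lemma -/
def zg : ℕ → ℕ → ℕ
  | 0, _ => 1
  | n + 1, M => zh M * zg n (M * zh M)

theorem zs_many : ∀ (n M : ℕ) (s : Finset ℕ) (v : ℕ → ℕ → ℤ), (∀ x ∈ s, ∀ i < n, |v x i| ≤ M) →
    (∀ i < n, ∑ x ∈ s, v x i = 0) → ∃ l : ℕ → ℕ, ∀ a,
      (s.filter (fun x => l x = a)).card ≤ zg n M ∧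
      ∀ i < n, ∑ x ∈ s.filter (fun x => l x = a), v x i = 0 := by
  classical
  intro n
  induction n with
  | zero =>
    intro M s v _ _
    refine ⟨fun x => x, fun a => ⟨?_, by simp⟩⟩
    rw [Finset.filter_eq']
    split_ifs <;> simp [zg]
  | succ n ih =>
    intro M s v hM h0
    obtain ⟨l0, hl0⟩ := zs_one M (fun x => v x n) _ s le_rfl (fun x hx => hM x hx n (by omega))
      (h0 n (by omega))
    obtain ⟨l, hl⟩ := ih (M * zh M) (s.image l0)
      (fun b i => ∑ x ∈ s.filter (fun x => l0 x = b), v x i) (by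
        intro b _ i hi
        refine (Finset.abs_sum_le_sum_abs _ _).trans ?_
        refine (Finset.sum_le_card_nsmul _ _ (M : ℤ) ?_).trans ?_
        · intro x hx; exact hM x (Finset.mem_filter.1 hx).1 i (by omega)
        · rw [nsmul_eq_mul, mul_comm]
          push_cast
          exact mul_le_mul_of_nonneg_left (by exact_mod_cast (hl0 b).1) (by positivity)) (by
        intro i hi
        rw [Finset.sum_fiberwise_of_maps_to (fun x hx => Finset.mem_image_of_mem l0 hx)]
        exact h0 i (by omega))
    have key : ∀ a, s.filter (fun x => l (l0 x) = a) =
        ((s.image l0).filter (fun b => l b = a)).biUnion (fun b => s.filter (fun x => l0 x = b)) := by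
      intro a
      ext x
      simp only [Finset.mem_filter, Finset.mem_biUnion, Finset.mem_image]
      constructor
      · rintro ⟨h1, h2⟩; exact ⟨l0 x, ⟨⟨x, h1, rfl⟩, h2⟩, h1, rfl⟩
      · rintro ⟨b, ⟨-, h2⟩, h1, rfl⟩; exact ⟨h1, h2⟩
    have hdis : ∀ a, (((s.image l0).filter (fun b => l b = a) : Finset ℕ) : Set ℕ).PairwiseDisjoint
        (fun b => s.filter (fun x => l0 x = b)) := by
      intro a b _ b' _ hne
      rw [Function.onFun, Finset.disjoint_left]
      intro x h1 h2
      exact hne ((Finset.mem_filter.1 h1).2.symm.trans (Finset.mem_filter.1 h2).2)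
    refine ⟨fun x => l (l0 x), fun a => ⟨?_, fun i hi => ?_⟩⟩
    · rw [key a, zg, mul_comm]
      refine (Finset.card_biUnion_le_card_mul _ _ _ (fun b _ => (hl0 b).1)).trans ?_
      exact Nat.mul_le_mul_right _ (hl a).1
    · rw [key a, Finset.sum_biUnion (hdis a)]
      by_cases hin : i = n
      · subst hin
        exact Finset.sum_eq_zero (fun b _ => (hl0 b).2)
      · exact (hl a).2 i (by omega)

theorem zs_type {V K : Type} [Fintype V] [Fintype K] [DecidableEq V] (v : V → K → ℤ)
    (hv : ∀ x i, |v x i| ≤ 1) (h0 : ∀ i, ∑ x, v x i = 0) :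
    ∃ l : V → ℕ, (∀ a, {x | l x = a}.ncard ≤ zg (Fintype.card K) 1) ∧
      ∀ a i, ∑ x ∈ Finset.univ.filter (fun x => l x = a), v x i = 0 := by
  classical
  obtain eV := Fintype.equivFin V
  obtain eK := Fintype.equivFin K
  let em : V ↪ ℕ := ⟨fun x => (eV x : ℕ), fun x y h => eV.injective (Fin.ext h)⟩
  let s : Finset ℕ := Finset.univ.map em
  let w : ℕ → ℕ → ℤ := fun x i => if h : x < Fintype.card V ∧ i < Fintype.card K then
    v (eV.symm ⟨x, h.1⟩) (eK.symm ⟨i, h.2⟩) else 0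
  have hw : ∀ x i, w (em x) (eK i) = v x i := by
    intro x i
    have : (em x : ℕ) < Fintype.card V ∧ (eK i : ℕ) < Fintype.card K := ⟨(eV x).2, (eK i).2⟩
    have e1 : (⟨em x, this.1⟩ : Fin (Fintype.card V)) = eV x := Fin.ext rfl
    have e2 : w (em x) (eK i) = v (eV.symm ⟨em x, this.1⟩) (eK.symm ⟨eK i, this.2⟩) := dif_pos this
    rw [e2, e1, Equiv.symm_apply_apply, Fin.eta, Equiv.symm_apply_apply]
  obtain ⟨l, hl⟩ := zs_many (Fintype.card K) 1 s w (by
      intro x hx i hi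
      obtain ⟨y, -, rfl⟩ := Finset.mem_map.1 hx
      have := hw y (eK.symm ⟨i, hi⟩)
      rw [Equiv.apply_symm_apply] at this
      change |w (em y) i| ≤ _
      rw [this]; exact_mod_cast hv _ _) (by
      intro i hi
      rw [Finset.sum_map, ← h0 (eK.symm ⟨i, hi⟩)]
      apply Finset.sum_congr rfl
      intro y _
      have := hw y (eK.symm ⟨i, hi⟩)
      rw [Equiv.apply_symm_apply] at this
      exact this)
  have hfil : ∀ a, s.filter (fun x => l x = a) =
      (Finset.univ.filter (fun x => l (em x) = a)).map em := by
    intro a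
    ext x
    simp only [s, Finset.mem_filter, Finset.mem_map, Finset.mem_univ, true_and]
    constructor
    · rintro ⟨⟨y, rfl⟩, h⟩; exact ⟨y, h, rfl⟩
    · rintro ⟨y, h, rfl⟩; exact ⟨⟨y, rfl⟩, h⟩
  refine ⟨fun x => l (em x), fun a => ?_, fun a i => ?_⟩
  · have := (hl a).1
    rw [hfil, Finset.card_map] at this
    rw [← Set.ncard_coe_finset] at this
    simpa using this
  · have := (hl a).2 (eK i) (eK i).2
    rw [hfil, Finset.sum_map] at this
    rw [← this]
    exact Finset.sum_congr rfl (fun x _ => (hw x i).symm)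

end OneVarEq

namespace OneVarEq

open Classical in
/-- kinds of rows in the extracted certificate -/
noncomputable def kd {W L : Type} (W1 : Set W) (lw : W → L) (U : Set L) (w : W) : ℕ :=
  if w ∈ W1 then (if lw w ∈ U then 1 else 2) else 0

open Classical in
/-- cells of the extracted certificate -/
noncomputable def Xf {T W D : Type} (X fill : W → D → T) (kw : W → ℕ) (ke : D → ℕ)
    (w : W) (d : D) : T :=
  if kw w ≠ 0 ∧ ke d ≠ 0 ∧ (kw w = 2 ∨ ke d = 2) then fill w d else X w d

theorem Xf_swap {T W D : Type} (X fill : W → D → T) (kw : W → ℕ) (ke : D → ℕ) (w : W) (d : D) :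
    Xf (fun d w => X w d) (fun d w => fill w d) ke kw d w = Xf X fill kw ke w d := by
  unfold Xf
  have : (ke d ≠ 0 ∧ kw w ≠ 0 ∧ (ke d = 2 ∨ kw w = 2)) = (kw w ≠ 0 ∧ ke d ≠ 0 ∧ (kw w = 2 ∨ ke d = 2)) := by
    apply propext; constructor <;> rintro ⟨a, b, c⟩ <;> exact ⟨b, a, c.symm⟩
  simp only [this]

/-- row half of the data of an extraction -/
structure HX {T W D L R : Type} (σ : Sys T) (X : W → D → T) (W1 : Set W) (D1 : Set D)
    (lw : W → L) (ld : D → L) (U S : Set L) (Sm : T → Prop) (fill : W → D → T) (ρ : R → W) : Prop where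
  wit : ∀ w, w ∉ W1 → ∀ d, ∃ d', X w d' = X w d ∧ (d' ∉ D1 ∨ ld d' ∈ U)
  sm : ∀ w d, (σ.A (X w d) ∨ σ.B (X w d)) → Sm (X w d) → w ∈ W1 → d ∈ D1 → lw w ∈ U
  rep : ∀ w ∈ W1, ∃ w' ∈ W1, Set.range (X w') = Set.range (X w) ∧ lw w' ∈ S
  repA : ∀ t, σ.A t → ¬ Sm t → ∃ w ∈ W1, ∃ d ∈ D1, X w d = t ∧ lw w ∈ S
  fil : ∀ w ∈ W1, ∀ d ∈ D1, fill w d ∈ Set.range (X w) ∧ ¬ σ.A (fill w d)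
  inj : Function.Injective ρ
  rng : ∀ w, (∃ r, ρ r = w) ↔ (w ∉ W1 ∨ lw w ∈ U ∨ lw w ∈ S)
  dis : ∀ a ∈ U, a ∉ S

section
variable {T W D L R C : Type} {σ : Sys T} {X : W → D → T} {W1 : Set W} {D1 : Set D}
    {lw : W → L} {ld : D → L} {U S : Set L} {Sm : T → Prop} {fill : W → D → T} {ρ : R → W} {γ : C → D}

theorem kd0 {w : W} : kd W1 lw U w = 0 ↔ w ∉ W1 := by
  unfold kd; split_ifs <;> simp_all

theorem kd1 {w : W} : kd W1 lw U w = 1 ↔ w ∈ W1 ∧ lw w ∈ U := by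
  unfold kd; split_ifs <;> simp_all

theorem kd2 {w : W} : kd W1 lw U w = 2 ↔ w ∈ W1 ∧ lw w ∉ U := by
  unfold kd; split_ifs <;> simp_all

theorem kdne {w : W} : kd W1 lw U w = 0 ∨ kd W1 lw U w = 1 ∨ kd W1 lw U w = 2 := by
  unfold kd; split_ifs <;> simp_all

/-- a stub comes from a cell with big row and column -/
theorem stub_cell (h : HX σ X W1 D1 lw ld U S Sm fill ρ)
    (h' : HX σ.swap (fun d w => X w d) D1 W1 ld lw U S Sm (fun d w => fill w d) γ)
    {r : R} {t : T}
    (hs : RStub (fun r => kd W1 lw U (ρ r)) (fun c => kd D1 ld U (γ c))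
      (fun r c => Xf X fill (kd W1 lw U) (kd D1 ld U) (ρ r) (γ c)) (fun r => Set.range (X (ρ r))) r t) :
    ρ r ∈ W1 ∧ ∃ d ∈ D1, X (ρ r) d = t ∧ (kd W1 lw U (ρ r) ≠ 2 → ld d ∉ U) := by
  obtain ⟨h0, ⟨d, hd⟩, hn⟩ := hs
  have hw : ρ r ∈ W1 := by
    by_contra hh; exact h0 (kd0.2 hh)
  dsimp only at hn hd
  have hd1 : d ∈ D1 := by
    by_contra hh
    obtain ⟨c, rfl⟩ := (h'.rng d).2 (Or.inl hh)
    have hk : kd D1 ld U (γ c) = 0 := kd0.2 hh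
    refine hn c (fun _ => by omega) (fun _ => hk) ?_
    rw [Xf, if_neg (by omega)]; exact hd
  refine ⟨hw, d, hd1, hd, fun h2 hU => ?_⟩
  obtain ⟨c, rfl⟩ := (h'.rng d).2 (Or.inr (Or.inl hU))
  have hk : kd D1 ld U (γ c) = 1 := kd1.2 ⟨hd1, hU⟩
  refine hn c (fun _ => by omega) (fun h => absurd h h2) ?_
  rw [Xf, if_neg (by omega)]; exact hd

/-- unique colours give stubs -/
theorem cell_stub (hX : HValid σ X) (h : HX σ X W1 D1 lw ld U S Sm fill ρ)
    (h' : HX σ.swap (fun d w => X w d) D1 W1 ld lw U S Sm (fun d w => fill w d) γ)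
    {r : R} {d : D} (hr : ρ r ∈ W1) (hd : d ∈ D1) (hA : σ.A (X (ρ r) d))
    (hU : kd W1 lw U (ρ r) ≠ 2 → ld d ∉ U) :
    RStub (fun r => kd W1 lw U (ρ r)) (fun c => kd D1 ld U (γ c))
      (fun r c => Xf X fill (kd W1 lw U) (kd D1 ld U) (ρ r) (γ c)) (fun r => Set.range (X (ρ r))) r
      (X (ρ r) d) := by
  refine ⟨fun h0 => kd0.1 h0 hr, ⟨d, rfl⟩, fun c h1 h2 heq => ?_⟩
  dsimp only at h1 h2 heq
  have hov : ¬ (kd W1 lw U (ρ r) ≠ 0 ∧ kd D1 ld U (γ c) ≠ 0 ∧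
      (kd W1 lw U (ρ r) = 2 ∨ kd D1 ld U (γ c) = 2)) := by
    rintro ⟨a, b, c1⟩
    rcases c1 with c1 | c1
    · exact b (h2 c1)
    · by_cases h3 : kd W1 lw U (ρ r) = 2
      · exact b (h2 h3)
      · exact h1 h3 c1
  rw [Xf, if_neg hov] at heq
  have hdc := hX.2 _ _ _ hA heq.symm
  subst hdc
  have := kd0 (W1 := D1) (lw := ld) (U := U) (w := γ c)
  have := kd1 (W1 := D1) (lw := ld) (U := U) (w := γ c)
  have := kdne (W1 := D1) (lw := ld) (U := U) (w := γ c)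
  by_cases h3 : kd W1 lw U (ρ r) = 2
  · exact kd0.1 (h2 h3) hd
  · exact h1 h3 (kd2.2 ⟨hd, hU h3⟩)

theorem hx_cert (hX : HValid σ X) (hX' : HValid σ.swap (fun d w => X w d))
    (h : HX σ X W1 D1 lw ld U S Sm fill ρ)
    (h' : HX σ.swap (fun d w => X w d) D1 W1 ld lw U S Sm (fun d w => fill w d) γ) :
    HCert σ (fun r => kd W1 lw U (ρ r)) (fun c => kd D1 ld U (γ c))
      (fun r c => Xf X fill (kd W1 lw U) (kd D1 ld U) (ρ r) (γ c)) (fun r => Set.range (X (ρ r)))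
      (fun c => Set.range (fun w => X w (γ c))) := by
  have hfil : ∀ w d, kd W1 lw U w ≠ 0 → kd D1 ld U d ≠ 0 →
      fill w d ∈ Set.range (X w) ∧ ¬ σ.A (fill w d) := by
    intro w d h1 h2
    refine h.fil w ?_ d ?_
    · by_contra hh; exact h1 (kd0.2 hh)
    · by_contra hh; exact h2 (kd0.2 hh)
  have hnot : ∀ w d, σ.A (Xf X fill (kd W1 lw U) (kd D1 ld U) w d) →
      Xf X fill (kd W1 lw U) (kd D1 ld U) w d = X w d := by
    intro w d hA
    unfold Xf at hA ⊢
    split_ifs with hc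
    · rw [if_pos hc] at hA
      exact absurd hA (hfil w d hc.1 hc.2.1).2
    · rfl
  refine ⟨?_, ?_, ?_, ?_, ?_, ?_, ?_⟩
  · intro r c
    try dsimp only
    unfold Xf
    split_ifs with hc
    · exact (hfil _ _ hc.1 hc.2.1).1
    · exact ⟨_, rfl⟩
  · intro r; exact hX.1 _
  · intro r c h1 h2 h3
    try dsimp only at h1 h2 h3 ⊢
    rw [Xf, if_pos ⟨h1, h2, h3⟩]
    exact (hfil _ _ h1 h2).2
  · intro r c h2 hA
    try dsimp only at h2 hA
    have e := hnot _ _ hA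
    rw [e] at hA
    by_cases h1 : kd W1 lw U (ρ r) = 0
    · obtain ⟨d', hd', hor⟩ := h.wit _ (kd0.1 h1) (γ c)
      have := hX.2 _ _ _ hA hd'.symm
      subst this
      have h3 := kd2.1 h2
      tauto
    · rw [Xf, if_pos ⟨h1, by omega, Or.inr h2⟩] at e
      have := (hfil (ρ r) (γ c) h1 (by omega)).2
      rw [e] at this
      exact this hA
  · intro r c c' hA heq
    try dsimp only at hA heq
    have e := hnot _ _ hA
    have e' := hnot _ _ (heq ▸ hA)
    rw [e] at hA
    exact h'.inj (hX.2 _ _ _ hA (e.symm.trans (heq.trans e')))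
  · rintro r h0 _ ⟨d, rfl⟩
    try dsimp only at h0 ⊢
    obtain ⟨d', hd', hor⟩ := h.wit _ (kd0.1 h0) d
    obtain ⟨c, rfl⟩ := (h'.rng d').2 (by tauto)
    refine ⟨c, fun h2 => ?_, ?_⟩
    · have := kd2.1 h2; tauto
    · rw [Xf, if_neg (by omega)]; exact hd'
  · intro t hst
    have hcell : ∃ w ∈ W1, ∃ d ∈ D1, X w d = t ∧ ((σ.A t ∨ σ.B t) → ¬ Sm t) := by
      rcases hst with ⟨r, hr⟩ | ⟨c, hc⟩
      · obtain ⟨h1, d, h2, h3, h4⟩ := stub_cell h h' hr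
        refine ⟨_, h1, d, h2, h3, fun hab hsm => ?_⟩
        rw [← h3] at hab hsm
        have g1 := h.sm _ _ hab hsm h1 h2
        have g2 := h'.sm d (ρ r) hab.symm hsm h2 h1
        refine h4 ?_ g2
        intro h5
        exact (kd2.1 h5).2 g1
      · have hc' : RStub (fun c => kd D1 ld U (γ c)) (fun r => kd W1 lw U (ρ r))
            (fun c r => Xf (fun d w => X w d) (fun d w => fill w d) (kd D1 ld U) (kd W1 lw U) (γ c) (ρ r))
            (fun c => Set.range (fun w => X w (γ c))) c t := by
          simpa only [Xf_swap] using hc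
        obtain ⟨h1, d, h2, h3, h4⟩ := stub_cell h' h hc'
        refine ⟨d, h2, _, h1, h3, fun hab hsm => ?_⟩
        rw [← h3] at hab hsm
        have g1 := h'.sm _ _ hab.symm hsm h1 h2
        have g2 := h.sm d (γ c) hab hsm h2 h1
        refine h4 ?_ g2
        intro h5
        exact (kd2.1 h5).2 g1
    obtain ⟨w, hw, d, hd, rfl, hsm⟩ := hcell
    by_cases hA : σ.A (X w d)
    · obtain ⟨w', hw', d', hd', he, hS⟩ := h.repA _ hA (hsm (Or.inl hA))
      obtain ⟨r, rfl⟩ := (h.rng w').2 (Or.inr (Or.inr hS))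
      have k2 : kd W1 lw U (ρ r) = 2 := kd2.2 ⟨hw', fun hu => h.dis _ hu hS⟩
      refine ⟨r, k2, ⟨d', he⟩, fun _ => ?_⟩
      rw [← he]
      exact cell_stub hX h h' hw' hd' (he ▸ hA) (fun hh => absurd k2 hh)
    · obtain ⟨w', hw', he, hS⟩ := h.rep w hw
      obtain ⟨r, rfl⟩ := (h.rng w').2 (Or.inr (Or.inr hS))
      have k2 : kd W1 lw U (ρ r) = 2 := kd2.2 ⟨hw', fun hu => h.dis _ hu hS⟩
      refine ⟨r, k2, ?_, fun hh => absurd hh hA⟩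
      try dsimp only
      rw [he]
      exact ⟨d, rfl⟩

/-- row half of the matching condition on labels -/
structure HLab (σ : Sys T) (X : W → D → T) (W1 : Set W) (D1 : Set D) (lw : W → L) (ld : D → L)
    (Δ : T → Set (W × D)) : Prop where
  sub : ∀ t, ∀ e ∈ Δ t, e.1 ∈ W1 ∧ e.2 ∈ D1 ∧ X e.1 e.2 = t
  fin : ∀ t, (Δ t).Finite
  i1 : ∀ t, Set.InjOn Prod.fst (Δ t)
  i2 : ∀ t, Set.InjOn Prod.snd (Δ t)
  cov : ∀ w ∈ W1, ∀ d ∈ D1, σ.A (X w d) → ∃ e ∈ Δ (X w d), e.2 = d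
  cnt : ∀ t (K : Set L), {e ∈ Δ t | lw e.1 ∈ K}.ncard = {e ∈ Δ t | ld e.2 ∈ K}.ncard

theorem lab_cnt2 {Δ : T → Set (W × D)} (hl : HLab σ X W1 D1 lw ld Δ) (t : T) (K : Set L) :
    {e ∈ Δ t | lw e.1 ∈ K ∧ ld e.2 ∉ K}.ncard = {e ∈ Δ t | ld e.2 ∈ K ∧ lw e.1 ∉ K}.ncard := by
  have hf := hl.fin t
  have e1 : {e ∈ Δ t | lw e.1 ∈ K ∧ ld e.2 ∉ K}.ncard + {e ∈ Δ t | lw e.1 ∈ K ∧ ld e.2 ∈ K}.ncard =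
      {e ∈ Δ t | lw e.1 ∈ K}.ncard := by
    rw [← Set.ncard_union_eq ?_ (hf.subset (fun e he => he.1)) (hf.subset (fun e he => he.1))]
    · congr 1; ext e; simp only [Set.mem_union, Set.mem_ofPred_eq]; tauto
    · rw [Set.disjoint_left]; rintro e ⟨-, -, h1⟩ ⟨-, -, h2⟩; exact h1 h2
  have e2 : {e ∈ Δ t | ld e.2 ∈ K ∧ lw e.1 ∉ K}.ncard + {e ∈ Δ t | lw e.1 ∈ K ∧ ld e.2 ∈ K}.ncard =
      {e ∈ Δ t | ld e.2 ∈ K}.ncard := by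
    rw [← Set.ncard_union_eq ?_ (hf.subset (fun e he => he.1)) (hf.subset (fun e he => he.1))]
    · congr 1; ext e; simp only [Set.mem_union, Set.mem_ofPred_eq]; tauto
    · rw [Set.disjoint_left]; rintro e ⟨-, -, h1⟩ ⟨-, h2, -⟩; exact h1 h2
  have := hl.cnt t K
  omega

theorem hx_bal [Finite R] [Finite C] (hX : HValid σ X)
    (h : HX σ X W1 D1 lw ld U S Sm fill ρ)
    (h' : HX σ.swap (fun d w => X w d) D1 W1 ld lw U S Sm (fun d w => fill w d) γ)
    {Δ : T → Set (W × D)} (hl : HLab σ X W1 D1 lw ld Δ) :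
    HBal σ (fun r => kd W1 lw U (ρ r)) (fun c => kd D1 ld U (γ c))
      (fun r c => Xf X fill (kd W1 lw U) (kd D1 ld U) (ρ r) (γ c)) (fun r => Set.range (X (ρ r)))
      (fun c => Set.range (fun w => X w (γ c))) := by
  have hcs : ∀ c t, RStub (fun c => kd D1 ld U (γ c)) (fun r => kd W1 lw U (ρ r))
      (fun c r => Xf X fill (kd W1 lw U) (kd D1 ld U) (ρ r) (γ c))
      (fun c => Set.range (fun w => X w (γ c))) c t →
      γ c ∈ D1 ∧ ∃ d ∈ W1, X d (γ c) = t ∧ (kd D1 ld U (γ c) ≠ 2 → lw d ∉ U) := by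
    intro c t hc
    have hc' : RStub (fun c => kd D1 ld U (γ c)) (fun r => kd W1 lw U (ρ r))
        (fun c r => Xf (fun d w => X w d) (fun d w => fill w d) (kd D1 ld U) (kd W1 lw U) (γ c) (ρ r))
        (fun c => Set.range (fun w => X w (γ c))) c t := by
      simpa only [Xf_swap] using hc
    exact stub_cell h' h hc'
  constructor
  · intro t hA
    calc _ ≤ {e ∈ Δ t | ld e.2 ∈ S}.ncard := ?_
      _ = {e ∈ Δ t | lw e.1 ∈ S}.ncard := (hl.cnt t S).symm
      _ ≤ _ := ?_
    · have : ∀ c ∈ {c | RStub (fun c => kd D1 ld U (γ c)) (fun r => kd W1 lw U (ρ r))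
          (fun c r => Xf X fill (kd W1 lw U) (kd D1 ld U) (ρ r) (γ c))
          (fun c => Set.range (fun w => X w (γ c))) c t ∧ kd D1 ld U (γ c) = 2},
          γ c ∈ Prod.snd '' {e ∈ Δ t | ld e.2 ∈ S} := by
        rintro c ⟨hc, hk⟩
        obtain ⟨h1, w, hw, rfl, -⟩ := hcs c t hc
        obtain ⟨e, he, he2⟩ := hl.cov w hw (γ c) h1 hA
        refine ⟨e, ⟨he, ?_⟩, he2⟩
        rw [he2]
        have := (h'.rng (γ c)).1 ⟨c, rfl⟩
        have := kd2.1 hk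
        tauto
      have hfin : {e ∈ Δ t | ld e.2 ∈ S}.Finite := (hl.fin t).subset (fun e he => he.1)
      rw [← Set.InjOn.ncard_image (f := Prod.snd) (s := {e ∈ Δ t | ld e.2 ∈ S})
        ((hl.i2 t).mono (fun e he => he.1))]
      exact Set.ncard_le_ncard_of_injOn γ this (h'.inj.injOn) (hfin.image _)
    · have : ∀ e ∈ {e ∈ Δ t | lw e.1 ∈ S}, e.1 ∈ ρ '' {r | RStub (fun r => kd W1 lw U (ρ r))
          (fun c => kd D1 ld U (γ c)) (fun r c => Xf X fill (kd W1 lw U) (kd D1 ld U) (ρ r) (γ c))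
          (fun r => Set.range (X (ρ r))) r t ∧ kd W1 lw U (ρ r) = 2} := by
        rintro e ⟨he, heS⟩
        obtain ⟨h1, h2, h3⟩ := hl.sub t e he
        obtain ⟨r, hr⟩ := (h.rng e.1).2 (Or.inr (Or.inr heS))
        have k2 : kd W1 lw U (ρ r) = 2 := by
          rw [hr]; exact kd2.2 ⟨h1, fun hu => h.dis _ hu heS⟩
        refine ⟨r, ⟨?_, k2⟩, hr⟩
        have := cell_stub (r := r) (d := e.2) hX h h' (hr ▸ h1) h2 (by rw [hr, h3]; exact hA)
          (fun hh => absurd k2 hh)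
        have e3 : X (ρ r) e.2 = t := by rw [hr]; exact h3
        rwa [e3] at this
      rw [← Set.InjOn.ncard_image (f := ρ) h.inj.injOn]
      exact Set.ncard_le_ncard_of_injOn Prod.fst this ((hl.i1 t).mono (fun e he => he.1))
        (Set.toFinite _)
  · intro t hA
    calc _ ≤ {e ∈ Δ t | ld e.2 ∈ U ∧ lw e.1 ∉ U}.ncard := ?_
      _ = {e ∈ Δ t | lw e.1 ∈ U ∧ ld e.2 ∉ U}.ncard := (lab_cnt2 hl t U).symm
      _ ≤ _ := ?_
    · have : ∀ c ∈ {c | RStub (fun c => kd D1 ld U (γ c)) (fun r => kd W1 lw U (ρ r))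
          (fun c r => Xf X fill (kd W1 lw U) (kd D1 ld U) (ρ r) (γ c))
          (fun c => Set.range (fun w => X w (γ c))) c t ∧ kd D1 ld U (γ c) ≠ 2},
          γ c ∈ Prod.snd '' {e ∈ Δ t | ld e.2 ∈ U ∧ lw e.1 ∉ U} := by
        rintro c ⟨hc, hk⟩
        obtain ⟨h1, w, hw, hwt, hwU⟩ := hcs c t hc
        obtain ⟨e, he, he2⟩ := hl.cov w hw (γ c) h1 (hwt ▸ hA)
        rw [hwt] at he
        have hcU : ld (γ c) ∈ U := by
          by_contra hh; exact hk (kd2.2 ⟨h1, hh⟩)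
        refine ⟨e, ⟨he, he2 ▸ hcU, fun heU => ?_⟩, he2⟩
        obtain ⟨g1, g2, g3⟩ := hl.sub t e he
        obtain ⟨r, hr⟩ := (h.rng e.1).2 (Or.inr (Or.inl heU))
        have k1 : kd W1 lw U (ρ r) = 1 := by rw [hr]; exact kd1.2 ⟨g1, heU⟩
        have k1' : kd D1 ld U (γ c) = 1 := kd1.2 ⟨h1, hcU⟩
        refine hc.2.2 r (fun _ => ?_) (fun hh => absurd hh hk) ?_
        · dsimp only; omega
        · dsimp only
          rw [Xf, if_neg (by omega), hr, ← he2]; exact g3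
      have hfin : {e ∈ Δ t | ld e.2 ∈ U ∧ lw e.1 ∉ U}.Finite := (hl.fin t).subset (fun e he => he.1)
      rw [← Set.InjOn.ncard_image (f := Prod.snd) (s := {e ∈ Δ t | ld e.2 ∈ U ∧ lw e.1 ∉ U})
        ((hl.i2 t).mono (fun e he => he.1))]
      exact Set.ncard_le_ncard_of_injOn γ this (h'.inj.injOn) (hfin.image _)
    · have : ∀ e ∈ {e ∈ Δ t | lw e.1 ∈ U ∧ ld e.2 ∉ U}, e.1 ∈ ρ '' {r | RStub (fun r => kd W1 lw U (ρ r))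
          (fun c => kd D1 ld U (γ c)) (fun r c => Xf X fill (kd W1 lw U) (kd D1 ld U) (ρ r) (γ c))
          (fun r => Set.range (X (ρ r))) r t ∧ kd W1 lw U (ρ r) ≠ 2} := by
        rintro e ⟨he, heU, heU'⟩
        obtain ⟨h1, h2, h3⟩ := hl.sub t e he
        obtain ⟨r, hr⟩ := (h.rng e.1).2 (Or.inr (Or.inl heU))
        have k1 : kd W1 lw U (ρ r) = 1 := by rw [hr]; exact kd1.2 ⟨h1, heU⟩
        refine ⟨r, ⟨?_, by omega⟩, hr⟩
        have := cell_stub (r := r) (d := e.2) hX h h' (hr ▸ h1) h2 (by rw [hr, h3]; exact hA)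
          (fun hh => heU')
        have e3 : X (ρ r) e.2 = t := by rw [hr]; exact h3
        rwa [e3] at this
      rw [← Set.InjOn.ncard_image (f := ρ) h.inj.injOn]
      exact Set.ncard_le_ncard_of_injOn Prod.fst this ((hl.i1 t).mono (fun e he => he.1))
        (Set.toFinite _)
end

end OneVarEq

namespace OneVarEq

theorem enc_fib {α β : Type} (f : α → β) (s : Set α) (U : Set β) (u n : ℕ)
    (hm : ∀ a ∈ s, f a ∈ U) (hU : U.encard ≤ u) (hf : ∀ b, {a ∈ s | f a = b}.encard ≤ n) :
    s.encard ≤ (u * n : ℕ) := by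
  classical
  have hUf : U.Finite := Set.finite_of_encard_le_coe hU
  have hs : s.Finite := by
    apply Set.Finite.of_finite_fibers f
    · exact hUf.subset (by rintro _ ⟨a, ha, rfl⟩; exact hm a ha)
    · intro b _
      apply Set.finite_of_encard_le_coe (k := n)
      refine le_trans (le_of_eq ?_) (hf b)
      congr 1
  obtain ⟨s', rfl⟩ := hs.exists_finset_coe
  obtain ⟨U', rfl⟩ := hUf.exists_finset_coe
  rw [Set.encard_coe_eq_coe_finsetCard] at hU ⊢
  have h1 := Finset.card_le_mul_card_image (f := f) s' n (by
    intro b _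
    have := hf b
    have e : {a | a ∈ (s' : Set α) ∧ f a = b} = ((s'.filter (fun a => f a = b) : Finset α) : Set α) := by
      ext a; simp
    rw [e, Set.encard_coe_eq_coe_finsetCard] at this
    exact_mod_cast this)
  have h2 : (s'.image f).card ≤ U'.card := Finset.card_le_card (by
    intro b hb
    obtain ⟨a, ha, rfl⟩ := Finset.mem_image.1 hb
    exact hm a ha)
  have h3 : U'.card ≤ u := by exact_mod_cast hU
  have : s'.card ≤ u * n := by
    refine h1.trans ?_
    rw [mul_comm]
    exact Nat.mul_le_mul_right _ (h2.trans h3)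
  exact_mod_cast this

/-- rows with a big profile class -/
def Big {T W D : Type} (X : W → D → T) (n : ℕ) : Set W :=
  {w | (n : ℕ∞) < {w' | Set.range (X w') = Set.range (X w)}.encard}

/-- cells of colour `t` in a rectangle -/
def Hc {T W D : Type} (X : W → D → T) (W1 : Set W) (D1 : Set D) (t : T) : Set (W × D) :=
  {e | e.1 ∈ W1 ∧ e.2 ∈ D1 ∧ X e.1 e.2 = t}

theorem Hc_swap {T W D : Type} (X : W → D → T) (W1 : Set W) (D1 : Set D) (t : T) :
    (Hc (fun d w => X w d) D1 W1 t).encard = (Hc X W1 D1 t).encard := by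
  have : Hc (fun d w => X w d) D1 W1 t = Prod.swap '' Hc X W1 D1 t := by
    ext ⟨d, w⟩
    constructor
    · rintro ⟨h1, h2, h3⟩; exact ⟨(w, d), ⟨h2, h1, h3⟩, rfl⟩
    · rintro ⟨⟨w', d'⟩, ⟨h1, h2, h3⟩, he⟩
      simp only [Prod.swap_prod_mk, Prod.mk.injEq] at he
      obtain ⟨rfl, rfl⟩ := he
      exact ⟨h2, h1, h3⟩
  rw [this, Function.Injective.encard_image Prod.swap_injective]

theorem encard_univ_le (β : Type) [Fintype β] (s : Set β) : s.encard ≤ Fintype.card β := by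
  refine (Set.encard_le_encard (Set.subset_univ s)).trans ?_
  rw [Set.encard_univ, ENat.card_eq_coe_fintype_card]

section
variable {T W D : Type} [Fintype T]

theorem small_bound (X : W → D → T) (n : ℕ) :
    {w | w ∉ Big X n}.encard ≤ (2 ^ Fintype.card T * n : ℕ) := by
  classical
  apply enc_fib (fun w => Set.range (X w)) _ Set.univ _ _ (fun _ _ => trivial)
  · refine (encard_univ_le (Set T) _).trans ?_
    simp
  · intro P
    by_cases h : ∃ w, w ∉ Big X n ∧ Set.range (X w) = P
    · obtain ⟨w, hw, rfl⟩ := h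
      refine le_trans (Set.encard_le_encard ?_) (not_lt.1 hw)
      rintro w' ⟨-, h⟩; exact h
    · have : {a | a ∈ {w | w ∉ Big X n} ∧ Set.range (X a) = P} = ∅ := by
        ext w; simp only [Set.mem_ofPred_eq, Set.mem_empty_iff_false, iff_false]
        exact fun hh => h ⟨w, hh⟩
      rw [this]; simp

theorem core_half [Nonempty W] (σ : Sys T) (X : W → D → T) (n : ℕ) (W1 : Set W) (D1 : Set D)
    (hD : {d | d ∉ D1}.encard ≤ (2 ^ Fintype.card T * n : ℕ))
    (Sm : T → Prop) (hSm : ∀ t, (σ.A t ∨ σ.B t) → Sm t → (Hc X W1 D1 t).encard ≤ n) :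
    ∃ K : Set W, K.encard ≤ (2 ^ Fintype.card T * n * Fintype.card T + Fintype.card T * n : ℕ) ∧
      (∀ d, d ∉ D1 → ∀ w, ∃ w' ∈ K, X w' d = X w d) ∧
      (∀ w d, (σ.A (X w d) ∨ σ.B (X w d)) → Sm (X w d) → w ∈ W1 → d ∈ D1 → w ∈ K) := by
  classical
  have h1 : ∀ (d : D) (t : T), ∃ w, (∃ w, X w d = t) → X w d = t := by
    intro d t
    by_cases h : ∃ w, X w d = t
    · obtain ⟨w, hw⟩ := h; exact ⟨w, fun _ => hw⟩
    · exact ⟨Classical.arbitrary W, fun h' => absurd h' h⟩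
  choose ω hω using h1
  set K1 : Set W := (fun p : D × T => ω p.1 p.2) '' {p | p.1 ∉ D1}
  set H : Set (W × D) := {e | (σ.A (X e.1 e.2) ∨ σ.B (X e.1 e.2)) ∧ Sm (X e.1 e.2) ∧ e.1 ∈ W1 ∧ e.2 ∈ D1}
  refine ⟨K1 ∪ Prod.fst '' H, ?_, ?_, ?_⟩
  · refine (Set.encard_union_le _ _).trans ?_
    push_cast
    apply add_le_add
    · refine (Set.encard_image_le _ _).trans ?_
      have := enc_fib (fun p : D × T => p.1) {p | p.1 ∉ D1} {d | d ∉ D1} _ (Fintype.card T)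
        (fun p hp => hp) hD (by
          intro d
          have e : {a : D × T | a ∈ {p : D × T | p.1 ∉ D1} ∧ a.1 = d} ⊆ (fun t => (d, t)) '' Set.univ := by
            rintro ⟨d', t⟩ ⟨-, rfl⟩; exact ⟨t, trivial, rfl⟩
          exact (Set.encard_le_encard e).trans ((Set.encard_image_le _ _).trans (encard_univ_le T _)))
      exact_mod_cast this
    · refine (Set.encard_image_le _ _).trans ?_
      have := enc_fib (fun e : W × D => X e.1 e.2) H Set.univ (Fintype.card T) n (fun _ _ => trivial)
        (encard_univ_le T _) (by
          intro t
          by_cases ht : (σ.A t ∨ σ.B t) ∧ Sm t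
          · refine (Set.encard_le_encard ?_).trans (hSm t ht.1 ht.2)
            rintro e ⟨⟨-, -, h3, h4⟩, h5⟩; exact ⟨h3, h4, h5⟩
          · have : {a | a ∈ H ∧ X a.1 a.2 = t} = ∅ := by
              ext e
              simp only [Set.mem_ofPred_eq, Set.mem_empty_iff_false, iff_false]
              rintro ⟨⟨g1, g2, -, -⟩, rfl⟩
              exact ht ⟨g1, g2⟩
            rw [this]; simp)
      exact_mod_cast this
  · intro d hd w
    exact ⟨ω d (X w d), Or.inl ⟨(d, X w d), hd, rfl⟩, hω d _ ⟨w, rfl⟩⟩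
  · intro w d h1 h2 h3 h4
    exact Or.inr ⟨(w, d), ⟨h1, h2, h3, h4⟩, rfl⟩

theorem rep_half [Nonempty W] {L : Type} (σ : Sys T) (X : W → D → T) (hX : HValid σ X) (n n' m : ℕ)
    (D1 : Set D) (lw : W → L) (U : Set L) (hm : {w | lw w ∈ U}.encard ≤ m) (hmn : m ≤ n')
    (hW : ∀ w ∈ Big X n, w ∈ Big X n') (Sm : T → Prop)
    (hSm : ∀ t, (σ.A t ∨ σ.B t) → ¬ Sm t → (n' : ℕ∞) < (Hc X (Big X n) D1 t).encard) :
    ∃ S : Set L, S.encard ≤ (2 ^ Fintype.card T + Fintype.card T : ℕ) ∧ (∀ a ∈ U, a ∉ S) ∧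
      (∀ w ∈ Big X n, ∃ w' ∈ Big X n, Set.range (X w') = Set.range (X w) ∧ lw w' ∈ S) ∧
      (∀ t, σ.A t → ¬ Sm t → ∃ w ∈ Big X n, ∃ d ∈ D1, X w d = t ∧ lw w ∈ S) := by
  classical
  have key : ∀ s : Set W, (n' : ℕ∞) < s.encard → ∃ w ∈ s, lw w ∉ U := by
    intro s hs
    by_contra hcon
    push Not at hcon
    have : s.encard ≤ m := (Set.encard_le_encard (show s ⊆ {w | lw w ∈ U} from hcon)).trans hm
    have h2 : (m : ℕ∞) ≤ n' := by exact_mod_cast hmn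
    exact absurd (this.trans h2) (not_le.2 hs)
  have h1 : ∀ P : Set T, ∃ w : W, (∃ w ∈ Big X n, Set.range (X w) = P) →
      Set.range (X w) = P ∧ lw w ∉ U := by
    intro P
    by_cases h : ∃ w ∈ Big X n, Set.range (X w) = P
    · obtain ⟨w, hw, rfl⟩ := h
      obtain ⟨w', hw', h'⟩ := key _ (hW w hw)
      exact ⟨w', fun _ => ⟨hw', h'⟩⟩
    · exact ⟨Classical.arbitrary W, fun h' => absurd h' h⟩
  choose f hf using h1
  have h2 : ∀ t : T, ∃ w : W, (σ.A t ∧ ¬ Sm t) → lw w ∉ U ∧ w ∈ Big X n ∧ ∃ d ∈ D1, X w d = t := by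
    intro t
    by_cases h : σ.A t ∧ ¬ Sm t
    · have hinj : Set.InjOn Prod.fst (Hc X (Big X n) D1 t) := by
        rintro ⟨w, d⟩ ⟨a1, a2, a3⟩ ⟨w', d'⟩ ⟨b1, b2, b3⟩ he
        dsimp only at *
        subst he
        have := hX.2 w d d' (a3 ▸ h.1) (a3.trans b3.symm)
        rw [this]
      have := hSm t (Or.inl h.1) h.2
      rw [← hinj.encard_image] at this
      obtain ⟨_, ⟨⟨w, d⟩, ⟨h3, h4, h5⟩, rfl⟩, hU⟩ := key _ this
      exact ⟨w, fun _ => ⟨hU, h3, d, h4, h5⟩⟩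
    · exact ⟨Classical.arbitrary W, fun h' => absurd h' h⟩
  choose g hg using h2
  refine ⟨(fun P => lw (f P)) '' {P | ∃ w ∈ Big X n, Set.range (X w) = P} ∪
    (fun t => lw (g t)) '' {t | σ.A t ∧ ¬ Sm t}, ?_, ?_, ?_, ?_⟩
  · refine (Set.encard_union_le _ _).trans ?_
    push_cast
    apply add_le_add
    · refine (Set.encard_image_le _ _).trans ((encard_univ_le (Set T) _).trans ?_)
      simp
    · exact (Set.encard_image_le _ _).trans (encard_univ_le T _)
  · rintro a ha (⟨P, hP, rfl⟩ | ⟨t, ht, rfl⟩)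
    · exact (hf P hP).2 ha
    · exact (hg t ht).1 ha
  · intro w hw
    have hP : ∃ w' ∈ Big X n, Set.range (X w') = Set.range (X w) := ⟨w, hw, rfl⟩
    refine ⟨f (Set.range (X w)), ?_, (hf _ hP).1, Or.inl ⟨_, hP, rfl⟩⟩
    unfold Big
    simp only [Set.mem_ofPred_eq]
    rw [(hf _ hP).1]
    exact hw
  · intro t hA hs
    obtain ⟨h3, h4, d, h5, h6⟩ := hg t ⟨hA, hs⟩
    exact ⟨g t, h4, d, h5, h6, Or.inr ⟨t, ⟨hA, hs⟩, rfl⟩⟩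

theorem fill_ex (σ : Sys T) (X : W → D → T) (hX : MValid σ X) (n' : ℕ)
    (hn : 2 * Fintype.card T + 1 ≤ n') (w : W) (d : D) (hw : w ∈ Big X n')
    (hd : d ∈ Big (fun d w => X w d) n') :
    ∃ t, t ∈ Set.range (X w) ∧ t ∈ Set.range (fun w => X w d) ∧ ¬ σ.A t ∧ ¬ σ.B t := by
  classical
  set N := 2 * Fintype.card T + 1 with hN
  have h1 : ((N : ℕ) : ℕ∞) ≤ {w' | Set.range (X w') = Set.range (X w)}.encard :=
    le_trans (by exact_mod_cast hn) (le_of_lt hw)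
  have h2 : ((N : ℕ) : ℕ∞) ≤ {d' | Set.range (fun w => X w d') = Set.range (fun w => X w d)}.encard :=
    le_trans (by exact_mod_cast hn) (le_of_lt hd)
  obtain ⟨a, ha, hac⟩ := Set.exists_subset_encard_eq h1
  obtain ⟨b, hb, hbc⟩ := Set.exists_subset_encard_eq h2
  obtain ⟨a, rfl⟩ := (Set.finite_of_encard_eq_coe hac).exists_finset_coe
  obtain ⟨b, rfl⟩ := (Set.finite_of_encard_eq_coe hbc).exists_finset_coe
  rw [Set.encard_coe_eq_coe_finsetCard] at hac hbc
  have hac : a.card = N := by exact_mod_cast hac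
  have hbc : b.card = N := by exact_mod_cast hbc
  by_contra hcon
  push Not at hcon
  have hAB : ∀ e ∈ a ×ˢ b, σ.A (X e.1 e.2) ∨ σ.B (X e.1 e.2) := by
    intro e he
    obtain ⟨he1, he2⟩ := Finset.mem_product.1 he
    by_contra hh
    push Not at hh
    refine hh.2 (hcon (X e.1 e.2) ?_ ?_ hh.1)
    · rw [← show _ = _ from ha he1]; exact ⟨_, rfl⟩
    · rw [← show _ = _ from hb he2]; exact ⟨_, rfl⟩
  have c1 : ((a ×ˢ b).filter (fun e => σ.A (X e.1 e.2))).card ≤ (a ×ˢ (Finset.univ : Finset T)).card := by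
    apply Finset.card_le_card_of_injOn (fun e => (e.1, X e.1 e.2))
    · intro e he
      have := Finset.mem_product.1 (Finset.mem_filter.1 he).1
      simp [this.1]
    · rintro ⟨e1, e2⟩ he ⟨f1, f2⟩ hf heq
      simp only [Prod.mk.injEq] at heq
      obtain ⟨rfl, heq⟩ := heq
      have := hX.1.2 _ _ _ (Finset.mem_filter.1 he).2 heq
      rw [Prod.mk.injEq]; exact ⟨rfl, this⟩
  have c2 : ((a ×ˢ b).filter (fun e => σ.B (X e.1 e.2))).card ≤ (b ×ˢ (Finset.univ : Finset T)).card := by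
    apply Finset.card_le_card_of_injOn (fun e => (e.2, X e.1 e.2))
    · intro e he
      have := Finset.mem_product.1 (Finset.mem_filter.1 he).1
      simp [this.2]
    · rintro ⟨e1, e2⟩ he ⟨f1, f2⟩ hf heq
      simp only [Prod.mk.injEq] at heq
      obtain ⟨rfl, heq⟩ := heq
      have := hX.2.2 _ _ _ (Finset.mem_filter.1 he).2 heq
      rw [Prod.mk.injEq]; exact ⟨this, rfl⟩
  have c3 : (a ×ˢ b).card ≤ ((a ×ˢ b).filter (fun e => σ.A (X e.1 e.2))).card +
      ((a ×ˢ b).filter (fun e => σ.B (X e.1 e.2))).card := by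
    rw [← Finset.filter_true_of_mem hAB, Finset.filter_or]
    refine (Finset.card_union_le _ _).trans ?_
    rw [← Finset.filter_or, Finset.filter_true_of_mem hAB]
  rw [Finset.card_product, hac, hbc] at c3
  rw [Finset.card_product, hac, Finset.card_univ] at c1
  rw [Finset.card_product, hbc, Finset.card_univ] at c2
  have : N * N ≤ N * (2 * Fintype.card T) := by nlinarith
  have := Nat.le_of_mul_le_mul_left this (by omega)
  omega

end

theorem gap {ι : Type} [Fintype ι] (a : ι → ℕ → ℕ∞) (N : ℕ → ℕ) (hN : Monotone N)
    (ha : ∀ x, Antitone (a x)) :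
    ∃ i ≤ Fintype.card ι, ∀ x, a x i ≤ N i ∨ (N (i+1) : ℕ∞) < a x i := by
  classical
  by_contra hcon
  push Not at hcon
  choose f hf using fun i : Fin (Fintype.card ι + 1) => hcon i.1 (by omega)
  have hinj : Function.Injective f := by
    have : ∀ i j : Fin (Fintype.card ι + 1), i < j → f i ≠ f j := by
      intro i j hij he
      have h1 := (hf i).2
      have h2 := (hf j).1
      rw [← he] at h2
      have h3 := ha (f i) (show (i : ℕ) ≤ j from le_of_lt hij)
      have h4 : (N (i + 1) : ℕ∞) ≤ N j := by exact_mod_cast hN (show (i : ℕ) + 1 ≤ j from hij)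
      exact absurd (h3.trans (h1.trans h4)) (not_le.2 h2)
    intro i j he
    rcases lt_trichotomy i j with h | h | h
    · exact absurd he (this i j h)
    · exact h
    · exact absurd he.symm (this j i h)
  have := Fintype.card_le_of_injective f hinj
  simp at this

end OneVarEq

namespace OneVarEq

def uuB (k n : ℕ) : ℕ := 2 * (2 ^ k * n * k + k * n)

def Nn (k g : ℕ) : ℕ → ℕ
  | 0 => 0
  | i+1 => Nn k g i + (2 * k + 1) + uuB k (Nn k g i) * g

def bdN (k g n : ℕ) : ℕ := 2 ^ k * n + (uuB k n + 2 * (2 ^ k + k)) * g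

def BdN (k g : ℕ) : ℕ := bdN k g (Nn k g (2 ^ k + (2 ^ k + k)))

theorem uuB_mono (k : ℕ) : Monotone (uuB k) := by
  intro a b h; unfold uuB; gcongr

theorem Nn_mono (k g : ℕ) : Monotone (Nn k g) := by
  apply monotone_nat_of_le_succ
  intro n; rw [Nn]; omega

theorem bdN_mono (k g : ℕ) : Monotone (bdN k g) := by
  intro a b h
  have := uuB_mono k h
  unfold bdN; gcongr

theorem fin_enum {W : Type} (s : Set W) (n : ℕ) (h : s.encard ≤ n) :
    ∃ (a : ℕ) (ρ : Fin a → W), a ≤ n ∧ Function.Injective ρ ∧ ∀ w, (∃ r, ρ r = w) ↔ w ∈ s := by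
  classical
  obtain ⟨s', rfl⟩ := (Set.finite_of_encard_le_coe h).exists_finset_coe
  rw [Set.encard_coe_eq_coe_finsetCard] at h
  refine ⟨s'.card, fun r => (s'.equivFin.symm r : W), by exact_mod_cast h, ?_, ?_⟩
  · exact Subtype.val_injective.comp s'.equivFin.symm.injective
  · intro w
    constructor
    · rintro ⟨r, rfl⟩; exact (s'.equivFin.symm r).2
    · intro hw
      exact ⟨s'.equivFin ⟨w, hw⟩, by simp⟩

theorem Big_anti {T W D : Type} (X : W → D → T) {n m : ℕ} (h : n ≤ m) : Big X m ⊆ Big X n := by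
  intro w hw
  have h1 : (n : ℕ∞) ≤ m := by exact_mod_cast h
  exact lt_of_le_of_lt h1 hw

theorem extract {T W D L : Type} [Fintype T] [Nonempty W] [Nonempty D] (σ : Sys T) (X : W → D → T)
    (hX : MValid σ X) (g : ℕ) (Φ : Set W → Set D → (W → L) → (D → L) → Prop)
    (hl : ∀ (W1 : Set W) (D1 : Set D), ∃ (lw : W → L) (ld : D → L),
      (∀ a, {w | lw w = a}.encard ≤ g) ∧ (∀ a, {d | ld d = a}.encard ≤ g) ∧ Φ W1 D1 lw ld) :
    ∃ (W1 : Set W) (D1 : Set D) (lw : W → L) (ld : D → L) (U S : Set L) (Sm : T → Prop)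
      (fill : W → D → T) (a b : ℕ) (ρ : Fin a → W) (γ : Fin b → D),
      a ≤ BdN (Fintype.card T) g ∧ b ≤ BdN (Fintype.card T) g ∧ 0 < a ∧ 0 < b ∧ Φ W1 D1 lw ld ∧
      HX σ X W1 D1 lw ld U S Sm fill ρ ∧
      HX σ.swap (fun d w => X w d) D1 W1 ld lw U S Sm (fun d w => fill w d) γ := by
  classical
  set k := Fintype.card T with hk
  obtain ⟨i, hi, hgap⟩ := gap (ι := Set T ⊕ (Set T ⊕ T)) (fun x i => match x with
    | .inl P => {w | Set.range (X w) = P}.encard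
    | .inr (.inl Q) => {d | Set.range (fun w => X w d) = Q}.encard
    | .inr (.inr t) => (Hc X (Big X (Nn k g i)) (Big (fun d w => X w d) (Nn k g i)) t).encard)
    (Nn k g) (Nn_mono k g) (by
      rintro (P | Q | t) i j hij
      · exact le_rfl
      · exact le_rfl
      · apply Set.encard_le_encard
        rintro ⟨w, d⟩ ⟨h1, h2, h3⟩
        exact ⟨Big_anti X (Nn_mono k g hij) h1, Big_anti _ (Nn_mono k g hij) h2, h3⟩)
  have hi' : i ≤ 2 ^ k + (2 ^ k + k) := by
    refine hi.trans (le_of_eq ?_)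
    simp [hk]
  set n := Nn k g i with hn
  set n' := Nn k g (i+1) with hn'
  have hnn : n' = n + (2 * k + 1) + uuB k n * g := by rw [hn', Nn]
  set W1 := Big X n with hW1
  set D1 := Big (fun d w => X w d) n with hD1
  have hWW : ∀ w ∈ W1, w ∈ Big X n' := by
    intro w hw
    rcases hgap (.inl (Set.range (X w))) with h | h
    · exact absurd h (not_le.2 hw)
    · exact h
  have hDD : ∀ d ∈ D1, d ∈ Big (fun d w => X w d) n' := by
    intro w hw
    rcases hgap (.inr (.inl (Set.range (fun w' => X w' w)))) with h | h
    · exact absurd h (not_le.2 hw)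
    · exact h
  let Sm : T → Prop := fun t => (Hc X W1 D1 t).encard ≤ n
  have hSm : ∀ t, ¬ Sm t → (n' : ℕ∞) < (Hc X W1 D1 t).encard := by
    intro t ht
    rcases hgap (.inr (.inr t)) with h | h
    · exact absurd h ht
    · exact h
  obtain ⟨KW, hKW, hKW1, hKW2⟩ := core_half σ X n W1 D1 (small_bound _ n) Sm (fun t _ h => h)
  obtain ⟨KD, hKD, hKD1, hKD2⟩ := core_half σ.swap (fun d w => X w d) n D1 W1 (small_bound _ n) Sm
    (fun t _ h => by rw [Hc_swap]; exact h)
  obtain ⟨lw, ld, hlw, hld, hΦ⟩ := hl W1 D1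
  set U : Set L := lw '' KW ∪ ld '' KD with hU
  have hUc : U.encard ≤ (uuB k n : ℕ) := by
    refine (Set.encard_union_le _ _).trans ?_
    refine (add_le_add ((Set.encard_image_le _ _).trans hKW) ((Set.encard_image_le _ _).trans hKD)).trans ?_
    have : (2 ^ k * n * k + k * n) + (2 ^ k * n * k + k * n) ≤ uuB k n := by unfold uuB; omega
    exact_mod_cast this
  have hUw : {w | lw w ∈ U}.encard ≤ (uuB k n * g : ℕ) := by
    apply enc_fib lw _ U _ _ (fun _ h => h) hUc
    intro b
    exact le_trans (Set.encard_le_encard (fun w hw => hw.2)) (hlw b)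
  have hUd : {w | ld w ∈ U}.encard ≤ (uuB k n * g : ℕ) := by
    apply enc_fib ld _ U _ _ (fun _ h => h) hUc
    intro b
    exact le_trans (Set.encard_le_encard (fun w hw => hw.2)) (hld b)
  obtain ⟨SW, hSW, hSW1, hSW2, hSW3⟩ := rep_half σ X hX.1 n n' _ D1 lw U hUw (by omega) hWW Sm
    (fun t _ h => hSm t h)
  obtain ⟨SD, hSD, hSD1, hSD2, hSD3⟩ := rep_half σ.swap (fun d w => X w d) hX.2 n n' _ W1 ld U hUd
    (by omega) hDD Sm (fun t _ h => by rw [Hc_swap]; exact hSm t h)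
  set S : Set L := SW ∪ SD with hS
  have hUS : (U ∪ S).encard ≤ (uuB k n + 2 * (2 ^ k + k) : ℕ) := by
    refine (Set.encard_union_le _ _).trans ?_
    refine (add_le_add hUc ((Set.encard_union_le _ _).trans (add_le_add hSW hSD))).trans ?_
    have : uuB k n + ((2 ^ k + k) + (2 ^ k + k)) ≤ uuB k n + 2 * (2 ^ k + k) := by omega
    exact_mod_cast this
  have hb : bdN k g n ≤ BdN k g := bdN_mono k g (Nn_mono k g hi')
  have hRw : {w | w ∉ W1 ∨ lw w ∈ U ∨ lw w ∈ S}.encard ≤ (BdN k g : ℕ) := by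
    have e : {w | w ∉ W1 ∨ lw w ∈ U ∨ lw w ∈ S} = {w | w ∉ W1} ∪ {w | lw w ∈ U ∪ S} := by
      ext w; simp
    rw [e]
    refine (Set.encard_union_le _ _).trans ?_
    refine (add_le_add (small_bound X n) (enc_fib lw _ (U ∪ S) _ g (fun _ h => h) hUS (fun b =>
      le_trans (Set.encard_le_encard (fun w hw => hw.2)) (hlw b)))).trans ?_
    exact_mod_cast hb
  have hRd : {w | w ∉ D1 ∨ ld w ∈ U ∨ ld w ∈ S}.encard ≤ (BdN k g : ℕ) := by
    have e : {w | w ∉ D1 ∨ ld w ∈ U ∨ ld w ∈ S} = {w | w ∉ D1} ∪ {w | ld w ∈ U ∪ S} := by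
      ext w; simp
    rw [e]
    refine (Set.encard_union_le _ _).trans ?_
    refine (add_le_add (small_bound _ n) (enc_fib ld _ (U ∪ S) _ g (fun _ h => h) hUS (fun b =>
      le_trans (Set.encard_le_encard (fun w hw => hw.2)) (hld b)))).trans ?_
    exact_mod_cast hb
  obtain ⟨a, ρ, ha, hρ, hρ'⟩ := fin_enum _ _ hRw
  obtain ⟨b, γ, hbb, hγ, hγ'⟩ := fin_enum _ _ hRd
  have hfe := fun w d (hw : w ∈ W1) (hd : d ∈ D1) =>
    fill_ex σ X hX n' (by omega) w d (hWW w hw) (hDD d hd)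
  have hfe' : ∀ w d, ∃ t, w ∈ W1 → d ∈ D1 →
      t ∈ Set.range (X w) ∧ t ∈ Set.range (fun w => X w d) ∧ ¬ σ.A t ∧ ¬ σ.B t := by
    intro w d
    by_cases h : w ∈ W1 ∧ d ∈ D1
    · obtain ⟨t, ht⟩ := hfe w d h.1 h.2
      exact ⟨t, fun _ _ => ht⟩
    · exact ⟨X w d, fun h1 h2 => absurd ⟨h1, h2⟩ h⟩
  choose fill hfill using hfe'
  have hdis : ∀ a ∈ U, a ∉ S := by
    rintro a ha (h | h)
    · exact hSW1 a ha h
    · exact hSD1 a ha h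
  have H1 : HX σ X W1 D1 lw ld U S Sm fill ρ := by
    refine ⟨?_, ?_, ?_, ?_, ?_, hρ, hρ', hdis⟩
    · intro w hw d
      obtain ⟨d', h1, h2⟩ := hKD1 w hw d
      exact ⟨d', h2, Or.inr (Or.inr ⟨d', h1, rfl⟩)⟩
    · intro w d h1 h2 h3 h4
      exact Or.inl ⟨w, hKW2 w d h1 h2 h3 h4, rfl⟩
    · intro w hw
      obtain ⟨w', h1, h2, h3⟩ := hSW2 w hw
      exact ⟨w', h1, h2, Or.inl h3⟩
    · intro t h1 h2
      obtain ⟨w, h3, d, h4, h5, h6⟩ := hSW3 t h1 h2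
      exact ⟨w, h3, d, h4, h5, Or.inl h6⟩
    · intro w hw d hd
      exact ⟨(hfill w d hw hd).1, (hfill w d hw hd).2.2.1⟩
  have H2 : HX σ.swap (fun d w => X w d) D1 W1 ld lw U S Sm (fun d w => fill w d) γ := by
    refine ⟨?_, ?_, ?_, ?_, ?_, hγ, hγ', hdis⟩
    · intro w hw d
      obtain ⟨d', h1, h2⟩ := hKW1 w hw d
      exact ⟨d', h2, Or.inr (Or.inl ⟨d', h1, rfl⟩)⟩
    · intro w d h1 h2 h3 h4
      exact Or.inr ⟨w, hKD2 w d h1 h2 h3 h4, rfl⟩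
    · intro w hw
      obtain ⟨w', h1, h2, h3⟩ := hSD2 w hw
      exact ⟨w', h1, h2, Or.inr h3⟩
    · intro t h1 h2
      obtain ⟨w, h3, d, h4, h5, h6⟩ := hSD3 t h1 h2
      exact ⟨w, h3, d, h4, h5, Or.inr h6⟩
    · intro d hd w hw
      exact ⟨(hfill w d hw hd).2.1, (hfill w d hw hd).2.2.2⟩
  refine ⟨W1, D1, lw, ld, U, S, Sm, fill, a, b, ρ, γ, ha, hbb, ?_, ?_, hΦ, H1, H2⟩
  · obtain ⟨w⟩ := ‹Nonempty W›
    have : ∃ r : Fin a, True := by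
      by_cases hw : w ∈ W1
      · obtain ⟨w', h1, h2, h3⟩ := H1.rep w hw
        obtain ⟨r, -⟩ := (H1.rng w').2 (Or.inr (Or.inr h3))
        exact ⟨r, trivial⟩
      · obtain ⟨r, -⟩ := (H1.rng w).2 (Or.inl hw)
        exact ⟨r, trivial⟩
    obtain ⟨r, -⟩ := this
    exact r.pos
  · obtain ⟨w⟩ := ‹Nonempty D›
    have : ∃ r : Fin b, True := by
      by_cases hw : w ∈ D1
      · obtain ⟨w', h1, h2, h3⟩ := H2.rep w hw
        obtain ⟨r, -⟩ := (H2.rng w').2 (Or.inr (Or.inr h3))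
        exact ⟨r, trivial⟩
      · obtain ⟨r, -⟩ := (H2.rng w).2 (Or.inl hw)
        exact ⟨r, trivial⟩
    obtain ⟨r, -⟩ := this
    exact r.pos

theorem extract_inf {T W D : Type} [Fintype T] [Nonempty W] [Nonempty D] (σ : Sys T) (X : W → D → T)
    (hX : MValid σ X) :
    ∃ (a b : ℕ) (kr : Fin a → ℕ) (kc : Fin b → ℕ) (Y : Fin a → Fin b → T) (P : Fin a → Set T)
      (Q : Fin b → Set T), a ≤ BdN (Fintype.card T) 1 ∧ b ≤ BdN (Fintype.card T) 1 ∧ 0 < a ∧ 0 < b ∧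
      (∀ r, kr r < 3) ∧ (∀ c, kc c < 3) ∧ Cert σ kr kc Y P Q := by
  obtain ⟨W1, D1, lw, ld, U, S, Sm, fill, a, b, ρ, γ, ha, hb, ha0, hb0, -, H1, H2⟩ :=
    extract (L := W ⊕ D) σ X hX 1 (fun _ _ _ _ => True) (fun W1 D1 => ⟨Sum.inl, Sum.inr, by
      intro x
      refine Set.encard_le_one_iff.2 ?_
      rintro w w' h1 h2
      exact Sum.inl_injective (h1.trans h2.symm), by
      intro x
      refine Set.encard_le_one_iff.2 ?_
      rintro w w' h1 h2
      exact Sum.inr_injective (h1.trans h2.symm), trivial⟩)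
  refine ⟨a, b, _, _, _, _, _, ha, hb, ha0, hb0, ?_, ?_, ⟨hx_cert hX.1 hX.2 H1 H2, ?_⟩⟩
  · intro r; rcases kdne (W1 := W1) (lw := lw) (U := U) (w := ρ r) with h | h | h <;> omega
  · intro r; rcases kdne (W1 := D1) (lw := ld) (U := U) (w := γ r) with h | h | h <;> omega
  · have := hx_cert hX.2 hX.1 H2 H1
    simpa only [Xf_swap] using this

end OneVarEq

namespace OneVarEq

theorem lab_half {T W D : Type} [Nonempty W] (σ : Sys T) (X : W → D → T) (hX : MValid σ X)
    (W1 : Set W) (D1 : Set D)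
    (t : T) (hA : σ.A t) :
    ∃ Δ : Set (W × D), Δ ⊆ Hc X W1 D1 t ∧ Set.InjOn Prod.fst Δ ∧ Set.InjOn Prod.snd Δ ∧
      (∀ w ∈ W1, ∀ d ∈ D1, X w d = t → σ.A t → ∃ e ∈ Δ, e.2 = d) ∧
      (∀ w ∈ W1, ∀ d ∈ D1, X w d = t → σ.B t → ∃ e ∈ Δ, e.1 = w) := by
  classical
  have : ∀ d, ∃ w, (∃ w ∈ W1, X w d = t) → w ∈ W1 ∧ X w d = t := by
    intro d
    by_cases h : ∃ w ∈ W1, X w d = t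
    · obtain ⟨w, hw⟩ := h; exact ⟨w, fun _ => hw⟩
    · exact ⟨Classical.arbitrary W, fun h' => absurd h' h⟩
  choose f hf using this
  refine ⟨{e | e.1 = f e.2 ∧ e ∈ Hc X W1 D1 t}, fun e he => he.2, ?_, ?_, ?_, ?_⟩
  · rintro ⟨w, d⟩ ⟨h1, h2, h3, h4⟩ ⟨w', d'⟩ ⟨h1', h2', h3', h4'⟩ he
    dsimp only at *
    subst he
    have := hX.1.2 w d d' (h4 ▸ hA) (h4.trans h4'.symm)
    rw [this]
  · rintro ⟨w, d⟩ ⟨h1, h2, h3, h4⟩ ⟨w', d'⟩ ⟨h1', h2', h3', h4'⟩ he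
    dsimp only at *
    subst he
    rw [h1, h1']
  · intro w hw d hd he _
    obtain ⟨h1, h2⟩ := hf d ⟨w, hw, he⟩
    exact ⟨(f d, d), ⟨rfl, h1, hd, h2⟩, rfl⟩
  · intro w hw d hd he hB
    obtain ⟨h1, h2⟩ := hf d ⟨w, hw, he⟩
    refine ⟨(f d, d), ⟨rfl, h1, hd, h2⟩, ?_⟩
    exact hX.2.2 d (f d) w (by show σ.B (X (f d) d); rw [h2]; exact hB) (h2.trans he.symm)

theorem lab_delta {T W D : Type} [Nonempty W] [Nonempty D] (σ : Sys T) (X : W → D → T)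
    (hX : MValid σ X) (W1 : Set W) (D1 : Set D)
    (t : T) : ∃ Δ : Set (W × D), Δ ⊆ Hc X W1 D1 t ∧ Set.InjOn Prod.fst Δ ∧ Set.InjOn Prod.snd Δ ∧
      (∀ w ∈ W1, ∀ d ∈ D1, X w d = t → σ.A t → ∃ e ∈ Δ, e.2 = d) ∧
      (∀ w ∈ W1, ∀ d ∈ D1, X w d = t → σ.B t → ∃ e ∈ Δ, e.1 = w) := by
  classical
  by_cases hA : σ.A t
  · exact lab_half σ X hX W1 D1 t hA
  · by_cases hB : σ.B t
    · obtain ⟨Δ, h1, h2, h3, h4, h5⟩ := lab_half σ.swap (fun d w => X w d) ⟨hX.2, hX.1⟩ D1 W1 t hB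
      refine ⟨{e | (e.2, e.1) ∈ Δ}, ?_, ?_, ?_, ?_, ?_⟩
      · rintro ⟨w, d⟩ he
        obtain ⟨g1, g2, g3⟩ := h1 he
        exact ⟨g2, g1, g3⟩
      · rintro ⟨w, d⟩ he ⟨w', d'⟩ he' hh
        have := h3 he he' hh
        simp only [Prod.mk.injEq] at this ⊢
        exact ⟨this.2, this.1⟩
      · rintro ⟨w, d⟩ he ⟨w', d'⟩ he' hh
        have := h2 he he' hh
        simp only [Prod.mk.injEq] at this ⊢
        exact ⟨this.2, this.1⟩
      · intro w hw d hd he hA'; exact absurd hA' hA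
      · intro w hw d hd he hB'
        obtain ⟨e, he1, he2⟩ := h4 d hd w hw he hB'
        exact ⟨(e.2, e.1), he1, he2⟩
    · exact ⟨∅, by simp, by simp, by simp, fun w _ d _ _ h => absurd h hA,
        fun w _ d _ _ h => absurd h hB⟩

theorem sum_ncard {W E : Type} [Fintype W] (f : E → W) (Δ : Set E) (hf : Set.InjOn f Δ) (p : W → Prop)
    [DecidablePred p] [DecidablePred (fun w => w ∈ f '' Δ)] :
    (∑ w, if p w then (if w ∈ f '' Δ then (1:ℤ) else 0) else 0) = ({e ∈ Δ | p (f e)}.ncard : ℤ) := by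
  classical
  have h1 : ({e ∈ Δ | p (f e)}).ncard = (Finset.univ.filter (fun w => p w ∧ w ∈ f '' Δ)).card := by
    rw [← Set.ncard_coe_finset, ← Set.InjOn.ncard_image (f := f) (fun a ha b hb h => hf ha.1 hb.1 h)]
    congr 1
    ext w
    simp only [Set.mem_image, Finset.coe_filter, Set.mem_ofPred_eq, Finset.mem_univ, true_and]
    constructor
    · rintro ⟨e, ⟨h1, h2⟩, rfl⟩; exact ⟨h2, e, h1, rfl⟩
    · rintro ⟨h2, e, h1, rfl⟩; exact ⟨e, ⟨h1, h2⟩, rfl⟩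
  rw [h1, Finset.card_filter]
  push_cast
  apply Finset.sum_congr rfl
  intro w _
  by_cases h1 : p w <;> by_cases h2 : w ∈ f '' Δ <;> simp only [h1, h2, if_true, if_false, and_true, and_false]

theorem lab_ex {T W D : Type} [Fintype T] [Fintype W] [Fintype D] [Nonempty W] [Nonempty D] (σ : Sys T)
    (X : W → D → T) (hX : MValid σ X) (W1 : Set W) (D1 : Set D) :
    ∃ (lw : W → ℕ) (ld : D → ℕ), (∀ a, {w | lw w = a}.encard ≤ (zg (Fintype.card T) 1 : ℕ)) ∧
      (∀ a, {d | ld d = a}.encard ≤ (zg (Fintype.card T) 1 : ℕ)) ∧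
      ∃ Δ : T → Set (W × D), HLab σ X W1 D1 lw ld Δ ∧
        HLab σ.swap (fun d w => X w d) D1 W1 ld lw (fun t => {e | (e.2, e.1) ∈ Δ t}) := by
  classical
  choose Δ h1 h2 h3 h4 h5 using lab_delta σ X hX W1 D1
  let v : W ⊕ D → T → ℤ := fun x t => Sum.elim (fun w => if w ∈ Prod.fst '' Δ t then 1 else 0)
    (fun d => - if d ∈ Prod.snd '' Δ t then 1 else 0) x
  have hz : ∀ (t : T) (K : Set ℕ) (lw : W → ℕ) (ld : D → ℕ),
      (∑ x, if Sum.elim lw ld x ∈ K then v x t else 0) =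
        ({e ∈ Δ t | lw e.1 ∈ K}.ncard : ℤ) - ({e ∈ Δ t | ld e.2 ∈ K}.ncard : ℤ) := by
    intro t K lw ld
    rw [Fintype.sum_sum_type]
    have e1 := sum_ncard Prod.fst (Δ t) (h2 t) (fun w => lw w ∈ K)
    have e2 := sum_ncard Prod.snd (Δ t) (h3 t) (fun w => ld w ∈ K)
    rw [← e1, ← e2, sub_eq_add_neg, ← Finset.sum_neg_distrib]
    congr 1
    apply Finset.sum_congr rfl
    intro d _
    dsimp only [v, Sum.elim_inr]
    by_cases g1 : ld d ∈ K
    · simp only [g1, if_true]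
    · simp only [g1, if_false, neg_zero]
  obtain ⟨l, hl1, hl2⟩ := zs_type v (by
    rintro (w | d) t
    · dsimp only [v, Sum.elim_inl]; split_ifs <;> simp
    · dsimp only [v, Sum.elim_inr]; split_ifs <;> simp) (by
    intro t
    have := hz t Set.univ (fun _ => 0) (fun _ => 0)
    simpa using this)
  have hl3 : ∀ t (K : Set ℕ), (∑ x, if l x ∈ K then v x t else 0) = 0 := by
    intro t K
    rw [← Finset.sum_filter, ← Finset.sum_fiberwise_of_maps_to (g := l) (t := (Finset.univ.filter (fun x => l x ∈ K)).image l)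
      (fun x hx => Finset.mem_image_of_mem _ hx)]
    apply Finset.sum_eq_zero
    intro a ha
    obtain ⟨x, hx, rfl⟩ := Finset.mem_image.1 ha
    rw [← hl2 (l x) t]
    apply Finset.sum_congr _ (fun _ _ => rfl)
    ext y
    simp only [Finset.mem_filter, Finset.mem_univ, true_and] at hx ⊢
    constructor
    · exact fun h => h.2
    · intro h; exact ⟨h ▸ hx, h⟩
  have hl4 : ∀ t (K : Set ℕ), {e ∈ Δ t | l (.inl e.1) ∈ K}.ncard = {e ∈ Δ t | l (.inr e.2) ∈ K}.ncard := by
    intro t K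
    have := hz t K (fun w => l (.inl w)) (fun d => l (.inr d))
    have e : Sum.elim (fun w => l (.inl w)) (fun d => l (.inr d)) = l := by
      ext x; cases x <;> rfl
    rw [e, hl3] at this
    omega
  have henc : ∀ a, {x | l x = a}.encard ≤ (zg (Fintype.card T) 1 : ℕ) := by
    intro a
    rw [← (Set.toFinite {x | l x = a}).cast_ncard_eq]
    exact_mod_cast hl1 a
  refine ⟨fun w => l (.inl w), fun d => l (.inr d), ?_, ?_, Δ, ?_, ?_⟩
  · intro a
    refine le_trans ?_ (henc a)
    rw [← Function.Injective.encard_image Sum.inl_injective (s := {w | l (.inl w) = a}) (β := W ⊕ D)]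
    apply Set.encard_le_encard
    rintro _ ⟨w, hw, rfl⟩; exact hw
  · intro a
    refine le_trans ?_ (henc a)
    rw [← Function.Injective.encard_image Sum.inr_injective (s := {w | l (.inr w) = a}) (β := W ⊕ D)]
    apply Set.encard_le_encard
    rintro _ ⟨w, hw, rfl⟩; exact hw
  · exact ⟨fun t e he => h1 t he, fun t => Set.toFinite _, h2, h3,
      fun w hw d hd hA => h4 _ w hw d hd rfl hA, hl4⟩
  · have hsw : ∀ t (p : W × D → Prop), {e : D × W | (e.2, e.1) ∈ Δ t ∧ p (e.2, e.1)}.ncard =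
        {e ∈ Δ t | p e}.ncard := by
      intro t p
      rw [← Function.Injective.injOn (Prod.swap_injective (α := W) (β := D)) |>.ncard_image]
      congr 1
      ext ⟨d, w⟩
      simp
    refine ⟨?_, fun t => Set.toFinite _, ?_, ?_, ?_, ?_⟩
    · intro t e he
      obtain ⟨g1, g2, g3⟩ := h1 t he
      exact ⟨g2, g1, g3⟩
    · rintro t ⟨w, d⟩ he ⟨w', d'⟩ he' hh
      have := h3 t he he' hh
      simp only [Prod.mk.injEq] at this ⊢
      exact ⟨this.2, this.1⟩
    · rintro t ⟨w, d⟩ he ⟨w', d'⟩ he' hh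
      have := h2 t he he' hh
      simp only [Prod.mk.injEq] at this ⊢
      exact ⟨this.2, this.1⟩
    · intro d hd w hw hB
      obtain ⟨e, he1, he2⟩ := h5 _ w hw d hd rfl hB
      exact ⟨(e.2, e.1), he1, he2⟩
    · intro t K
      have g1 := hsw t (fun e => l (.inr e.2) ∈ K)
      have g2 := hsw t (fun e => l (.inl e.1) ∈ K)
      exact g1.trans ((hl4 t K).symm.trans g2.symm)

def BfN (k : ℕ) : ℕ :=
  let m := BdN k (zg k 1)
  m * 2 ^ (2 * (m * (m * k)) + 2 * (m * k))

theorem mvalid_equiv {T W D W' D' : Type} {σ : Sys T} {X : W → D → T} (hX : MValid σ X)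
    (e : W' ≃ W) (f : D' ≃ D) : MValid σ (fun w d => X (e w) (f d)) := by
  have r1 : ∀ w, Set.range (fun d => X (e w) (f d)) = Set.range (X (e w)) :=
    fun w => f.surjective.range_comp (X (e w))
  have r2 : ∀ d, Set.range (fun w => X (e w) (f d)) = Set.range (fun w => X w (f d)) :=
    fun d => e.surjective.range_comp (fun w => X w (f d))
  refine ⟨⟨fun w => ?_, fun w d d' h1 h2 => f.injective (hX.1.2 _ _ _ h1 h2)⟩,
    ⟨fun d => ?_, fun d w w' h1 h2 => e.injective (hX.2.2 _ _ _ h1 h2)⟩⟩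
  · rw [r1]; exact hX.1.1 _
  · rw [r2]; exact hX.2.1 _

theorem blow_card {a N : ℕ} {R J : Type} [Finite R] [Finite J] (kr : R → ℕ) (j0 : J)
    (h1 : Nat.card R ≤ a) (h2 : Nat.card J ≤ N) : Nat.card (Blow kr j0) ≤ a * N := by
  classical
  refine (Nat.card_le_card_of_injective Subtype.val Subtype.val_injective).trans ?_
  rw [Nat.card_prod]
  exact Nat.mul_le_mul h1 h2

theorem extract_fin {T W D : Type} [Fintype T] [Finite W] [Finite D] [Nonempty W] [Nonempty D]
    (σ : Sys T) (X : W → D → T) (hX : MValid σ X) :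
    ∃ (a b : ℕ) (Y : Fin a → Fin b → T), a ≤ BfN (Fintype.card T) ∧ b ≤ BfN (Fintype.card T) ∧
      0 < a ∧ 0 < b ∧ MValid σ Y := by
  classical
  have := Fintype.ofFinite W
  have := Fintype.ofFinite D
  obtain ⟨W1, D1, lw, ld, U, S, Sm, fill, a, b, ρ, γ, ha, hb, ha0, hb0, ⟨Δ, hΔ1, hΔ2⟩, H1, H2⟩ :=
    extract σ X hX (zg (Fintype.card T) 1) _ (lab_ex σ X hX)
  have hc1 := hx_cert hX.1 hX.2 H1 H2
  have hc2 := hx_cert hX.2 hX.1 H2 H1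
  have hb1 := hx_bal hX.1 H1 H2 hΔ1
  have hb2 := hx_bal hX.2 H2 H1 hΔ2
  simp only [Xf_swap] at hc2 hb2
  obtain ⟨Y, hY⟩ := realise_fin ⟨hc1, hc2⟩ hb1 hb2
  set m := BdN (Fintype.card T) (zg (Fintype.card T) 1) with hm
  have hJ : Nat.card (FG (Fin a) (Fin b) T) ≤ 2 ^ (2 * (m * (m * Fintype.card T)) + 2 * (m * Fintype.card T)) := by
    have : Nat.card (FG (Fin a) (Fin b) T) = 2 ^ (2 * (a * (b * Fintype.card T)) + (a * Fintype.card T + b * Fintype.card T)) := by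
      rw [Nat.card_fun, Nat.card_sum, Nat.card_sum, Nat.card_sum]
      simp only [Nat.card_eq_fintype_card, ZMod.card, Fintype.card_fin, Fintype.card_prod]
      congr 1; ring
    rw [this]
    apply Nat.pow_le_pow_right (by norm_num)
    have h1 : a * (b * Fintype.card T) ≤ m * (m * Fintype.card T) := by gcongr
    have h2 : a * Fintype.card T ≤ m * Fintype.card T := by gcongr
    have h3 : b * Fintype.card T ≤ m * Fintype.card T := by gcongr
    omega
  refine ⟨_, _, fun w d => Y ((Finite.equivFin _).symm w) ((Finite.equivFin _).symm d), ?_, ?_, ?_, ?_,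
    mvalid_equiv hY _ _⟩
  · exact blow_card _ _ (by simpa using ha) hJ
  · exact blow_card _ _ (by simpa using hb) hJ
  · exact Nat.card_pos_iff.2 ⟨⟨⟨(⟨0, ha0⟩, 0), Or.inr rfl⟩⟩, inferInstance⟩
  · exact Nat.card_pos_iff.2 ⟨⟨⟨(⟨0, hb0⟩, 0), Or.inr rfl⟩⟩, inferInstance⟩

end OneVarEq

namespace OneVarEq
attribute [fun_prop] Primrec
attribute [fun_prop] Primrec.id Primrec.const Primrec.comp Primrec.fst Primrec.snd Primrec.pair

section
variable {α : Type} [Primcodable α] {f g : α → ℕ}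
@[fun_prop] theorem pr_fst {β γ} [Primcodable β] [Primcodable γ] {f : α → β × γ} (hf : Primrec f) : Primrec fun a => (f a).1 := Primrec.fst.comp hf
@[fun_prop] theorem pr_snd {β γ} [Primcodable β] [Primcodable γ] {f : α → β × γ} (hf : Primrec f) : Primrec fun a => (f a).2 := Primrec.snd.comp hf
@[fun_prop] theorem pr_add (hf : Primrec f) (hg : Primrec g) : Primrec fun a => f a + g a := Primrec.nat_add.comp hf hg
@[fun_prop] theorem pr_mul (hf : Primrec f) (hg : Primrec g) : Primrec fun a => f a * g a := Primrec.nat_mul.comp hf hg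
@[fun_prop] theorem pr_div (hf : Primrec f) (hg : Primrec g) : Primrec fun a => f a / g a := Primrec.nat_div.comp hf hg
@[fun_prop] theorem pr_mod (hf : Primrec f) (hg : Primrec g) : Primrec fun a => f a % g a := Primrec.nat_mod.comp hf hg
@[fun_prop] theorem pr_pair (hf : Primrec f) (hg : Primrec g) : Primrec fun a => Nat.pair (f a) (g a) := Primrec₂.natPair.comp hf hg
@[fun_prop] theorem pr_unpair (hf : Primrec f) : Primrec fun a => Nat.unpair (f a) := Primrec.unpair.comp hf
@[fun_prop] theorem pr_pow (hf : Primrec f) (hg : Primrec g) : Primrec fun a => f a ^ g a := by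
  have : Primrec₂ (fun a n : ℕ => a ^ n) := by
    have := Primrec.nat_rec (f := fun _ : ℕ => 1) (g := fun (a : ℕ) (p : ℕ × ℕ) => p.2 * a) (Primrec.const 1)
      (by unfold Primrec₂; exact Primrec.nat_mul.comp (Primrec.snd.comp Primrec.snd) Primrec.fst)
    refine this.of_eq ?_
    intro a n
    induction n with
    | zero => rfl
    | succ n ih => 
      show (Nat.rec 1 (fun y IH => IH * a) n : ℕ) * a = _
      rw [pow_succ, ← ih]
  exact this.comp hf hg

@[fun_prop] def PP (p : α → Prop) : Prop := PrimrecPred p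
@[fun_prop] theorem PP.cpp {β} [Primcodable β] {p : β → Prop} {f : α → β} (hp : PP p) (hf : Primrec f) : PP fun a => p (f a) := PrimrecPred.comp hp hf

end
def bAll (n : ℕ) (p : ℕ → Prop) : Prop := ∀ x < n, p x
def bEx (n : ℕ) (p : ℕ → Prop) : Prop := ∃ x < n, p x
def Im (p q : Prop) : Prop := p → q

section
variable {α : Type} [Primcodable α] {f g : α → ℕ} {p q : α → Prop}
@[fun_prop] theorem pp_and (hp : PP p) (hq : PP q) : PP fun a => p a ∧ q a := PrimrecPred.and hp hq
@[fun_prop] theorem pp_or (hp : PP p) (hq : PP q) : PP fun a => p a ∨ q a := PrimrecPred.or hp hq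
@[fun_prop] theorem pp_not (hp : PP p) : PP fun a => ¬ p a := PrimrecPred.not hp
@[fun_prop] theorem pp_imp (hp : PP p) (hq : PP q) : PP fun a => Im (p a) (q a) := by
  refine PrimrecPred.of_eq (PrimrecPred.or (PrimrecPred.not hp) hq) ?_
  intro a; unfold Im; tauto
@[fun_prop] theorem pp_iff (hp : PP p) (hq : PP q) : PP fun a => p a ↔ q a := by
  refine PrimrecPred.of_eq (pp_and (pp_imp hp hq) (pp_imp hq hp)) ?_
  intro a; unfold Im; tauto
@[fun_prop] theorem pp_eq (hf : Primrec f) (hg : Primrec g) : PP fun a => f a = g a := Primrec.eq.comp hf hg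
@[fun_prop] theorem pp_lt (hf : Primrec f) (hg : Primrec g) : PP fun a => f a < g a := Primrec.nat_lt.comp hf hg
@[fun_prop] theorem pp_all {p : α → ℕ → Prop} (hf : Primrec f) (hp : PP fun q : α × ℕ => p q.1 q.2) : PP fun a => bAll (f a) (p a) := by
  have h1 : PrimrecRel fun (x : ℕ) (a : α) => p a x := by
    have : PP fun q : ℕ × α => p q.2 q.1 := PrimrecPred.comp hp (Primrec.pair Primrec.snd Primrec.fst)
    exact this
  have := (PrimrecRel.forall_mem_list h1).comp (Primrec.list_range.comp hf) Primrec.id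
  refine PrimrecPred.of_eq this ?_
  intro a; simp [bAll]
@[fun_prop] theorem pp_ex {p : α → ℕ → Prop} (hf : Primrec f) (hp : PP fun q : α × ℕ => p q.1 q.2) : PP fun a => bEx (f a) (p a) := by
  have h1 : PrimrecRel fun (x : ℕ) (a : α) => p a x := by
    have : PP fun q : ℕ × α => p q.2 q.1 := PrimrecPred.comp hp (Primrec.pair Primrec.snd Primrec.fst)
    exact this
  have := (PrimrecRel.exists_mem_list h1).comp (Primrec.list_range.comp hf) Primrec.id
  refine PrimrecPred.of_eq this ?_
  intro a; simp [bEx]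



theorem PP.congr {p q : α → Prop} (hp : PP p) (h : ∀ a, p a ↔ q a) : PP q := PrimrecPred.of_eq hp h

@[fun_prop] theorem pp_ne (hf : Primrec f) (hg : Primrec g) : PP fun a => f a ≠ g a :=
  pp_not (pp_eq hf hg)

/-- bit `i` of `t` is set -/
def bt (t i : ℕ) : Prop := t / 2 ^ i % 2 = 1
/-- digit `i` of `Z` in base `b` -/
def dg (b Z i : ℕ) : ℕ := Z / b ^ i % b

@[fun_prop] theorem pp_bt (hf : Primrec f) (hg : Primrec g) : PP fun a => bt (f a) (g a) := by
  unfold bt; fun_prop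
@[fun_prop] theorem pr_dg {h : α → ℕ} (hf : Primrec f) (hg : Primrec g) (hh : Primrec h) :
    Primrec fun a => dg (f a) (g a) (h a) := by
  unfold dg; fun_prop

theorem dg_ex (b : ℕ) : ∀ (N : ℕ) (f : ℕ → ℕ), (∀ i < N, f i < b) → ∃ Z < b ^ N, ∀ i < N, dg b Z i = f i
  | 0, f, _ => ⟨0, by simp, by simp⟩
  | N+1, f, h => by
    obtain ⟨Z, hZ, hZ'⟩ := dg_ex b N (fun i => f (i+1)) (fun i hi => h (i+1) (by omega))
    have h0 := h 0 (by omega)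
    refine ⟨f 0 + b * Z, ?_, ?_⟩
    · rw [pow_succ]
      have : b * (Z + 1) ≤ b * b ^ N := Nat.mul_le_mul_left _ hZ
      nlinarith
    · intro i hi
      rcases i with _ | i
      · simp [dg, Nat.mod_eq_of_lt h0]
      · have : (f 0 + b * Z) / b = Z := by
          rw [Nat.add_mul_div_left _ _ (by omega), Nat.div_eq_of_lt h0, zero_add]
        have e := hZ' i (by omega)
        rw [← e]
        unfold dg
        rw [pow_succ, mul_comm (b ^ i) b, ← Nat.div_div_eq_div_mul, this]

theorem bt_ex (N : ℕ) (p : ℕ → Prop) : ∃ Z < 2 ^ N, ∀ i < N, (bt Z i ↔ p i) := by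
  classical
  obtain ⟨Z, hZ, hZ'⟩ := dg_ex 2 N (fun i => if p i then 1 else 0) (by intro i _; split_ifs <;> simp)
  refine ⟨Z, hZ, fun i hi => ?_⟩
  have := hZ' i hi
  unfold bt
  unfold dg at this
  rw [this]
  split_ifs with h <;> simp [h]

theorem dg_lt {b : ℕ} (hb : 0 < b) (Z i : ℕ) : dg b Z i < b := Nat.mod_lt _ hb

def okc (v c : ℕ) : Prop :=
  c.unpair.1 = 0 ∨ c.unpair.1 = 1 ∨ ((c.unpair.1 = 2 ∨ c.unpair.1 = 4) ∧ bt v c.unpair.2) ∨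
  (c.unpair.1 = 3 ∧ bt v c.unpair.2.unpair.1 ∧ bt v c.unpair.2.unpair.2) ∨
  (c.unpair.1 = 5 ∧ c.unpair.2.unpair.1 = 0 ∧ bt v c.unpair.2.unpair.2)

/-- recognising codes of formulas -/
def isCode (n : ℕ) : Prop :=
  bEx (2 ^ (n+1)) fun v => bt v n ∧ bAll (n+1) fun c => Im (bt v c) (okc v c)

@[fun_prop] theorem pp_isCode (hf : Primrec f) : PP fun a => isCode (f a) := by
  unfold isCode okc; fun_prop

theorem pair_lt_pair_tag {a b : ℕ} (h : a ≠ 0) : b < Nat.pair a b := by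
  have := Nat.add_le_pair a b
  omega

theorem unp1_le (n : ℕ) : n.unpair.1 ≤ n := Nat.unpair_left_le n
theorem unp2_le (n : ℕ) : n.unpair.2 ≤ n := Nat.unpair_right_le n

theorem unp2_lt {n : ℕ} (h : n.unpair.1 ≠ 0) : n.unpair.2 < n := by
  have := pair_lt_pair_tag (b := n.unpair.2) h
  rwa [Nat.pair_unpair] at this

theorem tm_ex (n : ℕ) : ∃ t : ETm, t.code = n := by
  rcases n with _ | n
  · exact ⟨.var, rfl⟩
  · exact ⟨.const n, rfl⟩

theorem isCode_iff (n : ℕ) : isCode n ↔ ∃ φ : EF Unit, EF.encode eU φ = n := by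
  constructor
  · rintro ⟨v, -, hv, hall⟩
    have : ∀ c, c < n + 1 → bt v c → ∃ φ : EF Unit, EF.encode eU φ = c := by
      intro c
      induction c using Nat.strong_induction_on with
      | _ c ih =>
        intro hc hb
        have hp := Nat.pair_unpair c
        have hp2 := Nat.pair_unpair c.unpair.2
        rcases hall c hc hb with h | h | ⟨h, h1⟩ | ⟨h, h1, h2⟩ | ⟨h, h1, h2⟩
        · obtain ⟨t, ht⟩ := tm_ex c.unpair.2.unpair.2
          exact ⟨.pred c.unpair.2.unpair.1 t, by rw [EF.encode, ht, hp2, ← h, hp]⟩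
        · obtain ⟨t, ht⟩ := tm_ex c.unpair.2.unpair.1
          obtain ⟨t', ht'⟩ := tm_ex c.unpair.2.unpair.2
          exact ⟨.eq t t', by rw [EF.encode, ht, ht', hp2, ← h, hp]⟩
        · have hl := unp2_lt (n := c) (by omega)
          obtain ⟨φ, hφ⟩ := ih _ hl (by omega) h1
          rcases h with h | h
          · exact ⟨.neg φ, by rw [EF.encode, hφ, ← h, hp]⟩
          · exact ⟨.ex φ, by rw [EF.encode, hφ, ← h, hp]⟩
        · have hl := unp2_lt (n := c) (by omega)
          have l1 := unp1_le c.unpair.2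
          have l2 := unp2_le c.unpair.2
          obtain ⟨φ, hφ⟩ := ih _ (lt_of_le_of_lt l1 hl) (by omega) h1
          obtain ⟨ψ, hψ⟩ := ih _ (lt_of_le_of_lt l2 hl) (by omega) h2
          exact ⟨.and φ ψ, by rw [EF.encode, hφ, hψ, hp2, ← h, hp]⟩
        · have hl := unp2_lt (n := c) (by omega)
          have l2 := unp2_le c.unpair.2
          obtain ⟨ψ, hψ⟩ := ih _ (lt_of_le_of_lt l2 hl) (by omega) h2
          refine ⟨.box () ψ, ?_⟩
          rw [EF.encode, hψ, eU, ← h1, hp2, ← h, hp]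
    exact this n (by omega) hv
  · rintro ⟨φ, hφ⟩
    obtain ⟨v, hv, hv'⟩ := bt_ex (n+1) (fun c => ∃ φ : EF Unit, EF.encode eU φ = c)
    refine ⟨v, hv, (hv' n (by omega)).2 ⟨φ, hφ⟩, ?_⟩
    intro c hc hb
    obtain ⟨ψ, rfl⟩ := (hv' c hc).1 hb
    have hb2 : ∀ χ : EF Unit, EF.encode eU χ ≤ EF.encode eU ψ → bt v (EF.encode eU χ) :=
      fun χ h => (hv' _ (by omega)).2 ⟨χ, rfl⟩
    unfold okc
    have := unp2_le (EF.encode eU ψ)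
    have h1 := unp1_le (EF.encode eU ψ).unpair.2
    have h2 := unp2_le (EF.encode eU ψ).unpair.2
    cases ψ with
    | pred n t => simp [EF.encode]
    | eq t t' => simp [EF.encode]
    | neg χ =>
      simp only [EF.encode, Nat.unpair_pair] at this hb2 ⊢
      simp [hb2 χ this]
    | ex χ =>
      simp only [EF.encode, Nat.unpair_pair] at this hb2 ⊢
      simp [hb2 χ this]
    | and χ ξ =>
      simp only [EF.encode, Nat.unpair_pair] at this h1 h2 hb2 ⊢
      simp [hb2 χ (h1.trans this), hb2 ξ (h2.trans this)]
    | box m χ =>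
      simp only [EF.encode, Nat.unpair_pair] at this h1 h2 hb2 ⊢
      simp [hb2 χ (h2.trans this), eU]

def Kc (g : ℕ) : ℕ := 2 ^ (2 * g + 2)
def xe (g t τ : ℕ) : Prop := τ = 0 ∨ bt t (g + τ)

/-- local coherence of bit `c` -/
def coh (g : ℕ) (p : ℕ → Prop) (t c : ℕ) : Prop :=
  Im (c.unpair.1 = 0) (bt t c ↔ bEx (Kc g) fun s => p s ∧ Im (c.unpair.2.unpair.2 = 0) (s = t) ∧
    xe g s c.unpair.2.unpair.2 ∧ bt s (Nat.pair 0 (Nat.pair c.unpair.2.unpair.1 0))) ∧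
  Im (c.unpair.1 = 1) (bt t c ↔ bEx (Kc g) fun s => p s ∧
    Im (c.unpair.2.unpair.1 = 0 ∨ c.unpair.2.unpair.2 = 0) (s = t) ∧
    xe g s c.unpair.2.unpair.1 ∧ xe g s c.unpair.2.unpair.2) ∧
  Im (c.unpair.1 = 2) (bt t c ↔ ¬ bt t c.unpair.2) ∧
  Im (c.unpair.1 = 3) (bt t c ↔ (bt t c.unpair.2.unpair.1 ∧ bt t c.unpair.2.unpair.2)) ∧
  Im (c.unpair.1 = 4) (bt t c ↔ bEx (Kc g) fun s => p s ∧ bt s c.unpair.2)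

def cRR (g : ℕ) (p : ℕ → Prop) : Prop :=
  (bAll (Kc g) fun t => Im (p t) (¬ bt t g ∧ bAll (g+1) fun c => Im (isCode c) (coh g p t c))) ∧
  bAll (g+1) fun τ => Im (τ ≠ 0) (bEx (Kc g) fun t => p t ∧ bt t (g + τ) ∧
    bAll (Kc g) fun s => Im (p s ∧ bt s (g + τ)) (s = t))

def cCC (g : ℕ) (p : ℕ → Prop) : Prop :=
  bAll (Kc g) fun t => Im (p t) (bAll (g+1) fun c => Im (isCode c ∧ c.unpair.1 = 5)
    (Im (bt t c) (bAll (Kc g) fun s => Im (p s ∧ s ≠ t) (bt s c.unpair.2.unpair.2)) ∧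
     Im (¬ bt t c) (bEx (Kc g) fun s => p s ∧ s ≠ t ∧ ¬ bt s c.unpair.2.unpair.2)))

def cA (g t : ℕ) : Prop := bEx (g+1) fun τ => τ ≠ 0 ∧ bt t (g + τ)

def cB (g t : ℕ) : Prop :=
  bEx (g+1) fun c => isCode c ∧ c.unpair.1 = 5 ∧ bt t c ∧ ¬ bt t c.unpair.2.unpair.2

@[fun_prop] theorem pr_Kc (hf : Primrec f) : Primrec fun a => Kc (f a) := by
  unfold Kc; fun_prop
@[fun_prop] theorem pp_xe {h : α → ℕ} (hf : Primrec f) (hg : Primrec g) (hh : Primrec h) :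
    PP fun a => xe (f a) (g a) (h a) := by
  unfold xe; fun_prop
@[fun_prop] theorem pp_coh {h : α → ℕ} {p : α → ℕ → Prop} (hf : Primrec f) (hg : Primrec g) (hh : Primrec h)
    (hp : PP fun q : α × ℕ => p q.1 q.2) :
    PP fun a => coh (f a) (p a) (g a) (h a) := by
  unfold coh; fun_prop
@[fun_prop] theorem pp_cRR {p : α → ℕ → Prop} (hf : Primrec f)
    (hp : PP fun q : α × ℕ => p q.1 q.2) : PP fun a => cRR (f a) (p a) := by
  unfold cRR; fun_prop
@[fun_prop] theorem pp_cCC {p : α → ℕ → Prop} (hf : Primrec f)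
    (hp : PP fun q : α × ℕ => p q.1 q.2) : PP fun a => cCC (f a) (p a) := by
  unfold cCC; fun_prop
@[fun_prop] theorem pp_cA (hf : Primrec f) (hg : Primrec g) : PP fun a => cA (f a) (g a) := by
  unfold cA; fun_prop
@[fun_prop] theorem pp_cB (hf : Primrec f) (hg : Primrec g) : PP fun a => cB (f a) (g a) := by
  unfold cB; fun_prop

end
end OneVarEq

set_option linter.unusedSectionVars false

namespace OneVarEq
open Set

/-! ### Simple constant-domain difference models -/

structure SM (W D : Type) where
  I : W → ℕ → Set D
  cst : W → ℕ → D

def SM.tv {W D : Type} (S : SM W D) (w : W) (a : D) : ETm → D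
  | .var => a
  | .const k => S.cst w k

def SM.ev {W D : Type} (S : SM W D) : EF Unit → W → D → Prop
  | .pred n t, w, a => S.tv w a t ∈ S.I w n
  | .eq t₁ t₂, w, a => S.tv w a t₁ = S.tv w a t₂
  | .neg φ, w, a => ¬ S.ev φ w a
  | .and φ ψ, w, a => S.ev φ w a ∧ S.ev ψ w a
  | .ex φ, w, _ => ∃ b, S.ev φ w b
  | .box _ φ, w, a => ∀ v, w ≠ v → S.ev φ v a

/-- the universal closure used as a global assumption -/
def UU (φ : EF Unit) : EF Unit := .and (EF.all φ) (.box () (EF.all φ))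

theorem SM.ev_UU {W D : Type} (S : SM W D) (φ : EF Unit) (w : W) (a : D) :
    S.ev (UU φ) w a ↔ ∀ v b, S.ev φ v b := by
  simp only [UU, EF.all, SM.ev, not_exists, not_not]
  constructor
  · rintro ⟨h1, h2⟩ v b
    by_cases h : w = v
    · exact h ▸ h1 b
    · exact h2 v h b
  · intro h
    exact ⟨h w, fun v _ b => h v b⟩

/-- from simple models to frames -/
def difF (W : Type) [hW : Nonempty W] : KFrame Unit := ⟨W, hW, fun _ w v => w ≠ v⟩

theorem difF_D (W : Type) [Nonempty W] : difF W ∈ Dclass :=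
  ⟨Unit, fun _ => (), fun w v => by simp [difF]⟩

theorem difF_Dfin (W : Type) [Nonempty W] [Finite W] : difF W ∈ DfinClass :=
  ⟨Unit, fun _ => (), fun w v => by simp [difF], fun w => Set.toFinite (α := W) _⟩

def SM.mod {W D : Type} [Nonempty W] (S : SM W D) : EModel (difF W) where
  D := D
  dom := fun _ => univ
  domNe := fun w => ⟨S.cst w 0, trivial⟩
  expand := fun _ _ _ _ => subset_rfl
  I := S.I
  cst := S.cst
  cstMem := fun _ _ => trivial

theorem SM.mod_tv {W D : Type} [Nonempty W] (S : SM W D) (w : W) (a : D) (t : ETm) :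
    S.mod.tmVal w a t = S.tv w a t := by cases t <;> rfl

theorem SM.mod_eval {W D : Type} [Nonempty W] (S : SM W D) (φ : EF Unit) :
    ∀ (w : W) (a : D), S.mod.eval φ w a ↔ S.ev φ w a := by
  induction φ with
  | pred n t => intro w a; simp only [EModel.eval, SM.ev, SM.mod_tv]; rfl
  | eq t t' => intro w a; simp only [EModel.eval, SM.ev, SM.mod_tv]; rfl
  | neg φ ih => intro w a; simp only [EModel.eval, SM.ev, ih]
  | and φ ψ ih ih' => intro w a; simp only [EModel.eval, SM.ev, ih, ih']
  | ex φ ih =>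
    intro w a; simp only [EModel.eval, SM.ev]
    exact ⟨fun ⟨b, _, h⟩ => ⟨b, (ih w b).1 h⟩, fun ⟨b, h⟩ => ⟨b, trivial, (ih w b).2 h⟩⟩
  | box m φ ih =>
    intro w a; simp only [EModel.eval, SM.ev]
    exact ⟨fun h v hv => (ih v a).1 (h v hv), fun h v hv => (ih v a).2 (h v hv)⟩

theorem SM.refute {W D : Type} [Nonempty W] (S : SM W D) (d : DSem) (C : Set (KFrame Unit))
    (hC : difF W ∈ C) (φ : EF Unit) (w : W) (a : D) (h : ¬ S.ev φ w a) : φ ∉ LogED d C :=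
  fun hh => h ((S.mod_eval φ w a).1 (hh _ hC S.mod (fun _ _ => rfl) w a trivial))

/-- from models to simple models -/
theorem dom_comp {F : KFrame Unit} (𝔪 : EModel F) {ι : Type} (f : F.W → ι)
    (hf : ∀ w v, F.R () w v ↔ (f w = f v ∧ w ≠ v)) {w v : F.W} (h : f w = f v) :
    𝔪.dom w = 𝔪.dom v := by
  by_cases e : w = v
  · rw [e]
  · exact Subset.antisymm (𝔪.expand () w v ((hf w v).2 ⟨h, e⟩))
      (𝔪.expand () v w ((hf v w).2 ⟨h.symm, fun e' => e e'.symm⟩))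

def subM {F : KFrame Unit} (𝔪 : EModel F) {ι : Type} (f : F.W → ι)
    (hf : ∀ w v, F.R () w v ↔ (f w = f v ∧ w ≠ v)) (w0 : F.W) :
    SM {v // f v = f w0} (𝔪.dom w0) where
  I := fun w n => {d | d.1 ∈ 𝔪.I w.1 n}
  cst := fun w k => ⟨𝔪.cst w.1 k, dom_comp 𝔪 f hf w.2 ▸ 𝔪.cstMem w.1 k⟩

theorem subM_tv {F : KFrame Unit} (𝔪 : EModel F) {ι : Type} (f : F.W → ι)
    (hf : ∀ w v, F.R () w v ↔ (f w = f v ∧ w ≠ v)) (w0 : F.W) (w : {v // f v = f w0})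
    (a : 𝔪.dom w0) (t : ETm) : ((subM 𝔪 f hf w0).tv w a t).1 = 𝔪.tmVal w.1 a.1 t := by
  cases t <;> rfl

theorem subM_ev {F : KFrame Unit} (𝔪 : EModel F) {ι : Type} (f : F.W → ι)
    (hf : ∀ w v, F.R () w v ↔ (f w = f v ∧ w ≠ v)) (w0 : F.W) (φ : EF Unit) :
    ∀ w a, (subM 𝔪 f hf w0).ev φ w a ↔ 𝔪.eval φ w.1 a.1 := by
  induction φ with
  | pred n t => intro w a; simp only [EModel.eval, SM.ev, ← subM_tv 𝔪 f hf w0]; rfl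
  | eq t t' =>
    intro w a; simp only [EModel.eval, SM.ev, ← subM_tv 𝔪 f hf w0]
    exact Subtype.ext_iff
  | neg φ ih => intro w a; simp only [EModel.eval, SM.ev, ih]
  | and φ ψ ih ih' => intro w a; simp only [EModel.eval, SM.ev, ih, ih']
  | ex φ ih =>
    intro w a; simp only [EModel.eval, SM.ev, ih, dom_comp 𝔪 f hf w.2]
    exact ⟨fun ⟨b, h⟩ => ⟨b.1, b.2, h⟩, fun ⟨b, hb, h⟩ => ⟨⟨b, hb⟩, h⟩⟩
  | box m φ ih =>
    intro w a; simp only [EModel.eval, SM.ev]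
    constructor
    · intro h v hv
      obtain ⟨h1, h2⟩ := (hf _ _).1 hv
      exact (ih ⟨v, h1.symm.trans w.2⟩ a).1 (h _ (fun e => h2 (congrArg Subtype.val e)))
    · intro h v hv
      exact (ih v a).2 (h v.1 ((hf _ _).2 ⟨w.2.trans v.2.symm, fun e => hv (Subtype.ext e)⟩))

theorem D_simple (d : DSem) (φ : EF Unit) (h : φ ∉ LogED d Dclass) :
    ∃ (W D : Type) (S : SM W D) (w : W) (a : D), ¬ S.ev φ w a := by
  simp only [LogED, Set.mem_ofPred_eq, EModel.TrueIn, EModel.TrueAt] at h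
  push Not at h
  obtain ⟨F, ⟨ι, f, hf⟩, 𝔪, _, w, a, ha, hh⟩ := h
  exact ⟨_, _, subM 𝔪 f hf w, ⟨w, rfl⟩, ⟨a, ha⟩, by rw [subM_ev]; exact hh⟩

theorem Dfin_simple (d : DSem) (φ : EF Unit) (h : φ ∉ LogED d DfinClass) :
    ∃ (W D : Type) (_ : Finite W) (S : SM W D) (w : W) (a : D), ¬ S.ev φ w a := by
  simp only [LogED, Set.mem_ofPred_eq, EModel.TrueIn, EModel.TrueAt] at h
  push Not at h
  obtain ⟨F, ⟨ι, f, hf, hfin⟩, 𝔪, _, w, a, ha, hh⟩ := h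
  exact ⟨_, _, (hfin w).to_subtype, subM 𝔪 f hf w, ⟨w, rfl⟩, ⟨a, ha⟩, by rw [subM_ev]; exact hh⟩

/-! ### Matrices and simple models -/

def sysF (g : ℕ) : Sys (Fin (Kc g)) where
  A := fun t => cA g t.1
  B := fun t => cB g t.1
  RR := fun P => cRR g (fun n => ∃ t ∈ P, t.1 = n)
  CC := fun P => cCC g (fun n => ∃ t ∈ P, t.1 = n)

section M2S
variable {W D : Type} [Nonempty W] [Nonempty D] {g : ℕ} {X : W → D → Fin (Kc g)}

theorem row_exists (hX : MValid (sysF g) X) (w : W) (k : ℕ) (hk : k < g) :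
    ∃ d, bt (X w d).1 (g + (k+1)) ∧ ∀ d', bt (X w d').1 (g + (k+1)) → d' = d := by
  obtain ⟨⟨h1, h2⟩, -⟩ := hX
  obtain ⟨-, h⟩ := h1 w
  obtain ⟨n, hn, ⟨t, ⟨d, rfl⟩, rfl⟩, hb, hu⟩ := h (k+1) (by omega) (by omega)
  refine ⟨d, hb, fun d' hd' => ?_⟩
  have := hu (X w d').1 (X w d').2 ⟨⟨_, ⟨d', rfl⟩, rfl⟩, hd'⟩
  exact h2 w d' d ⟨k+1, by omega, by omega, hd'⟩ (Fin.ext this)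

noncomputable def m2s (g : ℕ) (X : W → D → Fin (Kc g)) : SM W D where
  I := fun w n => {d | bt (X w d).1 (Nat.pair 0 (Nat.pair n 0))}
  cst := fun w k => Classical.epsilon (fun d => bt (X w d).1 (g + (k+1)))

theorem m2s_xe (hX : MValid (sysF g) X) (w : W) (a d : D) (t : ETm) (ht : t.code ≤ g) :
    (Im (t.code = 0) ((X w d).1 = (X w a).1) ∧ xe g (X w d).1 t.code) ↔
      (X w d = X w ((m2s g X).tv w a t) ∧ (t.code ≠ 0 → d = (m2s g X).tv w a t)) := by
  cases t with
  | var => simp [ETm.code, Im, xe, SM.tv, Fin.ext_iff]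
  | const k =>
    simp only [ETm.code, Im, xe, SM.tv] at ht ⊢
    obtain ⟨d0, hd0, hu⟩ := row_exists hX w k (by omega)
    have : (m2s g X).cst w k = d0 :=
      hu _ (Classical.epsilon_spec (p := fun d => bt (X w d).1 (g + (k+1))) ⟨d0, hd0⟩)
    rw [this]
    constructor
    · rintro ⟨-, h | h⟩
      · omega
      · exact ⟨by rw [hu d h], fun _ => hu d h⟩
    · rintro ⟨h, h2⟩
      exact ⟨by omega, Or.inr (h2 (by omega) ▸ hd0)⟩

theorem m2s_truth (hX : MValid (sysF g) X) (φ : EF Unit) :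
    EF.encode eU φ ≤ g → ∀ w a, (bt (X w a).1 (EF.encode eU φ) ↔ (m2s g X).ev φ w a) := by
  have hcoh : ∀ w a (ψ : EF Unit), EF.encode eU ψ ≤ g →
      coh g (fun n => ∃ t ∈ range (X w), t.1 = n) (X w a).1 (EF.encode eU ψ) := by
    intro w a ψ hψ
    exact ((hX.1.1 w).1 (X w a).1 (X w a).2 ⟨_, ⟨a, rfl⟩, rfl⟩).2 _ (by omega)
      ((isCode_iff _).2 ⟨ψ, rfl⟩)
  have hp : ∀ w n, (∃ t ∈ range (X w), t.1 = n) ↔ ∃ d, (X w d).1 = n := by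
    intro w n; simp
  induction φ with
  | pred n t =>
    intro hg w a
    have h := (hcoh w a _ hg).1
    have l1 := unp2_le (EF.encode eU (.pred n t))
    have l2 := unp2_le (EF.encode eU (.pred n t)).unpair.2
    simp only [EF.encode, Nat.unpair_pair] at h l1 l2
    simp only [EF.encode, SM.ev] at hg ⊢
    rw [h trivial]
    have key := fun d => m2s_xe hX w a d t (by omega)
    constructor
    · rintro ⟨s, hs, hps, h1, h2, h3⟩
      obtain ⟨d, rfl⟩ := (hp w s).1 hps
      have := (key d).1 ⟨h1, h2⟩
      change bt (X w _).1 _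
      rw [← this.1]; exact h3
    · intro h'
      have := (key ((m2s g X).tv w a t)).2 ⟨rfl, fun _ => rfl⟩
      exact ⟨_, (X w _).2, (hp w _).2 ⟨_, rfl⟩, this.1, this.2, h'⟩
  | eq t t' =>
    intro hg w a
    have h := (hcoh w a _ hg).2.1
    have l1 := unp2_le (EF.encode eU (.eq t t'))
    have l2 := unp2_le (EF.encode eU (.eq t t')).unpair.2
    have l3 := unp1_le (EF.encode eU (.eq t t')).unpair.2
    simp only [EF.encode, Nat.unpair_pair] at h l1 l2 l3
    simp only [EF.encode, SM.ev] at hg ⊢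
    rw [h trivial]
    have key := fun d => m2s_xe hX w a d t (by omega)
    have key' := fun d => m2s_xe hX w a d t' (by omega)
    -- uniqueness of marked elements
    have huniq : ∀ d τ, τ ≠ 0 → τ ≤ g → xe g (X w d).1 τ → ∀ d', X w d = X w d' → d = d' := by
      intro d τ h0 hτ hx d' e
      exact hX.1.2 w d d' ⟨τ, by omega, h0, hx.resolve_left h0⟩ e
    constructor
    · rintro ⟨s, hs, hps, h1, h2, h3⟩
      obtain ⟨d, rfl⟩ := (hp w s).1 hps
      have k1 := (key d).1 ⟨fun e => h1 (Or.inl e), h2⟩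
      have k2 := (key' d).1 ⟨fun e => h1 (Or.inr e), h3⟩
      by_cases e : t.code = 0
      · by_cases e' : t'.code = 0
        · cases t <;> cases t' <;> simp_all [ETm.code, SM.tv]
        · have := huniq d _ e' (by omega) h3 _ k1.1
          rw [← this, ← k2.2 e']
      · have := huniq d _ e (by omega) h2 _ k2.1
        rw [← this, ← k1.2 e]
    · intro h'
      have k1 := (key ((m2s g X).tv w a t)).2 ⟨rfl, fun _ => rfl⟩
      have k2 := (key' ((m2s g X).tv w a t)).2 ⟨by rw [h'], fun _ => h'⟩
      exact ⟨_, (X w _).2, (hp w _).2 ⟨_, rfl⟩, fun h => h.elim k1.1 k2.1, k1.2, k2.2⟩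
  | neg φ ih =>
    intro hg w a
    have h := (hcoh w a _ hg).2.2.1
    have l1 := unp2_le (EF.encode eU (.neg φ))
    simp only [EF.encode, Nat.unpair_pair] at h l1
    simp only [EF.encode, SM.ev] at hg ⊢
    rw [h trivial, ih (by omega)]
  | and φ ψ ih ih' =>
    intro hg w a
    have h := (hcoh w a _ hg).2.2.2.1
    have l1 := unp2_le (EF.encode eU (.and φ ψ))
    have l2 := unp2_le (EF.encode eU (.and φ ψ)).unpair.2
    have l3 := unp1_le (EF.encode eU (.and φ ψ)).unpair.2
    simp only [EF.encode, Nat.unpair_pair] at h l1 l2 l3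
    simp only [EF.encode, SM.ev] at hg ⊢
    rw [h trivial, ih (by omega), ih' (by omega)]
  | ex φ ih =>
    intro hg w a
    have h := (hcoh w a _ hg).2.2.2.2
    have l1 := unp2_le (EF.encode eU (.ex φ))
    simp only [EF.encode, Nat.unpair_pair] at h l1
    simp only [EF.encode, SM.ev] at hg ⊢
    rw [h trivial]
    constructor
    · rintro ⟨s, hs, hps, h1⟩
      obtain ⟨d, rfl⟩ := (hp w s).1 hps
      exact ⟨d, (ih (by omega) w d).1 h1⟩
    · rintro ⟨d, hd⟩
      exact ⟨_, (X w d).2, (hp w _).2 ⟨d, rfl⟩, (ih (by omega) w d).2 hd⟩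
  | box m φ ih =>
    intro hg w a
    have l1 := unp2_le (EF.encode eU (.box m φ))
    have l2 := unp2_le (EF.encode eU (.box m φ)).unpair.2
    have hp' : ∀ n, (∃ t ∈ range (fun v => X v a), t.1 = n) ↔ ∃ v, (X v a).1 = n := by
      intro n; simp
    have h := (hX.2.1 a) (X w a).1 (X w a).2 ⟨_, ⟨w, rfl⟩, rfl⟩ (EF.encode eU (.box m φ)) (by omega)
      ⟨(isCode_iff _).2 ⟨_, rfl⟩, by simp [EF.encode]⟩
    have hB := hX.2.2 a w
    have hcd : isCode (EF.encode eU (.box m φ)) := (isCode_iff _).2 ⟨_, rfl⟩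
    simp only [EF.encode, Nat.unpair_pair] at h l1 l2 hcd
    simp only [EF.encode, SM.ev] at hg ⊢
    obtain ⟨h1, h2⟩ := h
    constructor
    · intro hb v hv
      rw [← ih (by omega)]
      by_cases e : (X v a).1 = (X w a).1
      · by_contra hn
        refine hv (hB v ⟨_, by omega, hcd, by simp, hb, ?_⟩ (Fin.ext e.symm))
        simp only [Nat.unpair_pair]
        rw [← e]; exact hn
      · exact h1 hb _ (X v a).2 ⟨(hp' _).2 ⟨v, rfl⟩, e⟩
    · intro hv
      by_contra hn
      obtain ⟨s, hs, hps, hne, hb⟩ := h2 hn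
      obtain ⟨v, rfl⟩ := (hp' _).1 hps
      refine hb ((ih (by omega) v a).2 (hv v ?_))
      rintro rfl
      exact hne rfl

theorem m2s_final (φ : EF Unit) (X : W → D → Fin (Kc (EF.encode eU (UU φ))))
    (hX : MValid (sysF (EF.encode eU (UU φ))) X) : ∃ (S : SM W D) (w : W) (a : D), ¬ S.ev φ w a := by
  obtain ⟨w⟩ := ‹Nonempty W›
  obtain ⟨a⟩ := ‹Nonempty D›
  have : Nonempty W := ⟨w⟩
  have : Nonempty D := ⟨a⟩
  have h := ((hX.1.1 w).1 (X w a).1 (X w a).2 ⟨_, ⟨a, rfl⟩, rfl⟩).1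
  rw [m2s_truth hX _ le_rfl, SM.ev_UU] at h
  push Not at h
  obtain ⟨v, b, h⟩ := h
  exact ⟨_, v, b, h⟩
end M2S

end OneVarEq

namespace OneVarEq
open Set

section S2M
variable {W D : Type}

/-- the unmarked type of a point -/
def bp (g : ℕ) (S : SM W D) (w : W) (d : D) : ℕ → Prop := fun i =>
  (i ≤ g ∧ ∃ ψ : EF Unit, EF.encode eU ψ = i ∧ S.ev ψ w d) ∨
  (g < i ∧ i ≤ 2 * g ∧ d = S.cst w (i - g - 1))

/-- the marked occurrence -/
def mk (g : ℕ) (S : SM W D) (w : W) (d : D) : Prop :=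
  w = @Classical.epsilon W ⟨w⟩ (fun v => bp g S v d = bp g S w d)

noncomputable def s2m (g : ℕ) (S : SM W D) (w : W) (d : D) : Fin (Kc g) :=
  ⟨Classical.choose (bt_ex (2 * g + 2) fun i => bp g S w d i ∨ (i = 2 * g + 1 ∧ mk g S w d)),
    (Classical.choose_spec (bt_ex (2 * g + 2) fun i => bp g S w d i ∨
      (i = 2 * g + 1 ∧ mk g S w d))).1⟩

variable (g : ℕ) (S : SM W D)

theorem s2m_bit (w : W) (d : D) (i : ℕ) (hi : i < 2 * g + 2) :
    bt (s2m g S w d).1 i ↔ bp g S w d i ∨ (i = 2 * g + 1 ∧ mk g S w d) :=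
  (Classical.choose_spec (bt_ex (2 * g + 2) fun i => bp g S w d i ∨
      (i = 2 * g + 1 ∧ mk g S w d))).2 i hi

theorem eU_inj : Function.Injective eU := fun _ _ _ => rfl

theorem s2m_code (w : W) (d : D) (ψ : EF Unit) (h : EF.encode eU ψ ≤ g) :
    bt (s2m g S w d).1 (EF.encode eU ψ) ↔ S.ev ψ w d := by
  rw [s2m_bit g S w d _ (by omega)]
  constructor
  · rintro ((⟨-, χ, h1, h2⟩ | h) | h)
    · rwa [← encode_inj eU_inj _ _ h1]
    · omega
    · omega
  · intro hh
    exact Or.inl (Or.inl ⟨h, ψ, rfl, hh⟩)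

theorem s2m_cst (w : W) (d : D) (k : ℕ) (h : k < g) :
    bt (s2m g S w d).1 (g + (k + 1)) ↔ d = S.cst w k := by
  rw [s2m_bit g S w d _ (by omega)]
  have : g + (k+1) - g - 1 = k := by omega
  simp only [bp, this]
  constructor
  · rintro ((h | h) | h)
    · omega
    · exact h.2.2
    · omega
  · intro hh
    exact Or.inl (Or.inr ⟨by omega, by omega, hh⟩)

theorem s2m_mk (w : W) (d : D) : bt (s2m g S w d).1 (2 * g + 1) ↔ mk g S w d := by
  rw [s2m_bit g S w d _ (by omega)]
  constructor
  · rintro ((h | h) | h)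
    · omega
    · omega
    · exact h.2
  · intro h
    exact Or.inr ⟨rfl, h⟩

theorem s2m_bp {w v : W} {d : D} (h : s2m g S w d = s2m g S v d) : bp g S w d = bp g S v d := by
  funext i
  by_cases hi : i < 2 * g + 1
  · have h1 := s2m_bit g S w d i (by omega)
    have h2 := s2m_bit g S v d i (by omega)
    rw [h] at h1
    have h3 := h1.symm.trans h2
    apply propext
    constructor
    · intro hh
      rcases h3.1 (Or.inl hh) with h | h
      · exact h
      · omega
    · intro hh
      rcases h3.2 (Or.inl hh) with h | h
      · exact h
      · omega
  · apply propext
    constructor <;> (rintro (h | h) <;> omega)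

theorem bp_ev {w v : W} {d : D} (h : bp g S w d = bp g S v d) (ψ : EF Unit)
    (hψ : EF.encode eU ψ ≤ g) : S.ev ψ w d ↔ S.ev ψ v d := by
  have aux : ∀ u, S.ev ψ u d ↔ bp g S u d (EF.encode eU ψ) := by
    intro u
    constructor
    · intro hh
      exact Or.inl ⟨hψ, ψ, rfl, hh⟩
    · rintro (⟨-, χ, h1, h2⟩ | h)
      · rwa [← encode_inj eU_inj _ _ h1]
      · omega
  rw [aux, aux, h]

theorem mk_other {w v : W} {d : D} (h : bp g S w d = bp g S v d) (hne : w ≠ v) :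
    ∃ u, bp g S u d = bp g S w d ∧ s2m g S u d ≠ s2m g S w d := by
  by_cases hm : s2m g S w d = s2m g S v d
  · refine ⟨@Classical.epsilon W ⟨w⟩ (fun v => bp g S v d = bp g S w d),
      Classical.epsilon_spec (p := fun v => bp g S v d = bp g S w d) ⟨w, rfl⟩, fun e => ?_⟩
    have hs : bp g S (@Classical.epsilon W ⟨w⟩ (fun v => bp g S v d = bp g S w d)) d =
      bp g S w d := Classical.epsilon_spec (p := fun v => bp g S v d = bp g S w d) ⟨w, rfl⟩
    have h1 : mk g S (@Classical.epsilon W ⟨w⟩ (fun v => bp g S v d = bp g S w d)) d := by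
      unfold mk; rw [hs]
    have h2 : mk g S w d := by rw [← s2m_mk, ← e, s2m_mk]; exact h1
    have h3 : mk g S v d := by rw [← s2m_mk, ← hm, s2m_mk]; exact h2
    unfold mk at h2 h3
    rw [← h] at h3
    exact hne (h2.trans h3.symm)
  · exact ⟨v, h.symm, fun e => hm e.symm⟩

theorem s2m_xe (w : W) (a : D) (d : D) (t : ETm) (ht : t.code ≤ g) :
    xe g (s2m g S w d).1 t.code ↔ (t.code = 0 ∨ d = S.tv w a t) := by
  cases t with
  | var => simp [xe, ETm.code]
  | const k =>
    simp only [xe, ETm.code, SM.tv] at ht ⊢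
    rw [s2m_cst g S w d k (by omega)]

theorem tv_cases (w : W) (a : D) (t : ETm) (h : t.code = 0) : S.tv w a t = a := by
  cases t with
  | var => rfl
  | const k => simp [ETm.code] at h

theorem s2m_coh (w : W) (a : D) (ψ : EF Unit) (hψ : EF.encode eU ψ ≤ g) :
    coh g (fun n => ∃ t ∈ range (s2m g S w), t.1 = n) (s2m g S w a).1 (EF.encode eU ψ) := by
  have hp : ∀ n, (∃ t ∈ range (s2m g S w), t.1 = n) ↔ ∃ d, (s2m g S w d).1 = n := by
    intro n; simp
  have hb := s2m_code g S w a ψ hψ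
  unfold coh
  cases ψ with
  | pred n t =>
    have l1 := unp2_le (EF.encode eU (.pred n t))
    have l2 := unp2_le (EF.encode eU (.pred n t)).unpair.2
    have l3 : EF.encode eU (.pred n .var) ≤ EF.encode eU (.pred n t) := by
      simp only [EF.encode]
      rcases Nat.eq_zero_or_pos t.code with h | h
      · rw [h]; rfl
      · exact (Nat.pair_lt_pair_right _ (Nat.pair_lt_pair_right _ h)).le
    have hv : ∀ d, bt (s2m g S w d).1 (Nat.pair 0 (Nat.pair n 0)) ↔ d ∈ S.I w n :=
      fun d => s2m_code g S w d (.pred n .var) (l3.trans hψ)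
    rw [hb]
    simp only [EF.encode, Nat.unpair_pair, Im, SM.ev] at hψ l1 l2 ⊢
    have hx := fun d => s2m_xe g S w a d t (by omega)
    simp only [hp]
    refine ⟨fun _ => ?_, by simp, by simp, by simp, by simp⟩
    constructor
    · intro h
      refine ⟨_, (s2m g S w (S.tv w a t)).2, ⟨_, rfl⟩, fun e => ?_, (hx _).2 (Or.inr rfl),
        (hv _).2 h⟩
      rw [tv_cases S w a t e]
    · rintro ⟨s, -, ⟨d, rfl⟩, h1, h2, h3⟩
      rcases (hx d).1 h2 with e | e
      · have h4 := h1 e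
        rw [h4, hv] at h3
        rw [tv_cases S w a t e]; exact h3
      · rw [← e]; exact (hv d).1 h3
  | eq t t' =>
    have l1 := unp2_le (EF.encode eU (.eq t t'))
    have l2 := unp2_le (EF.encode eU (.eq t t')).unpair.2
    have l3 := unp1_le (EF.encode eU (.eq t t')).unpair.2
    rw [hb]
    simp only [EF.encode, Nat.unpair_pair, Im, SM.ev] at hψ l1 l2 l3 ⊢
    have hx := fun d => s2m_xe g S w a d t (by omega)
    have hx' := fun d => s2m_xe g S w a d t' (by omega)
    simp only [hp]
    refine ⟨by simp, fun _ => ?_, by simp, by simp, by simp⟩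
    constructor
    · intro h
      refine ⟨_, (s2m g S w (S.tv w a t)).2, ⟨_, rfl⟩, fun e => ?_, (hx _).2 (Or.inr rfl),
        (hx' _).2 (Or.inr h)⟩
      rcases e with e | e
      · rw [tv_cases S w a t e]
      · rw [h, tv_cases S w a t' e]
    · rintro ⟨s, -, ⟨d, rfl⟩, h1, h2, h3⟩
      by_cases e : t.code = 0
      · rw [h1 (Or.inl e)] at h2 h3
        rw [tv_cases S w a t e]
        rcases (hx' a).1 h3 with e' | e'
        · rw [tv_cases S w a t' e']
        · exact e'
      · by_cases e' : t'.code = 0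
        · rw [h1 (Or.inr e')] at h2 h3
          rw [tv_cases S w a t' e']
          exact (((hx a).1 h2).resolve_left e).symm
        · rw [← ((hx d).1 h2).resolve_left e, ← ((hx' d).1 h3).resolve_left e']
  | neg χ =>
    have l1 := unp2_le (EF.encode eU (.neg χ))
    rw [hb]
    simp only [EF.encode, Nat.unpair_pair, Im, SM.ev] at hψ l1 ⊢
    refine ⟨by simp, by simp, fun _ => ?_, by simp, by simp⟩
    rw [s2m_code g S w a χ (by omega)]
  | and χ ξ =>
    have l1 := unp2_le (EF.encode eU (.and χ ξ))
    have l2 := unp2_le (EF.encode eU (.and χ ξ)).unpair.2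
    have l3 := unp1_le (EF.encode eU (.and χ ξ)).unpair.2
    rw [hb]
    simp only [EF.encode, Nat.unpair_pair, Im, SM.ev] at hψ l1 l2 l3 ⊢
    refine ⟨by simp, by simp, by simp, fun _ => ?_, by simp⟩
    rw [s2m_code g S w a χ (by omega), s2m_code g S w a ξ (by omega)]
  | ex χ =>
    have l1 := unp2_le (EF.encode eU (.ex χ))
    rw [hb]
    simp only [EF.encode, Nat.unpair_pair, Im, SM.ev] at hψ l1 ⊢
    simp only [hp]
    refine ⟨by simp, by simp, by simp, by simp, fun _ => ?_⟩
    have hv := fun d => s2m_code g S w d χ (by omega)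
    constructor
    · rintro ⟨d, h⟩
      exact ⟨_, (s2m g S w d).2, ⟨d, rfl⟩, (hv d).2 h⟩
    · rintro ⟨s, -, ⟨d, rfl⟩, h⟩
      exact ⟨d, (hv d).1 h⟩
  | box m χ =>
    simp [EF.encode, Im]

theorem code_box {c : ℕ} (h : isCode c) (h5 : c.unpair.1 = 5) :
    ∃ χ : EF Unit, c = EF.encode eU (.box () χ) := by
  obtain ⟨ψ, rfl⟩ := (isCode_iff c).1 h
  cases ψ <;> simp [EF.encode] at h5
  exact ⟨_, rfl⟩

theorem s2m_valid (hg : ∀ w a, ¬ bt (s2m g S w a).1 g) : MValid (sysF g) (s2m g S) := by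
  refine ⟨⟨fun w => ⟨?_, ?_⟩, ?_⟩, ⟨fun d => ?_, ?_⟩⟩
  · rintro _ - ⟨_, ⟨a, rfl⟩, rfl⟩
    refine ⟨hg w a, fun c hc hcd => ?_⟩
    obtain ⟨ψ, rfl⟩ := (isCode_iff c).1 hcd
    exact s2m_coh g S w a ψ (by omega)
  · intro τ hτ h0
    obtain ⟨k, rfl⟩ := Nat.exists_eq_succ_of_ne_zero h0
    refine ⟨_, (s2m g S w (S.cst w k)).2, ⟨_, ⟨_, rfl⟩, rfl⟩,
      (s2m_cst g S w _ k (by omega)).2 rfl, ?_⟩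
    rintro _ - ⟨⟨_, ⟨d, rfl⟩, rfl⟩, h⟩
    rw [(s2m_cst g S w d k (by omega)).1 h]
  · rintro w d d' ⟨τ, hτ, h0, hb⟩ e
    obtain ⟨k, rfl⟩ := Nat.exists_eq_succ_of_ne_zero h0
    have h1 := (s2m_cst g S w d k (by omega)).1 hb
    rw [e] at hb
    rw [h1, (s2m_cst g S w d' k (by omega)).1 hb]
  · rintro _ - ⟨_, ⟨w, rfl⟩, rfl⟩ c hc ⟨hcd, h5⟩
    obtain ⟨χ, rfl⟩ := code_box hcd h5
    have l1 := unp2_le (EF.encode eU (.box () χ))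
    have l2 := unp2_le (EF.encode eU (.box () χ)).unpair.2
    have e5 : (EF.encode eU (.box () χ)).unpair.2.unpair.2 = EF.encode eU χ := by
      simp [EF.encode]
    rw [e5] at l2 ⊢
    have hv := fun w => s2m_code g S w d χ (by omega)
    refine ⟨?_, ?_⟩
    · rintro hb _ - ⟨⟨_, ⟨v, rfl⟩, rfl⟩, hne⟩
      rw [s2m_code g S w d _ (by omega)] at hb
      rw [hv]
      exact hb v (by rintro rfl; exact hne rfl)
    · intro hb
      rw [s2m_code g S w d _ (by omega)] at hb
      simp only [SM.ev] at hb
      push Not at hb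
      obtain ⟨v, hne, hb⟩ := hb
      by_cases e : s2m g S w d = s2m g S v d
      · obtain ⟨u, hu, hu'⟩ := mk_other g S (s2m_bp g S e) hne
        refine ⟨_, (s2m g S u d).2, ⟨_, ⟨u, rfl⟩, rfl⟩, fun h => hu' (Fin.ext h), ?_⟩
        rw [hv]
        rwa [bp_ev g S (hu.trans (s2m_bp g S e)) χ (by omega)]
      · refine ⟨_, (s2m g S v d).2, ⟨_, ⟨v, rfl⟩, rfl⟩, fun h => e (Fin.ext h).symm, ?_⟩
        rwa [hv]
  · rintro d w v ⟨c, hc, hcd, h5, hb, hn⟩ e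
    obtain ⟨χ, rfl⟩ := code_box hcd h5
    have l1 := unp2_le (EF.encode eU (.box () χ))
    have l2 := unp2_le (EF.encode eU (.box () χ)).unpair.2
    have e5 : (EF.encode eU (.box () χ)).unpair.2.unpair.2 = EF.encode eU χ := by
      simp [EF.encode]
    rw [e5] at l2 hn
    by_contra hne
    rw [s2m_code g S w d _ (by omega)] at hb
    have := hb v hne
    rw [← bp_ev g S (s2m_bp g S e) χ (by omega), ← s2m_code g S w d χ (by omega)] at this
    exact hn this

end S2M

theorem s2m_final {W D : Type} (S : SM W D) (φ : EF Unit) (w : W) (a : D) (h : ¬ S.ev φ w a) :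
    MValid (sysF (EF.encode eU (UU φ))) (s2m (EF.encode eU (UU φ)) S) := by
  apply s2m_valid
  intro v b
  rw [s2m_code _ S v b (UU φ) le_rfl, SM.ev_UU]
  exact fun hh => h (hh w a)

/-- with finitely many rows, finitely many columns suffice -/
theorem shrink {T W D : Type} [Finite T] [Finite W] (σ : Sys T) (X : W → D → T)
    (hX : MValid σ X) (d0 : D) :
    ∃ (D' : Type) (_ : Finite D') (_ : Nonempty D') (Y : W → D' → T), MValid σ Y := by
  classical
  let f : W × T → D := fun q => if h : ∃ d, X q.1 d = q.2 then h.choose else d0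
  have hf : ∀ w d, X w (f (w, X w d)) = X w d := by
    intro w d
    have h : ∃ d', X w d' = X w d := ⟨d, rfl⟩
    simp only [f]
    rw [dif_pos h]
    exact h.choose_spec
  let D' := {d // d ∈ insert d0 (range f)}
  have hfin : Finite D' := ((finite_range f).insert d0).to_subtype
  refine ⟨D', hfin, ⟨⟨d0, by simp⟩⟩, fun w d => X w d.1, ⟨⟨fun w => ?_, ?_⟩, ⟨?_, ?_⟩⟩⟩
  · have : range (fun d : D' => X w d.1) = range (X w) := by
      ext t
      constructor
      · rintro ⟨d, rfl⟩; exact ⟨_, rfl⟩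
      · rintro ⟨d, rfl⟩
        exact ⟨⟨f (w, X w d), by simp⟩, hf w d⟩
    rw [this]; exact hX.1.1 w
  · intro w d d' hA e
    exact Subtype.ext (hX.1.2 w d.1 d'.1 hA e)
  · intro d
    exact hX.2.1 d.1
  · intro d w w' hB e
    exact hX.2.2 d.1 w w' hB e

theorem D_iff (d : DSem) (φ : EF Unit) : φ ∉ LogED d Dclass ↔
    ∃ (W D : Type) (_ : Nonempty W) (_ : Nonempty D)
      (X : W → D → Fin (Kc (EF.encode eU (UU φ)))), MValid (sysF (EF.encode eU (UU φ))) X := by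
  constructor
  · intro h
    obtain ⟨W, D, S, w, a, h⟩ := D_simple d φ h
    exact ⟨W, D, ⟨w⟩, ⟨a⟩, _, s2m_final S φ w a h⟩
  · rintro ⟨W, D, hW, hD, X, hX⟩
    obtain ⟨S, w, a, h⟩ := m2s_final φ X hX
    exact S.refute d _ (difF_D W) φ w a h

theorem Dfin_iff (d : DSem) (φ : EF Unit) : φ ∉ LogED d DfinClass ↔
    ∃ (W D : Type) (_ : Nonempty W) (_ : Nonempty D) (_ : Finite W) (_ : Finite D)
      (X : W → D → Fin (Kc (EF.encode eU (UU φ)))), MValid (sysF (EF.encode eU (UU φ))) X := by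
  constructor
  · intro h
    obtain ⟨W, D, hW, S, w, a, h⟩ := Dfin_simple d φ h
    obtain ⟨D', h1, h2, Y, hY⟩ := shrink _ _ (s2m_final S φ w a h) a
    exact ⟨W, D', ⟨w⟩, h2, hW, h1, Y, hY⟩
  · rintro ⟨W, D, hW, hD, hW', hD', X, hX⟩
    obtain ⟨S, w, a, h⟩ := m2s_final φ X hX
    exact S.refute d _ (difF_Dfin W) φ w a h

end OneVarEq

set_option linter.unusedSectionVars false

namespace OneVarEq
open Set

theorem bAll_fin {n : ℕ} {p : ℕ → Prop} : bAll n p ↔ ∀ x : Fin n, p x.1 :=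
  ⟨fun h x => h x.1 x.2, fun h x hx => h ⟨x, hx⟩⟩
theorem bEx_fin {n : ℕ} {p : ℕ → Prop} : bEx n p ↔ ∃ x : Fin n, p x.1 :=
  ⟨fun ⟨x, hx, h⟩ => ⟨⟨x, hx⟩, h⟩, fun ⟨x, h⟩ => ⟨x.1, x.2, h⟩⟩

def nA (g e t : ℕ) : Prop := (e = 0 ∧ cA g t) ∨ (e ≠ 0 ∧ cB g t)
def nRR (g e : ℕ) (p : ℕ → Prop) : Prop := (e = 0 ∧ cRR g p) ∨ (e ≠ 0 ∧ cCC g p)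
def nP (g z r t : ℕ) : Prop := t < Kc g ∧ bt z (r * Kc g + t)
def nX (g z s1 s2 r c : ℕ) : ℕ := dg (Kc g) z (r * s1 + c * s2)

def nStub (g b zr zc zx s1 s2 zp r t : ℕ) : Prop :=
  dg 3 zr r ≠ 0 ∧ nP g zp r t ∧ bAll b fun c => Im (Im (dg 3 zr r ≠ 2) (dg 3 zc c ≠ 2))
    (Im (Im (dg 3 zr r = 2) (dg 3 zc c = 0)) (nX g zx s1 s2 r c ≠ t))

def nHC1 (g e a b zr zc zx s1 s2 zp : ℕ) : Prop :=
  (bAll a fun r => bAll b fun c => nP g zp r (nX g zx s1 s2 r c)) ∧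
  (bAll a fun r => nRR g e (nP g zp r)) ∧
  (bAll a fun r => bAll b fun c => Im (dg 3 zr r ≠ 0) (Im (dg 3 zc c ≠ 0)
    (Im (dg 3 zr r = 2 ∨ dg 3 zc c = 2) (¬ nA g e (nX g zx s1 s2 r c))))) ∧
  (bAll a fun r => bAll b fun c => Im (dg 3 zc c = 2) (¬ nA g e (nX g zx s1 s2 r c)))

def nHC2 (g e a b zr zc zx s1 s2 zp zq : ℕ) : Prop :=
  (bAll a fun r => bAll b fun c => bAll b fun c' => Im (nA g e (nX g zx s1 s2 r c))
    (Im (nX g zx s1 s2 r c = nX g zx s1 s2 r c') (c = c'))) ∧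
  (bAll a fun r => Im (dg 3 zr r = 0) (bAll (Kc g) fun t => Im (nP g zp r t)
    (bEx b fun c => dg 3 zc c ≠ 2 ∧ nX g zx s1 s2 r c = t))) ∧
  (bAll (Kc g) fun t => Im ((bEx a fun r => nStub g b zr zc zx s1 s2 zp r t) ∨
    (bEx b fun c => nStub g a zc zr zx s2 s1 zq c t))
    (bEx a fun i => dg 3 zr i = 2 ∧ nP g zp i t ∧
      Im (nA g e t) (nStub g b zr zc zx s1 s2 zp i t)))

section PR
variable {α : Type} [Primcodable α] {f1 f2 f3 f4 f5 f6 f7 f8 f9 f10 f11 : α → ℕ}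

@[fun_prop] theorem pp_nA (h1 : Primrec f1) (h2 : Primrec f2) (h3 : Primrec f3) :
    PP fun a => nA (f1 a) (f2 a) (f3 a) := by unfold nA; fun_prop
@[fun_prop] theorem pp_nRR {p : α → ℕ → Prop} (h1 : Primrec f1) (h2 : Primrec f2)
    (hp : PP fun q : α × ℕ => p q.1 q.2) :
    PP fun a => nRR (f1 a) (f2 a) (p a) := by unfold nRR; fun_prop
@[fun_prop] theorem pp_nP (h1 : Primrec f1) (h2 : Primrec f2) (h3 : Primrec f3) (h4 : Primrec f4) :
    PP fun a => nP (f1 a) (f2 a) (f3 a) (f4 a) := by unfold nP; fun_prop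
@[fun_prop] theorem pr_nX (h1 : Primrec f1) (h2 : Primrec f2) (h3 : Primrec f3) (h4 : Primrec f4)
    (h5 : Primrec f5) (h6 : Primrec f6) :
    Primrec fun a => nX (f1 a) (f2 a) (f3 a) (f4 a) (f5 a) (f6 a) := by unfold nX; fun_prop
@[fun_prop] theorem pp_nStub (h1 : Primrec f1) (h2 : Primrec f2) (h3 : Primrec f3)
    (h4 : Primrec f4) (h5 : Primrec f5) (h6 : Primrec f6) (h7 : Primrec f7) (h8 : Primrec f8)
    (h9 : Primrec f9) (h10 : Primrec f10) :
    PP fun a => nStub (f1 a) (f2 a) (f3 a) (f4 a) (f5 a) (f6 a) (f7 a) (f8 a) (f9 a) (f10 a) := by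
  unfold nStub; fun_prop
@[fun_prop] theorem pp_nHC1 (h1 : Primrec f1) (h2 : Primrec f2) (h3 : Primrec f3)
    (h4 : Primrec f4) (h5 : Primrec f5) (h6 : Primrec f6) (h7 : Primrec f7) (h8 : Primrec f8)
    (h9 : Primrec f9) (h10 : Primrec f10) :
    PP fun a => nHC1 (f1 a) (f2 a) (f3 a) (f4 a) (f5 a) (f6 a) (f7 a) (f8 a) (f9 a) (f10 a) := by
  unfold nHC1; fun_prop
@[fun_prop] theorem pp_nHC2 (h1 : Primrec f1) (h2 : Primrec f2) (h3 : Primrec f3)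
    (h4 : Primrec f4) (h5 : Primrec f5) (h6 : Primrec f6) (h7 : Primrec f7) (h8 : Primrec f8)
    (h9 : Primrec f9) (h10 : Primrec f10) (h11 : Primrec f11) :
    PP fun a => nHC2 (f1 a) (f2 a) (f3 a) (f4 a) (f5 a) (f6 a) (f7 a) (f8 a) (f9 a) (f10 a)
      (f11 a) := by
  unfold nHC2; fun_prop
end PR

def certOK (g km a b zr zc zx zp zq : ℕ) : Prop :=
  (bAll a fun r => dg 3 zr r < km) ∧ (bAll b fun c => dg 3 zc c < km) ∧
  nHC1 g 0 a b zr zc zx b 1 zp ∧ nHC2 g 0 a b zr zc zx b 1 zp zq ∧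
  nHC1 g 1 b a zc zr zx 1 b zq ∧ nHC2 g 1 b a zc zr zx 1 b zq zp

def hasCert (g km B : ℕ) : Prop :=
  bEx (B+1) fun a => bEx (B+1) fun b => 0 < a ∧ 0 < b ∧
    bEx (3^a) fun zr => bEx (3^b) fun zc => bEx (Kc g ^ (a*b)) fun zx =>
    bEx (2^(a * Kc g)) fun zp => bEx (2^(b * Kc g)) fun zq =>
      certOK g km a b zr zc zx zp zq

section PR
variable {α : Type} [Primcodable α] {f1 f2 f3 f4 f5 f6 f7 f8 f9 f10 f11 : α → ℕ}
@[fun_prop] theorem pp_certOK (h1 : Primrec f1) (h2 : Primrec f2) (h3 : Primrec f3)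
    (h4 : Primrec f4) (h5 : Primrec f5) (h6 : Primrec f6) (h7 : Primrec f7) (h8 : Primrec f8)
    (h9 : Primrec f9) :
    PP fun a => certOK (f1 a) (f2 a) (f3 a) (f4 a) (f5 a) (f6 a) (f7 a) (f8 a) (f9 a) := by
  unfold certOK; fun_prop
@[fun_prop] theorem pp_hasCert (h1 : Primrec f1) (h2 : Primrec f2) (h3 : Primrec f3) :
    PP fun a => hasCert (f1 a) (f2 a) (f3 a) := by
  unfold hasCert; fun_prop
end PR

section Corr
variable {g e a b zr zc zx s1 s2 zp zq : ℕ} {kr : Fin a → ℕ} {kc : Fin b → ℕ}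
  {X : Fin a → Fin b → Fin (Kc g)} {P : Fin a → Set (Fin (Kc g))} {Q : Fin b → Set (Fin (Kc g))}

theorem nStub_iff (hr : ∀ r : Fin a, dg 3 zr r.1 = kr r) (hc : ∀ c : Fin b, dg 3 zc c.1 = kc c)
    (hX : ∀ (r : Fin a) (c : Fin b), nX g zx s1 s2 r.1 c.1 = (X r c).1)
    (hP : ∀ (r : Fin a) (t : Fin (Kc g)), nP g zp r.1 t.1 ↔ t ∈ P r) (r : Fin a)
    (t : Fin (Kc g)) : nStub g b zr zc zx s1 s2 zp r.1 t.1 ↔ RStub kr kc X P r t := by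
  unfold nStub RStub Im
  simp only [bAll_fin, hr, hc, hX, hP, ne_eq, Fin.ext_iff]

theorem nHC_iff (σ : Sys (Fin (Kc g))) (hr : ∀ r : Fin a, dg 3 zr r.1 = kr r)
    (hc : ∀ c : Fin b, dg 3 zc c.1 = kc c)
    (hX : ∀ (r : Fin a) (c : Fin b), nX g zx s1 s2 r.1 c.1 = (X r c).1)
    (hX' : ∀ (r : Fin a) (c : Fin b), nX g zx s2 s1 c.1 r.1 = (X r c).1)
    (hP : ∀ (r : Fin a) (t : Fin (Kc g)), nP g zp r.1 t.1 ↔ t ∈ P r)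
    (hQ : ∀ (r : Fin b) (t : Fin (Kc g)), nP g zq r.1 t.1 ↔ t ∈ Q r)
    (hA : ∀ t : Fin (Kc g), nA g e t.1 ↔ σ.A t)
    (hR : ∀ S, nRR g e (fun n => ∃ t ∈ S, t.1 = n) ↔ σ.RR S) :
    (nHC1 g e a b zr zc zx s1 s2 zp ∧ nHC2 g e a b zr zc zx s1 s2 zp zq) ↔
      HCert σ kr kc X P Q := by
  have hs1 := nStub_iff hr hc hX hP
  have hs2 := nStub_iff (X := fun c r => X r c) hc hr (fun c r => hX' r c) hQ
  have hPR : ∀ r : Fin a, nRR g e (nP g zp r.1) ↔ σ.RR (P r) := by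
    intro r
    rw [← hR]
    have : nP g zp r.1 = fun n => ∃ t ∈ P r, t.1 = n := by
      funext n
      apply propext
      constructor
      · intro h
        exact ⟨⟨n, h.1⟩, (hP r ⟨n, h.1⟩).1 h, rfl⟩
      · rintro ⟨t, ht, rfl⟩
        exact (hP r t).2 ht
    rw [this]
  unfold nHC1 nHC2 Im
  simp only [bAll_fin, bEx_fin, hr, hc, hX, hP, hs1, hs2, hA, hPR, ← Fin.ext_iff]
  constructor
  · rintro ⟨⟨h1, h2, h3, h4⟩, h5, h6, h7⟩
    exact ⟨h1, h2, h3, h4, h5, h6, h7⟩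
  · rintro ⟨h1, h2, h3, h4, h5, h6, h7⟩
    exact ⟨⟨h1, h2, h3, h4⟩, h5, h6, h7⟩

theorem certOK_iff {km : ℕ} (hr : ∀ r : Fin a, dg 3 zr r.1 = kr r)
    (hc : ∀ c : Fin b, dg 3 zc c.1 = kc c)
    (hX : ∀ (r : Fin a) (c : Fin b), dg (Kc g) zx (r.1 * b + c.1) = (X r c).1)
    (hP : ∀ (r : Fin a) (t : Fin (Kc g)), bt zp (r.1 * Kc g + t.1) ↔ t ∈ P r)
    (hQ : ∀ (r : Fin b) (t : Fin (Kc g)), bt zq (r.1 * Kc g + t.1) ↔ t ∈ Q r) :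
    certOK g km a b zr zc zx zp zq ↔
      ((∀ r, kr r < km) ∧ (∀ c, kc c < km) ∧ Cert (sysF g) kr kc X P Q) := by
  have hX1 : ∀ (r : Fin a) (c : Fin b), nX g zx b 1 r.1 c.1 = (X r c).1 := by
    intro r c; unfold nX; rw [mul_one]; exact hX r c
  have hX2 : ∀ (r : Fin a) (c : Fin b), nX g zx 1 b c.1 r.1 = (X r c).1 := by
    intro r c; unfold nX; rw [mul_one, add_comm]; exact hX r c
  have hP' : ∀ (r : Fin a) (t : Fin (Kc g)), nP g zp r.1 t.1 ↔ t ∈ P r := by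
    intro r t; unfold nP; rw [hP]; simp
  have hQ' : ∀ (r : Fin b) (t : Fin (Kc g)), nP g zq r.1 t.1 ↔ t ∈ Q r := by
    intro r t; unfold nP; rw [hQ]; simp
  have H1 := nHC_iff (e := 0) (sysF g) hr hc hX1 hX2 hP' hQ' (fun t => by simp [nA, sysF])
    (fun S => by simp [nRR, sysF])
  have H2 := nHC_iff (e := 1) (X := fun c r => X r c) (sysF g).swap hc hr (fun c r => hX2 r c)
    (fun c r => hX1 r c) hQ' hP' (fun t => by simp [nA, sysF, Sys.swap])
    (fun S => by simp [nRR, sysF, Sys.swap])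
  unfold certOK
  rw [bAll_fin, bAll_fin, ← and_assoc (a := nHC1 g 0 _ _ _ _ _ _ _ _), H1, H2]
  simp only [hr, hc]
  constructor
  · rintro ⟨h1, h2, h3, h4⟩
    exact ⟨h1, h2, h3, h4⟩
  · rintro ⟨h1, h2, h3, h4⟩
    exact ⟨h1, h2, h3, h4⟩
end Corr

theorem hasCert_iff (g km B : ℕ) (hkm : km ≤ 3) : hasCert g km B ↔
    ∃ (a b : ℕ) (kr : Fin a → ℕ) (kc : Fin b → ℕ) (Y : Fin a → Fin b → Fin (Kc g))
      (P : Fin a → Set (Fin (Kc g))) (Q : Fin b → Set (Fin (Kc g))),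
      a ≤ B ∧ b ≤ B ∧ 0 < a ∧ 0 < b ∧ (∀ r, kr r < km) ∧ (∀ c, kc c < km) ∧
      Cert (sysF g) kr kc Y P Q := by
  have hK : 0 < Kc g := Nat.two_pow_pos _
  constructor
  · rintro ⟨a, ha, b, hb, ha0, hb0, zr, -, zc, -, zx, -, zp, -, zq, -, h⟩
    rw [certOK_iff (kr := fun r => dg 3 zr r.1) (kc := fun c => dg 3 zc c.1)
      (X := fun r c => ⟨dg (Kc g) zx (r.1 * b + c.1), dg_lt hK _ _⟩)
      (P := fun r => {t | bt zp (r.1 * Kc g + t.1)})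
      (Q := fun r => {t | bt zq (r.1 * Kc g + t.1)}) (fun _ => rfl) (fun _ => rfl)
      (fun _ _ => rfl) (fun _ _ => Iff.rfl) (fun _ _ => Iff.rfl)] at h
    exact ⟨a, b, _, _, _, _, _, by omega, by omega, ha0, hb0, h.1, h.2.1, h.2.2⟩
  · rintro ⟨a, b, kr, kc, Y, P, Q, ha, hb, ha0, hb0, hkr, hkc, h⟩
    obtain ⟨zr, zr1, zr2⟩ := dg_ex 3 a (fun i => if h : i < a then kr ⟨i, h⟩ else 0) (by
      intro i hi; simp only [dif_pos hi]; exact lt_of_lt_of_le (hkr _) hkm)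
    obtain ⟨zc, zc1, zc2⟩ := dg_ex 3 b (fun i => if h : i < b then kc ⟨i, h⟩ else 0) (by
      intro i hi; simp only [dif_pos hi]; exact lt_of_lt_of_le (hkc _) hkm)
    obtain ⟨zx, zx1, zx2⟩ := dg_ex (Kc g) (a*b)
      (fun i => if h : i / b < a then (Y ⟨i / b, h⟩ ⟨i % b, Nat.mod_lt _ hb0⟩).1 else 0) (by
      intro i hi
      have : i / b < a := Nat.div_lt_of_lt_mul (by rwa [mul_comm b a])
      simp only [dif_pos this]; exact Fin.isLt _)
    obtain ⟨zp, zp1, zp2⟩ := bt_ex (a * Kc g) (fun i => ∃ h : i / Kc g < a,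
      (⟨i % Kc g, Nat.mod_lt _ hK⟩ : Fin (Kc g)) ∈ P ⟨i / Kc g, h⟩)
    obtain ⟨zq, zq1, zq2⟩ := bt_ex (b * Kc g) (fun i => ∃ h : i / Kc g < b,
      (⟨i % Kc g, Nat.mod_lt _ hK⟩ : Fin (Kc g)) ∈ Q ⟨i / Kc g, h⟩)
    have lin : ∀ {x y m n : ℕ}, x < m → y < n → x * n + y < m * n := by
      intro x y m n hx hy
      calc x * n + y < x * n + n := by omega
        _ = (x+1) * n := by ring
        _ ≤ m * n := Nat.mul_le_mul_right _ hx
    have dv : ∀ {x y n : ℕ}, y < n → (x * n + y) / n = x := by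
      intro x y n hy
      rw [add_comm, Nat.add_mul_div_right _ _ (by omega), Nat.div_eq_of_lt hy, zero_add]
    have md : ∀ {x y n : ℕ}, y < n → (x * n + y) % n = y := by
      intro x y n hy
      rw [add_comm, Nat.add_mul_mod_self_right, Nat.mod_eq_of_lt hy]
    refine ⟨a, by omega, b, by omega, ha0, hb0, zr, zr1, zc, zc1, zx, zx1, zp, zp1, zq, zq1, ?_⟩
    change certOK g km a b zr zc zx zp zq
    rw [certOK_iff (kr := kr) (kc := kc) (X := Y) (P := P) (Q := Q)]
    · exact ⟨hkr, hkc, h⟩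
    · intro r; rw [zr2 r.1 r.2, dif_pos r.2]
    · intro r; rw [zc2 r.1 r.2, dif_pos r.2]
    · intro r c
      rw [zx2 _ (lin r.2 c.2), dif_pos (by rw [dv c.2]; exact r.2)]
      congr 2
      · exact Fin.ext (dv c.2)
      · exact Fin.ext (md c.2)
    · intro r t
      rw [zp2 _ (lin r.2 t.2)]
      simp only [dv t.2, md t.2]
      exact ⟨fun ⟨_, h⟩ => h, fun h => ⟨r.2, h⟩⟩
    · intro r t
      rw [zq2 _ (lin r.2 t.2)]
      simp only [dv t.2, md t.2]
      exact ⟨fun ⟨_, h⟩ => h, fun h => ⟨r.2, h⟩⟩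

theorem cert_zero {T R C : Type} (σ : Sys T) (kr : R → ℕ) (kc : C → ℕ) (hr : ∀ r, kr r < 1)
    (hc : ∀ c, kc c < 1) (Y : R → C → T) :
    (∃ P Q, Cert σ kr kc Y P Q) ↔ MValid σ Y := by
  have key : ∀ {R C : Type} (σ : Sys T) (kr : R → ℕ) (kc : C → ℕ), (∀ r, kr r < 1) →
      (∀ c, kc c < 1) → ∀ Y : R → C → T,
      (∀ P Q, HCert σ kr kc Y P Q → HValid σ Y) ∧ (∀ Q, HValid σ Y →
        HCert σ kr kc Y (fun r => range (Y r)) Q) := by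
    intro R C σ kr kc hr hc Y
    have hr' : ∀ r, kr r = 0 := fun r => by have := hr r; omega
    have hc' : ∀ c, kc c = 0 := fun c => by have := hc c; omega
    refine ⟨fun P Q h => ⟨fun r => ?_, h.exact'⟩, fun Q h => ?_⟩
    · have : range (Y r) = P r := by
        ext t
        constructor
        · rintro ⟨c, rfl⟩; exact h.mem r c
        · intro ht
          obtain ⟨c, -, e⟩ := h.closed r (hr' r) t ht
          exact ⟨c, e⟩
      rw [this]; exact h.rr r
    · refine ⟨fun r c => ⟨c, rfl⟩, h.1, ?_, ?_, h.2, ?_, ?_⟩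
      · intro r c h0; exact absurd (hr' r) h0
      · intro r c h0; rw [hc' c] at h0; omega
      · rintro r - _ ⟨c, rfl⟩
        exact ⟨c, by rw [hc' c]; omega, rfl⟩
      · rintro t (⟨r, h0, -⟩ | ⟨c, h0, -⟩)
        · exact absurd (hr' r) h0
        · exact absurd (hc' c) h0
  constructor
  · rintro ⟨P, Q, h⟩
    exact ⟨(key σ kr kc hr hc Y).1 P Q h.row,
      (key σ.swap kc kr hc hr (fun c r => Y r c)).1 Q P h.col⟩
  · intro h
    exact ⟨_, _, (key σ kr kc hr hc Y).2 (fun c => range (fun r => Y r c)) h.1,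
      (key σ.swap kc kr hc hr (fun c r => Y r c)).2 (fun r => range (Y r)) h.2⟩

theorem D_cert (g : ℕ) : hasCert g 3 (BdN (Kc g) 1) ↔
    ∃ (W D : Type) (_ : Nonempty W) (_ : Nonempty D)
      (X : W → D → Fin (Kc g)), MValid (sysF g) X := by
  rw [hasCert_iff g 3 _ le_rfl]
  constructor
  · rintro ⟨a, b, kr, kc, Y, P, Q, ha, hb, ha0, hb0, hkr, hkc, h⟩
    obtain ⟨Z, hZ⟩ := realise_inf h
    exact ⟨_, _, ⟨⟨(⟨0, ha0⟩, 0), Or.inr rfl⟩⟩, ⟨⟨(⟨0, hb0⟩, 0), Or.inr rfl⟩⟩, Z, hZ⟩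
  · rintro ⟨W, D, _, _, X, hX⟩
    have := extract_inf (sysF g) X hX
    rw [Fintype.card_fin] at this
    exact this

theorem Dfin_cert (g : ℕ) : hasCert g 1 (BfN (Kc g)) ↔
    ∃ (W D : Type) (_ : Nonempty W) (_ : Nonempty D) (_ : Finite W) (_ : Finite D)
      (X : W → D → Fin (Kc g)), MValid (sysF g) X := by
  rw [hasCert_iff g 1 _ (by omega)]
  constructor
  · rintro ⟨a, b, kr, kc, Y, P, Q, ha, hb, ha0, hb0, hkr, hkc, h⟩
    exact ⟨Fin a, Fin b, ⟨⟨0, ha0⟩⟩, ⟨⟨0, hb0⟩⟩, inferInstance, inferInstance, Y,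
      (cert_zero _ kr kc hkr hkc Y).1 ⟨P, Q, h⟩⟩
  · rintro ⟨W, D, _, _, _, _, X, hX⟩
    obtain ⟨a, b, Y, ha, hb, ha0, hb0, hY⟩ := extract_fin (sysF g) X hX
    rw [Fintype.card_fin] at ha hb
    obtain ⟨P, Q, h⟩ := (cert_zero (sysF g) (fun _ => 0) (fun _ => 0) (fun _ => one_pos)
      (fun _ => one_pos) Y).2 hY
    exact ⟨a, b, _, _, Y, P, Q, ha, hb, ha0, hb0, fun _ => one_pos, fun _ => one_pos, h⟩

end OneVarEq

set_option linter.unusedSectionVars false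

namespace OneVarEq
open Set

/-! ### The bounds are primitive recursive -/
section PR
variable {α : Type} [Primcodable α] {f1 f2 f3 : α → ℕ}

@[fun_prop] theorem pr_uuB (h1 : Primrec f1) (h2 : Primrec f2) :
    Primrec fun a => uuB (f1 a) (f2 a) := by unfold uuB; fun_prop
@[fun_prop] theorem pr_bdN (h1 : Primrec f1) (h2 : Primrec f2) (h3 : Primrec f3) :
    Primrec fun a => bdN (f1 a) (f2 a) (f3 a) := by unfold bdN; fun_prop
@[fun_prop] theorem pr_zh (h1 : Primrec f1) : Primrec fun a => zh (f1 a) := by unfold zh; fun_prop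

@[fun_prop] theorem pr_Nn (h1 : Primrec f1) (h2 : Primrec f2) (h3 : Primrec f3) :
    Primrec fun a => Nn (f1 a) (f2 a) (f3 a) := by
  have hs : Primrec₂ fun (a : α) (q : ℕ × ℕ) =>
      q.2 + (2 * f1 a + 1) + uuB (f1 a) q.2 * f2 a := by
    have : Primrec fun (p : α × (ℕ × ℕ)) =>
      p.2.2 + (2 * f1 p.1 + 1) + uuB (f1 p.1) p.2.2 * f2 p.1 := by fun_prop
    exact this
  have := Primrec.nat_rec' h3 (Primrec.const 0) hs
  refine this.of_eq (fun a => ?_)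
  generalize f3 a = n
  induction n with
  | zero => rfl
  | succ n ih => simp only [ih, Nn]

theorem zg_iter (n : ℕ) : ∀ M c : ℕ,
    ((fun q : ℕ × ℕ => (q.1 * zh q.1, q.2 * zh q.1))^[n] (M, c)).2 = c * zg n M := by
  induction n with
  | zero => intro M c; simp [zg]
  | succ n ih => intro M c; rw [Function.iterate_succ_apply, ih, zg, mul_assoc]

@[fun_prop] theorem pr_zg (h1 : Primrec f1) (h2 : Primrec f2) :
    Primrec fun a => zg (f1 a) (f2 a) := by
  have hs : Primrec₂ fun (_ : α) (q : ℕ × ℕ) => (q.1 * zh q.1, q.2 * zh q.1) := by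
    have : Primrec fun (p : α × (ℕ × ℕ)) => (p.2.1 * zh p.2.1, p.2.2 * zh p.2.1) := by fun_prop
    exact this
  have := Primrec.nat_iterate h1 (h2.pair (Primrec.const 1)) hs
  refine (Primrec.snd.comp this).of_eq (fun a => ?_)
  rw [zg_iter, one_mul]

@[fun_prop] theorem pr_BdN (h1 : Primrec f1) (h2 : Primrec f2) :
    Primrec fun a => BdN (f1 a) (f2 a) := by unfold BdN; fun_prop
@[fun_prop] theorem pr_BfN (h1 : Primrec f1) : Primrec fun a => BfN (f1 a) := by
  unfold BfN; fun_prop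
end PR

/-! ### Codes of derived connectives -/
def nall (m : ℕ) : ℕ := Nat.pair 2 (Nat.pair 4 (Nat.pair 2 m))
def nUU (m : ℕ) : ℕ := Nat.pair 3 (Nat.pair (nall m) (Nat.pair 5 (Nat.pair 0 (nall m))))
def nimp (m n : ℕ) : ℕ := Nat.pair 2 (Nat.pair 3 (Nat.pair m (Nat.pair 2 n)))

theorem enc_UU (φ : EF Unit) : EF.encode eU (UU φ) = nUU (EF.encode eU φ) := rfl
theorem enc_imp (φ ψ : EF Unit) :
    EF.encode eU (EF.imp φ ψ) = nimp (EF.encode eU φ) (EF.encode eU ψ) := rfl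

section PR
variable {α : Type} [Primcodable α] {f1 f2 f3 : α → ℕ}
@[fun_prop] theorem pr_nall (h1 : Primrec f1) : Primrec fun a => nall (f1 a) := by
  unfold nall; fun_prop
@[fun_prop] theorem pr_nUU (h1 : Primrec f1) : Primrec fun a => nUU (f1 a) := by
  unfold nUU; fun_prop
@[fun_prop] theorem pr_nimp (h1 : Primrec f1) (h2 : Primrec f2) :
    Primrec fun a => nimp (f1 a) (f2 a) := by
  unfold nimp; fun_prop
end PR

/-- numeric refutability for the two classes -/
def refD (n : ℕ) : Prop := hasCert (nUU n) 3 (BdN (Kc (nUU n)) 1)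
def refDfin (n : ℕ) : Prop := hasCert (nUU n) 1 (BfN (Kc (nUU n)))

@[fun_prop] theorem pp_refD {α : Type} [Primcodable α] {f : α → ℕ} (hf : Primrec f) :
    PP fun a => refD (f a) := by unfold refD; fun_prop
@[fun_prop] theorem pp_refDfin {α : Type} [Primcodable α] {f : α → ℕ} (hf : Primrec f) :
    PP fun a => refDfin (f a) := by unfold refDfin; fun_prop

theorem refD_iff (d : DSem) (φ : EF Unit) : refD (EF.encode eU φ) ↔ φ ∉ LogED d Dclass := by
  rw [D_iff, refD, ← enc_UU, D_cert]
theorem refDfin_iff (d : DSem) (φ : EF Unit) :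
    refDfin (EF.encode eU φ) ↔ φ ∉ LogED d DfinClass := by
  rw [Dfin_iff, refDfin, ← enc_UU, Dfin_cert]

theorem PP.toComp {α : Type} [Primcodable α] {p : α → Prop} (h : PP p) : ComputablePred p := by
  obtain ⟨h1, h2⟩ := h
  exact ⟨h1, h2.to_comp⟩

theorem gen_dec (L : Set (EF Unit)) (ref : ℕ → Prop)
    (href : ∀ φ, ref (EF.encode eU φ) ↔ φ ∉ L) 
    (hp : PP fun n : ℕ => ref n) : DecidableELogic eU L := by
  have h : PP fun n : ℕ => isCode n ∧ ¬ ref n := by fun_prop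
  refine (PP.toComp h).of_eq (fun n => ?_)
  constructor
  · rintro ⟨hc, hn⟩
    obtain ⟨φ, rfl⟩ := (isCode_iff n).1 hc
    rw [href, not_not] at hn
    exact ⟨φ, hn, rfl⟩
  · rintro ⟨φ, hφ, rfl⟩
    exact ⟨(isCode_iff _).2 ⟨φ, rfl⟩, by rw [href, not_not]; exact hφ⟩

theorem gen_gdec (L : Set (EF Unit)) (ref : ℕ → Prop)
    (href : ∀ φ, ref (EF.encode eU φ) ↔ φ ∉ L) 
    (hp : PP fun p : ℕ × ℕ => ref (nimp (nUU p.1) p.2))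
    (hL : ∀ φ ψ, GlobalConseqE L φ ψ ↔ EF.imp (UU φ) ψ ∈ L) : GloballyDecidableE eU L := by
  have h : PP fun p : ℕ × ℕ => isCode p.1 ∧ isCode p.2 ∧ ¬ ref (nimp (nUU p.1) p.2) :=
    pp_and (pp_isCode (by fun_prop)) (pp_and (pp_isCode (by fun_prop)) (pp_not hp))
  refine (PP.toComp h).of_eq (fun p => ?_)
  obtain ⟨m, n⟩ := p
  constructor
  · rintro ⟨hc, hc', hn⟩
    obtain ⟨φ, rfl⟩ := (isCode_iff m).1 hc
    obtain ⟨ψ, rfl⟩ := (isCode_iff n).1 hc'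
    simp only [← enc_UU, ← enc_imp] at hn
    rw [href, not_not] at hn
    exact ⟨φ, ψ, (hL _ _).2 hn, rfl, rfl⟩
  · rintro ⟨φ, ψ, hc, h1, h2⟩
    simp only at h1 h2 ⊢
    subst h1 h2
    refine ⟨(isCode_iff _).2 ⟨φ, rfl⟩, (isCode_iff _).2 ⟨ψ, rfl⟩, ?_⟩
    rw [← enc_UU, ← enc_imp, href, not_not]
    exact (hL _ _).1 hc

/-! ### Global consequence -/
theorem eval_UU {F : KFrame Unit} (𝔪 : EModel F) (w : F.W) (a : 𝔪.D) (φ : EF Unit) :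
    𝔪.eval (UU φ) w a ↔ (∀ b ∈ 𝔪.dom w, 𝔪.eval φ w b) ∧
      ∀ v, F.R () w v → ∀ b ∈ 𝔪.dom v, 𝔪.eval φ v b := by
  unfold UU
  rw [eval_and, eval_all]
  simp only [EModel.eval, eval_all]

theorem conseq_iff (d : DSem) (C : Set (KFrame Unit)) (hC : C ⊆ Dclass) (φ ψ : EF Unit) :
    GlobalConseqE (LogED d C) φ ψ ↔ EF.imp (UU φ) ψ ∈ LogED d C := by
  constructor
  · intro h
    induction h with
    | ax h =>
      intro F hF 𝔪 hd w a ha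
      exact (eval_imp 𝔪 w a _ _).2 fun _ => h F hF 𝔪 hd w a ha
    | prem =>
      intro F hF 𝔪 hd w a ha
      exact (eval_imp 𝔪 w a _ _).2 fun h => ((eval_UU 𝔪 w a φ).1 h).1 a ha
    | mp _ _ ih1 ih2 =>
      intro F hF 𝔪 hd w a ha
      refine (eval_imp 𝔪 w a _ _).2 fun h => ?_
      exact (eval_imp 𝔪 w a _ _).1 ((eval_imp 𝔪 w a _ _).1 (ih1 F hF 𝔪 hd w a ha) h)
        ((eval_imp 𝔪 w a _ _).1 (ih2 F hF 𝔪 hd w a ha) h)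
    | gen _ ih =>
      intro F hF 𝔪 hd w a ha
      refine (eval_imp 𝔪 w a _ _).2 fun h => (eval_all 𝔪 w a _).2 fun b hb => ?_
      refine (eval_imp 𝔪 w b _ _).1 (ih F hF 𝔪 hd w b hb) ?_
      rw [eval_UU] at h ⊢
      exact h
    | nec m _ ih =>
      intro F hF 𝔪 hd w a ha
      refine (eval_imp 𝔪 w a _ _).2 fun h v hv => ?_
      refine (eval_imp 𝔪 v a _ _).1 (ih F hF 𝔪 hd v a (𝔪.expand _ _ _ hv ha)) ?_
      rw [eval_UU] at h ⊢
      obtain ⟨ι, f, hf⟩ := hC hF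
      refine ⟨h.2 v hv, fun u hu => ?_⟩
      by_cases e : w = u
      · exact e ▸ h.1
      · exact h.2 u ((hf w u).2 ⟨((hf w v).1 hv).1.trans ((hf v u).1 hu).1, e⟩)
  · intro h
    have h1 : GlobalConseqE (LogED d C) φ (EF.all φ) := .gen .prem
    have h2 : GlobalConseqE (LogED d C) φ (.box () (EF.all φ)) := .nec () h1
    have h3 : GlobalConseqE (LogED d C) φ
        (EF.imp (EF.all φ) (EF.imp (.box () (EF.all φ)) (UU φ))) := by
      refine .ax fun F hF 𝔪 hd w a ha => ?_
      rw [eval_imp, eval_imp]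
      exact fun h1 h2 => ⟨h1, h2⟩
    exact .mp (.ax h) (.mp (.mp h3 h1) h2)

/-! ### Closure under disjoint unions -/
theorem DfinD : DfinClass ⊆ Dclass := fun _ ⟨ι, f, h, _⟩ => ⟨ι, f, h⟩

theorem du_rel {ι : Type} (hι : Nonempty ι) (Fs : ι → KFrame Unit) (κ : ι → Type)
    (f : ∀ i, (Fs i).W → κ i)
    (hf : ∀ i w v, (Fs i).R () w v ↔ (f i w = f i v ∧ w ≠ v))
    (w v : (KFrame.disjUnion hι Fs).W) : (KFrame.disjUnion hι Fs).R () w v ↔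
      ((⟨w.1, f w.1 w.2⟩ : Σ i, κ i) = ⟨v.1, f v.1 v.2⟩ ∧ w ≠ v) := by
  obtain ⟨i, w⟩ := w
  obtain ⟨j, v⟩ := v
  constructor
  · rintro ⟨k, x, y, h, h1, h2⟩
    cases h1
    cases h2
    obtain ⟨h3, h4⟩ := (hf _ _ _).1 h
    refine ⟨by simp [h3], fun e => h4 ?_⟩
    cases e
    rfl
  · rintro ⟨h1, h2⟩
    have e : i = j := congrArg Sigma.fst h1
    subst e
    have h3 : f i w = f i v := by simpa using h1
    exact ⟨i, w, v, (hf i w v).2 ⟨h3, fun e => h2 (by rw [e])⟩, rfl, rfl⟩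

theorem closed_D : ClosedDU Dclass := by
  intro ι hι Fs h
  choose κ f hf using h
  exact ⟨Σ i, κ i, _, du_rel hι Fs κ f hf⟩

theorem closed_Dfin : ClosedDU DfinClass := by
  intro ι hι Fs h
  choose κ f hf hfin using h
  refine ⟨Σ i, κ i, _, du_rel hι Fs κ f hf, ?_⟩
  rintro ⟨i, w⟩
  refine ((hfin i w).image (fun v => (⟨i, v⟩ : Σ i, (Fs i).W))).subset ?_
  rintro ⟨j, v⟩ h
  have h1 : (⟨j, f j v⟩ : Σ i, κ i) = ⟨i, f i w⟩ := h
  have e : j = i := congrArg Sigma.fst h1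
  subst e
  exact ⟨v, by simpa using h1, rfl⟩

theorem main_all (d : DSem) :
    ClosedDU Dclass ∧ ClosedDU DfinClass ∧
    DecidableELogic eU (LogED d Dclass) ∧
    DecidableELogic eU (LogED d DfinClass) ∧
    GloballyDecidableE eU (LogED d Dclass) ∧
    GloballyDecidableE eU (LogED d DfinClass) ∧
    REELogic eU (LogED d Dclass) ∧
    REELogic eU (LogED d DfinClass) ∧
    ¬ DecidableELogic eUU (LogED d (frameFusion Dclass DfinClass)) ∧
    ¬ GloballyDecidableE eUU (LogED d (frameFusion Dclass DfinClass)) ∧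
    ¬ REELogic eUU (LogED d (frameFusion Dclass DfinClass)) := by
  have h1 := gen_dec _ refD (refD_iff d) (by fun_prop)
  have h2 := gen_dec _ refDfin (refDfin_iff d) (by fun_prop)
  exact ⟨closed_D, closed_Dfin, h1, h2,
    gen_gdec _ refD (refD_iff d) (by fun_prop) (conseq_iff d _ subset_rfl),
    gen_gdec _ refDfin (refDfin_iff d) (by fun_prop) (conseq_iff d _ DfinD),
    ComputablePred.to_re h1, ComputablePred.to_re h2,
    fus_not_dec d, fus_not_gdec d, fus_not_re d⟩

end OneVarEq

namespace OneVarEq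

/-- For each `d ∈ {xd, cd}`: with `𝒞1 = 𝒟` and `𝒞2 = 𝒟_fin`
(classes closed under disjoint unions), the component logics `Log^=_d 𝒞_i` are
decidable, globally decidable, and recursively enumerable, while
`Log^=_d (𝒞1 ⊗ 𝒞2)` is undecidable, has undecidable global consequence, and is
not recursively enumerable.  Hence decidability, global decidability, and
recursive axiomatisability are not preserved under
`(Log^=_d 𝒞1, Log^=_d 𝒞2) ↦ Log^=_d (𝒞1 ⊗ 𝒞2)`. -/
theorem no_preservation_with_equality (d : DSem) :
    ClosedDU Dclass ∧ ClosedDU DfinClass ∧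
    DecidableELogic eU (LogED d Dclass) ∧
    DecidableELogic eU (LogED d DfinClass) ∧
    GloballyDecidableE eU (LogED d Dclass) ∧
    GloballyDecidableE eU (LogED d DfinClass) ∧
    REELogic eU (LogED d Dclass) ∧
    REELogic eU (LogED d DfinClass) ∧
    ¬ DecidableELogic eUU (LogED d (frameFusion Dclass DfinClass)) ∧
    ¬ GloballyDecidableE eUU (LogED d (frameFusion Dclass DfinClass)) ∧
    ¬ REELogic eUU (LogED d (frameFusion Dclass DfinClass)) := by
  exact main_all d

end OneVarEq
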